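/- Let 𝓗 be a simple arrangement of topoplanes in ℝⁿ, meaning that for every flat Y of 𝓗 the number of topoplanes of 𝓗 containing Y equals n − dim Y. Then there exists an affine arrangement of topoplanes 𝓗' in ℝⁿ whose k-skeleton equals the k-skeleton of 𝓗 for every k with 0 ≤ k ≤ n. -/

import Mathlib

open Set

/-- The `i`-th coordinate hyperplane in `ℝⁿ` (by convention the whole space if `i ≥ n`). -/
def coordHyp (n i : ℕ) : Set (Fin n → ℝ) := {x | ∀ h : i < n, x ⟨i, h⟩ = 0}

/-- `H` is a topological hyperplane (topoplane) in `ℝⁿ`: some self-homeomorphism of `ℝⁿ`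
carries `H` onto the coordinate hyperplane `{x | x₁ = 0}`. -/
def IsTopoplane {n : ℕ} (H : Set (Fin n → ℝ)) : Prop :=
  ∃ e : (Fin n → ℝ) ≃ₜ (Fin n → ℝ), e '' H = coordHyp n 0

/-- `Z` is a relative topoplane in `Y ⊆ ℝⁿ`: `Z ⊆ Y` and some homeomorphism of `Y`
(with the subspace topology) onto some `ℝᵈ`, `d ≥ 1`, carries `Z` onto `{x | x₁ = 0}`. -/
def IsRelTopoplane {n : ℕ} (Y Z : Set (Fin n → ℝ)) : Prop :=
  Z ⊆ Y ∧ ∃ d : ℕ, 1 ≤ d ∧ ∃ φ : Y ≃ₜ (Fin d → ℝ),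
    φ '' {y : Y | (y : Fin n → ℝ) ∈ Z} = coordHyp d 0

/-- `Y` is a flat of the family `𝓗`: a nonempty intersection of a subfamily of `𝓗`
(the empty intersection being all of `ℝⁿ`). -/
def IsFlat {n : ℕ} (𝓗 : Set (Set (Fin n → ℝ))) (Y : Set (Fin n → ℝ)) : Prop :=
  (∃ 𝓢 ⊆ 𝓗, Y = ⋂₀ 𝓢) ∧ Y.Nonempty

/-- `𝓗` is an arrangement of topoplanes in `ℝⁿ`: a finite set of topoplanes such that for
every `H ∈ 𝓗` and every flat `Y`, either `Y ⊆ H`, or `H ∩ Y = ∅`, or `H ∩ Y` is a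
relative topoplane in `Y`. -/
def IsArrangement {n : ℕ} (𝓗 : Set (Set (Fin n → ℝ))) : Prop :=
  𝓗.Finite ∧ (∀ H ∈ 𝓗, IsTopoplane H) ∧
    ∀ H ∈ 𝓗, ∀ Y : Set (Fin n → ℝ), IsFlat 𝓗 Y →
      Y ⊆ H ∨ H ∩ Y = ∅ ∨ IsRelTopoplane Y (H ∩ Y)

/-- `Y` has dimension `d`: it is homeomorphic, in the subspace topology, to `ℝᵈ`. -/
def HasDim {n : ℕ} (Y : Set (Fin n → ℝ)) (d : ℕ) : Prop :=
  Nonempty (Y ≃ₜ (Fin d → ℝ))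

/-- Topoplanes `H₁`, `H₂` cross: some self-homeomorphism of `ℝⁿ` carries them
simultaneously onto the coordinate hyperplanes `{x | x₁ = 0}` and `{x | x₂ = 0}`. -/
def Crosses {n : ℕ} (H₁ H₂ : Set (Fin n → ℝ)) : Prop :=
  ∃ e : (Fin n → ℝ) ≃ₜ (Fin n → ℝ), e '' H₁ = coordHyp n 0 ∧ e '' H₂ = coordHyp n 1

/-- The pairwise condition for an arrangement to be affine: any two distinct members
are disjoint or cross. -/
def PairwiseAffine {n : ℕ} (𝓗 : Set (Set (Fin n → ℝ))) : Prop :=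
  ∀ H₁ ∈ 𝓗, ∀ H₂ ∈ 𝓗, H₁ ≠ H₂ → H₁ ∩ H₂ = ∅ ∨ Crosses H₁ H₂

/-- The `k`-skeleton of an arrangement: the union of all flats of dimension at most `k`. -/
def skeleton {n : ℕ} (𝓗 : Set (Set (Fin n → ℝ))) (k : ℕ) : Set (Fin n → ℝ) :=
  ⋃₀ {Y | IsFlat 𝓗 Y ∧ ∃ d ≤ k, HasDim Y d}

open Filter Topology

theorem fiberwise_isOpenEmbedding {P : Type*} [TopologicalSpace P] {h : P × ℝ → ℝ}
    (hc : Continuous h) (hm : ∀ p, StrictMono fun t => h (p, t)) :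
    IsOpenEmbedding fun x : P × ℝ => (x.1, h x) := by
  refine .of_continuous_injective_isOpenMap (by fun_prop) ?_ ?_
  · rintro ⟨p, s⟩ ⟨q, t⟩ hpq
    simp only [Prod.mk.injEq] at hpq
    obtain ⟨rfl, h2⟩ := hpq
    exact Prod.ext rfl ((hm p).injective h2)
  · refine IsOpenMap.of_nhds_le ?_
    rintro ⟨p, t⟩ U hU
    rw [mem_map, nhds_prod_eq] at hU
    obtain ⟨A, hA, B, hB, hAB⟩ := mem_prod_iff.1 hU
    obtain ⟨a, b, ⟨ha, hb⟩, hab⟩ := mem_nhds_iff_exists_Ioo_subset.1 hB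
    obtain ⟨a', ha1, ha2⟩ := exists_between ha
    obtain ⟨b', hb1, hb2⟩ := exists_between hb
    have e1 : ∀ᶠ y in 𝓝 ((p, h (p, t)) : P × ℝ), h (y.1, a') < y.2 :=
      ContinuousAt.eventually_lt (by fun_prop) (by fun_prop) (hm p ha2)
    have e2 : ∀ᶠ y in 𝓝 ((p, h (p, t)) : P × ℝ), y.2 < h (y.1, b') :=
      ContinuousAt.eventually_lt (by fun_prop) (by fun_prop) (hm p hb1)
    have e3 : ∀ᶠ y in 𝓝 ((p, h (p, t)) : P × ℝ), y.1 ∈ A := continuousAt_fst hA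
    filter_upwards [e1, e2, e3] with y h1 h2 h3
    have hcont : ContinuousOn (fun t => h (y.1, t)) (Icc a' b') :=
      Continuous.continuousOn (by fun_prop)
    obtain ⟨u, hu, hu'⟩ := intermediate_value_Icc (ha2.le.trans hb1.le) hcont ⟨h1.le, h2.le⟩
    have : (y.1, u) ∈ A ×ˢ B := ⟨h3, hab ⟨ha1.trans_le hu.1, hu.2.trans_lt hb2⟩⟩
    have := hAB this
    simp only [mem_preimage] at this
    simp only at hu'
    rwa [hu'] at this

theorem exists_extend_homeomorph {X Z : Type*} [TopologicalSpace X] [TopologicalSpace Z]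
    {ψ₁ ψ₂ : X → Z} (h₁ : IsOpenEmbedding ψ₁) (h₂ : IsOpenEmbedding ψ₂)
    (hr : range ψ₁ = range ψ₂) (f : X ≃ₜ X)
    (hl₁ : ∀ y ∉ range ψ₁, Tendsto (ψ₂ ∘ f) (comap ψ₁ (𝓝 y)) (𝓝 y))
    (hl₂ : ∀ y ∉ range ψ₁, Tendsto (ψ₁ ∘ f.symm) (comap ψ₂ (𝓝 y)) (𝓝 y)) :
    ∃ g : Z ≃ₜ Z, (∀ x, g (ψ₁ x) = ψ₂ (f x)) ∧ ∀ y ∉ range ψ₁, g y = y := by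
  have key : ∀ (φ₁ φ₂ : X → Z), IsOpenEmbedding φ₁ → IsOpenEmbedding φ₂ → ∀ f : X ≃ₜ X,
      (∀ y ∉ range φ₁, Tendsto (φ₂ ∘ f) (comap φ₁ (𝓝 y)) (𝓝 y)) →
      Continuous (Function.extend φ₁ (φ₂ ∘ f) id) := by
    intro φ₁ φ₂ h₁ h₂ f hl
    rw [continuous_iff_continuousAt]
    intro y
    by_cases hy : y ∈ range φ₁
    · obtain ⟨x, rfl⟩ := hy
      have h5 : Function.extend φ₁ (φ₂ ∘ f) id ∘ φ₁ = φ₂ ∘ f :=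
        funext fun x => h₁.injective.extend_apply _ _ _
      rw [← h₁.continuousAt_iff, h5]
      exact (h₂.continuous.comp f.continuous).continuousAt
    · have hy' : Function.extend φ₁ (φ₂ ∘ f) id y = y := Function.extend_apply' _ _ _ hy
      rw [ContinuousAt, hy']
      intro U hU
      have h3 := hl y hy hU
      rw [mem_map, mem_comap] at h3
      obtain ⟨W, hW, hWU⟩ := h3
      rw [mem_map]
      filter_upwards [hW, hU] with z hz hzU
      by_cases hz' : z ∈ range φ₁
      · obtain ⟨x, rfl⟩ := hz'
        rw [mem_preimage, h₁.injective.extend_apply]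
        exact hWU hz
      · rw [mem_preimage, Function.extend_apply' _ _ _ hz']
        exact hzU
  have inv : ∀ (φ₁ φ₂ : X → Z), IsOpenEmbedding φ₁ → IsOpenEmbedding φ₂ →
      range φ₁ = range φ₂ → ∀ (f : X ≃ₜ X) y,
      Function.extend φ₂ (φ₁ ∘ f.symm) id (Function.extend φ₁ (φ₂ ∘ f) id y) = y := by
    intro φ₁ φ₂ h₁ h₂ hr f y
    by_cases hy : y ∈ range φ₁
    · obtain ⟨x, rfl⟩ := hy
      rw [h₁.injective.extend_apply, Function.comp_apply, h₂.injective.extend_apply]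
      simp
    · have hy' : y ∉ range φ₂ := hr ▸ hy
      rw [Function.extend_apply' _ _ _ hy, id, Function.extend_apply' _ _ _ hy', id]
  refine ⟨⟨⟨Function.extend ψ₁ (ψ₂ ∘ f) id, Function.extend ψ₂ (ψ₁ ∘ f.symm) id,
    inv _ _ h₁ h₂ hr f, inv _ _ h₂ h₁ hr.symm f.symm⟩, key _ _ h₁ h₂ f hl₁,
    key _ _ h₂ h₁ f.symm (hr ▸ hl₂)⟩, fun x => ?_, fun y hy => ?_⟩
  · exact h₁.injective.extend_apply _ _ _
  · exact Function.extend_apply' _ _ _ hy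

theorem abs_log_sub_log_le {a b m : ℝ} (hm : 0 < m) (ha : m ≤ a) (hb : m ≤ b) :
    |Real.log a - Real.log b| ≤ |a - b| / m := by
  have key : ∀ a b : ℝ, m ≤ a → m ≤ b → Real.log a - Real.log b ≤ |a - b| / m := by
    intro a b ha hb
    have ha' := hm.trans_le ha
    have hb' := hm.trans_le hb
    rw [← Real.log_div ha'.ne' hb'.ne']
    refine (Real.log_le_sub_one_of_pos (by positivity)).trans ?_
    rw [div_sub_one hb'.ne']
    calc (a - b) / b ≤ |a - b| / b := by gcongr; exact le_abs_self _
      _ ≤ |a - b| / m := by gcongr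
  rw [abs_le]
  constructor
  · have := key b a hb ha
    rw [abs_sub_comm] at this
    linarith
  · exact key a b ha hb

/-- A radial coordinate on the complement of the zero section of `V × ℂ`: for every `v : V` an
increasing reparametrization of the line on which `-log ‖z‖` lives. -/
structure RadialScale (V : Type*) [TopologicalSpace V] where
  /-- The reparametrization, fibred over `V`. -/
  toHomeo : (V × ℝ) ≃ₜ (V × ℝ)
  fst_eq : ∀ p, (toHomeo p).1 = p.1
  mono : ∀ v, StrictMono fun l => (toHomeo (v, l)).2

/-- The height of a point of `V × ℂ` with respect to a radial scale. -/
noncomputable def RadialScale.height {V : Type*} [TopologicalSpace V] (R : RadialScale V)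
    (y : V × ℂ) : ℝ :=
  (R.toHomeo (y.1, -Real.log ‖y.2‖)).2

section Radial

variable {V : Type*} [NormedAddCommGroup V]

theorem exists_tube_subset {U : Set (V × ℂ)} (hU : IsOpen U) (h0 : ∀ v, (v, 0) ∈ U) :
    ∃ ε : V → ℝ, Continuous ε ∧ (∀ v, 0 < ε v) ∧ (∀ v, ε v ≤ 1) ∧
      ∀ y : V × ℂ, ‖y.2‖ < ε y.1 → y ∈ U := by
  set C : Set (V × ℂ) := Uᶜ ∪ {y | 1 ≤ ‖y.2‖} with hC
  have hCc : IsClosed C := hU.isClosed_compl.union (isClosed_le (by fun_prop) (by fun_prop))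
  have hCn : ∀ v : V, (v, (1 : ℂ)) ∈ C := fun v => Or.inr (by simp)
  refine ⟨fun v => Metric.infDist (v, (0 : ℂ)) C, ?_, fun v => ?_, fun v => ?_, fun y hy => ?_⟩
  · exact (Metric.continuous_infDist_pt C).comp (by fun_prop)
  · rw [← hCc.notMem_iff_infDist_pos ⟨_, hCn v⟩]
    rintro (h | h)
    · exact h (h0 v)
    · simp at h
      linarith
  · refine (Metric.infDist_le_dist_of_mem (hCn v)).trans ?_
    simp [Prod.dist_eq]
  · by_contra hyU
    have : Metric.infDist (y.1, (0 : ℂ)) C ≤ dist (y.1, (0 : ℂ)) y :=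
      Metric.infDist_le_dist_of_mem (Or.inl hyU)
    simp [Prod.dist_eq] at this
    linarith

/-- The piecewise linear ramp which is `1` below `a` and `0` above `b`. -/
noncomputable def ramp (a b r : ℝ) : ℝ := max 0 (min 1 ((b - r) / (b - a)))

theorem ramp_nonneg (a b r : ℝ) : 0 ≤ ramp a b r := le_max_left _ _

theorem ramp_le_one (a b r : ℝ) : ramp a b r ≤ 1 := max_le zero_le_one (min_le_left _ _)

theorem ramp_of_le {a b r : ℝ} (hab : a < b) (h : r ≤ a) : ramp a b r = 1 := by
  have : 1 ≤ (b - r) / (b - a) := by rw [le_div_iff₀ (by linarith)]; linarith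
  simp [ramp, this]

theorem ramp_of_ge {a b r : ℝ} (hab : a < b) (h : b ≤ r) : ramp a b r = 0 := by
  have : (b - r) / (b - a) ≤ 0 := div_nonpos_of_nonpos_of_nonneg (by linarith) (by linarith)
  rw [ramp, max_eq_left]
  exact (min_le_right _ _).trans this

theorem ramp_antitone {a b : ℝ} (hab : a < b) : Antitone (ramp a b) := by
  intro r s hrs
  have : 0 < b - a := by linarith
  unfold ramp
  gcongr

theorem exists_radialScale_of_tubes (ε : ℕ → V → ℝ) (hc : ∀ i, Continuous (ε i))
    (hpos : ∀ i v, 0 < ε i v) (hone : ∀ v, ε 0 v ≤ 1) (hhalf : ∀ i v, ε (i + 1) v ≤ ε i v / 2) :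
    ∃ (R : RadialScale V) (J : V × ℂ → ℝ),
      (∀ y : V × ℂ, y.2 ≠ 0 → R.height y = Real.log (1 + J y) - ‖y.2‖) ∧
      (∀ (y : V × ℂ) (m : ℕ), y.2 ≠ 0 → ε m y.1 ≤ ‖y.2‖ → J y ≤ m) ∧
      (∀ (y : V × ℂ) (m : ℕ), y.2 ≠ 0 → ‖y.2‖ < ε m y.1 → m ≤ J y) := by
  have hlt : ∀ i v, ε (i + 1) v < ε i v := fun i v => by linarith [hhalf i v, hpos i v]
  have hanti : ∀ v, Antitone fun i => ε i v := fun v =>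
      antitone_nat_of_succ_le fun i => (hlt i v).le
  have hpow : ∀ i v, ε i v ≤ (1 / 2) ^ i := by
    intro i v
    induction i with
    | zero => simpa using hone v
    | succ i ih => rw [pow_succ]; linarith [hhalf i v]
  have hsmall : ∀ r : ℝ, 0 < r → ∃ m, ∀ v, ε m v ≤ r := by
    intro r hr
    obtain ⟨m, hm⟩ := exists_pow_lt_of_lt_one hr (by norm_num : (1 / 2 : ℝ) < 1)
    exact ⟨m, fun v => (hpow m v).trans hm.le⟩
  set ρ : ℕ → V × ℝ → ℝ := fun i p => ramp (ε (i + 1) p.1) (ε i p.1) p.2 with hρ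
  have hρc : ∀ i, Continuous (ρ i) := by
    intro i
    have h1 : ∀ p : V × ℝ, ε i p.1 - ε (i + 1) p.1 ≠ 0 := fun p => by
      have := hlt i p.1
      linarith
    have := hc i
    have := hc (i + 1)
    simp only [hρ, ramp]
    fun_prop (disch := exact h1 _)
  set j : V × ℝ → ℝ := fun p => ∑ᶠ i, ρ i p with hj
  have hjsum : ∀ v r m, ε m v ≤ r → j (v, r) = ∑ i ∈ Finset.range m, ρ i (v, r) := by
    intro v r m hm
    refine finsum_eq_sum_of_support_subset _ ?_
    intro i hi
    by_contra hi'
    simp only [Finset.coe_range, mem_Iio, not_lt] at hi'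
    exact hi (ramp_of_ge (hlt i v) ((hanti v hi').trans hm))
  have hjle : ∀ v r m, ε m v ≤ r → j (v, r) ≤ m := by
    intro v r m hm
    rw [hjsum v r m hm]
    refine (Finset.sum_le_sum fun i _ => ramp_le_one _ _ _).trans ?_
    simp
  have hjge : ∀ v r m, 0 < r → r < ε m v → m ≤ j (v, r) := by
    intro v r m hr hm
    obtain ⟨M, hM⟩ := hsmall r hr
    have hmM : m ≤ M := by
      by_contra hcon
      have := hanti v (not_le.1 hcon).le
      have := hM v
      simp only at *
      linarith
    rw [hjsum v r M (hM v)]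
    calc (m : ℝ) = ∑ i ∈ Finset.range m, (1 : ℝ) := by simp
      _ = ∑ i ∈ Finset.range m, ρ i (v, r) := by
          refine Finset.sum_congr rfl fun i hi => (ramp_of_le (hlt i v) ?_).symm
          exact hm.le.trans (hanti v (Finset.mem_range.1 hi))
      _ ≤ _ := Finset.sum_le_sum_of_subset_of_nonneg (by simpa using hmM)
          fun i _ _ => ramp_nonneg _ _ _
  have hj0 : ∀ p, 0 ≤ j p := fun p => finsum_nonneg fun i => ramp_nonneg _ _ _
  have hjanti : ∀ v r s, 0 < r → r ≤ s → j (v, s) ≤ j (v, r) := by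
    intro v r s hr hrs
    obtain ⟨M, hM⟩ := hsmall r hr
    rw [hjsum v r M (hM v), hjsum v s M ((hM v).trans hrs)]
    exact Finset.sum_le_sum fun i _ => ramp_antitone (hlt i v) hrs
  set S : V × ℝ → ℝ := fun p => Real.log (1 + j (p.1, Real.exp (-p.2))) - Real.exp (-p.2) with hS
  have hjc : Continuous fun p : V × ℝ => j (p.1, Real.exp (-p.2)) := by
    simp only [hj]
    refine continuous_finsum (fun i => (hρc i).comp (by fun_prop)) ?_
    intro p
    obtain ⟨m, hm⟩ := hsmall (Real.exp (-(p.2 + 1))) (Real.exp_pos _)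
    refine ⟨{q | q.2 < p.2 + 1}, (isOpen_lt (by fun_prop) (by fun_prop)).mem_nhds (by simp), ?_⟩
    refine (Finset.range m).finite_toSet.subset ?_
    rintro i ⟨q, hq1, hq2⟩
    by_contra hi
    simp only [Finset.coe_range, mem_Iio, not_lt] at hi
    refine hq1 (ramp_of_ge (hlt i _) (((hanti _ hi).trans (hm _)).trans ?_))
    refine Real.exp_le_exp.2 ?_
    simp only [mem_ofPred_eq] at hq2
    linarith
  have hSc : Continuous S := by
    have : ∀ p : V × ℝ, 1 + j (p.1, Real.exp (-p.2)) ≠ 0 := fun p => by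
      have := hj0 (p.1, Real.exp (-p.2))
      linarith
    exact ((continuous_const.add hjc).log this).sub (by fun_prop)
  have hSm : ∀ v, StrictMono fun l => S (v, l) := by
    intro v l l' hl
    have h1 : Real.exp (-l') < Real.exp (-l) := Real.exp_lt_exp.2 (by linarith)
    have h2 := hjanti v _ _ (Real.exp_pos (-l')) h1.le
    have h3 := hj0 (v, Real.exp (-l))
    have h4 : Real.log (1 + j (v, Real.exp (-l))) ≤ Real.log (1 + j (v, Real.exp (-l'))) :=
      Real.log_le_log (by linarith) (by linarith)
    simp only [hS]
    linarith
  have hSs : ∀ v y, ∃ l, S (v, l) = y := by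
    intro v y
    refine mem_range_of_exists_le_of_exists_ge (f := fun l => S (v, l)) (by fun_prop) ?_ ?_
    · have hp : 0 < max (ε 0 v) (-y) := lt_max_of_lt_left (hpos 0 v)
      refine ⟨-Real.log (max (ε 0 v) (-y)), ?_⟩
      simp only [hS, neg_neg, Real.exp_log hp]
      rw [hjsum v _ 0 (le_max_left _ _)]
      have := le_max_right (ε 0 v) (-y)
      simp
      linarith
    · obtain ⟨m, hm⟩ := exists_nat_ge (Real.exp (y + 1))
      have hp : 0 < ε m v / 2 := half_pos (hpos m v)
      refine ⟨-Real.log (ε m v / 2), ?_⟩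
      simp only [hS, neg_neg, Real.exp_log hp]
      have h1 := hjge v (ε m v / 2) m hp (by linarith)
      have h2 : y + 1 ≤ Real.log (1 + j (v, ε m v / 2)) := by
        rw [Real.le_log_iff_exp_le (by linarith [hj0 (v, ε m v / 2)])]
        linarith
      have h3 : ε m v ≤ 1 := (hanti v (Nat.zero_le m)).trans (hone v)
      linarith
  have hemb := fiberwise_isOpenEmbedding hSc hSm
  have hsurj : Function.Surjective fun x : V × ℝ => (x.1, S x) := by
    rintro ⟨v, y⟩
    obtain ⟨l, hl⟩ := hSs v y
    exact ⟨(v, l), by simp [hl]⟩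
  let R : RadialScale V := ⟨hemb.isEmbedding.toHomeomorphOfSurjective hsurj, fun p => rfl, hSm⟩
  refine ⟨R, fun y => j (y.1, ‖y.2‖), fun y hy => ?_, fun y m hy hm => hjle _ _ _ hm,
    fun y m hy hm => hjge _ _ _ (norm_pos_iff.2 hy) hm⟩
  change S (y.1, -Real.log ‖y.2‖) = _
  simp only [hS, neg_neg, Real.exp_log (norm_pos_iff.2 hy)]

theorem exists_radialScale (F : (V × ℂ) ≃ₜ (V × ℂ)) (hF : ∀ v, F (v, 0) = (v, 0)) :
    ∃ R : RadialScale V, ∀ v : V,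
      Tendsto (fun y => R.height (F y) - R.height y) (𝓝[{y | y.2 ≠ 0}] (v, 0)) (𝓝 0) := by
  have hF' : ∀ v, F.symm (v, 0) = (v, 0) := fun v => by rw [Homeomorph.symm_apply_eq, hF]
  have step : ∀ δ : {δ : V → ℝ // Continuous δ ∧ ∀ v, 0 < δ v},
      ∃ ε : {δ : V → ℝ // Continuous δ ∧ ∀ v, 0 < δ v}, (∀ v, ε.1 v ≤ δ.1 v / 2) ∧
        ∀ y : V × ℂ, ‖y.2‖ < ε.1 y.1 →
          ‖(F y).2‖ < δ.1 (F y).1 ∧ ‖(F.symm y).2‖ < δ.1 (F.symm y).1 := by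
    rintro ⟨δ, hδ, hδ0⟩
    obtain ⟨η, h1, h2, -, h3⟩ := exists_tube_subset
      (U := {y : V × ℂ | ‖(F y).2‖ < δ (F y).1 ∧ ‖(F.symm y).2‖ < δ (F.symm y).1})
      ((isOpen_lt (f := fun y : V × ℂ => ‖(F y).2‖) (g := fun y => δ (F y).1)
          (by fun_prop) (by fun_prop)).inter
        (isOpen_lt (f := fun y : V × ℂ => ‖(F.symm y).2‖) (g := fun y => δ (F.symm y).1)
          (by fun_prop) (by fun_prop)))
      (fun v => by simp [hF, hF', hδ0])
    refine ⟨⟨fun v => min (η v) (δ v / 2), by fun_prop, fun v => ?_⟩, fun v => min_le_right _ _,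
      fun y hy => h3 y (hy.trans_le (min_le_left _ _))⟩
    exact lt_min (h2 v) (half_pos (hδ0 v))
  choose g hg1 hg2 using step
  let e : ℕ → {δ : V → ℝ // Continuous δ ∧ ∀ v, 0 < δ v} :=
    fun n => Nat.rec ⟨fun _ => 1, continuous_const, fun _ => one_pos⟩ (fun _ δ => g δ) n
  have he : ∀ i, e (i + 1) = g (e i) := fun i => rfl
  obtain ⟨R, J, hR, hJle, hJge⟩ := exists_radialScale_of_tubes (fun i => (e i).1)
    (fun i => (e i).2.1) (fun i => (e i).2.2) (fun v => le_rfl)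
    (fun i => by rw [he]; exact hg1 _)
  have hN : ∀ i (y : V × ℂ), ‖y.2‖ < (e (i + 1)).1 y.1 →
      ‖(F y).2‖ < (e i).1 (F y).1 ∧ ‖(F.symm y).2‖ < (e i).1 (F.symm y).1 := fun i => by
    rw [he]; exact hg2 _
  have hF0 : ∀ y : V × ℂ, y.2 ≠ 0 → (F y).2 ≠ 0 := by
    intro y hy h0
    have : F y = F ((F y).1, 0) := by rw [hF]; exact Prod.ext rfl h0
    exact hy (congrArg Prod.snd (F.injective this))
  refine ⟨R, fun v => ?_⟩
  rw [Metric.tendsto_nhds]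
  intro δ hδ
  obtain ⟨m, hm⟩ := exists_nat_gt (4 / δ)
  have hm0 : 0 < (m : ℝ) := lt_trans (by positivity) hm
  have e1 : ∀ᶠ y : V × ℂ in 𝓝 (v, 0), ‖y.2‖ < (e m).1 y.1 := by
    have := (e m).2.1
    refine ContinuousAt.eventually_lt (by fun_prop) (by fun_prop) ?_
    simpa using (e m).2.2 v
  have e2 : ∀ᶠ y : V × ℂ in 𝓝 (v, 0), ‖y.2‖ < δ / 4 :=
    ContinuousAt.eventually_lt (by fun_prop) (by fun_prop) (by simp [hδ])
  have e3 : ∀ᶠ y : V × ℂ in 𝓝 (v, 0), ‖(F y).2‖ < δ / 4 :=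
    ContinuousAt.eventually_lt (by fun_prop) (by fun_prop) (by simp [hδ, hF])
  filter_upwards [nhdsWithin_le_nhds e1, nhdsWithin_le_nhds e2, nhdsWithin_le_nhds e3,
    self_mem_nhdsWithin] with y h1 h2 h3 (h4 : y.2 ≠ 0)
  have hex : ∃ k, (e k).1 y.1 ≤ ‖y.2‖ := by
    by_contra! hcon
    obtain ⟨k, hk⟩ := exists_nat_gt (J y)
    linarith [hJge y k h4 (hcon k)]
  classical
  set k := Nat.find hex with hk
  have hk1 : (e k).1 y.1 ≤ ‖y.2‖ := Nat.find_spec hex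
  have hk2 : ∀ i < k, ‖y.2‖ < (e i).1 y.1 := fun i hi => not_le.1 (Nat.find_min hex hi)
  have hanti : ∀ i w, (e (i + 1)).1 w ≤ (e i).1 w := fun i w => by
    have := hg1 (e i) w
    have := (e i).2.2 w
    rw [he]
    linarith
  have hmk : m < k := by
    by_contra hcon
    have h5 : (e m).1 y.1 ≤ (e k).1 y.1 :=
      antitone_nat_of_succ_le (f := fun i => (e i).1 y.1) (fun i => hanti i _) (not_lt.1 hcon)
    linarith
  obtain ⟨i, hi⟩ : ∃ i, k = i + 1 := ⟨k - 1, by omega⟩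
  have j1 : J y ≤ k := hJle y k h4 hk1
  have j2 : (i : ℝ) ≤ J y := hJge y i h4 (hk2 i (by omega))
  have j3 : (i : ℝ) - 1 ≤ J (F y) := by
    rcases Nat.eq_zero_or_pos i with h0 | h0
    · have : 0 < m := by exact_mod_cast hm0
      omega
    · obtain ⟨i', rfl⟩ : ∃ i', i = i' + 1 := ⟨i - 1, by omega⟩
      push_cast
      simpa using hJge (F y) i' (hF0 y h4) (hN i' y (hk2 (i' + 1) (by omega))).1
  have j4 : J (F y) ≤ k + 1 := by
    have h5 : (e (k + 1)).1 (F y).1 ≤ ‖(F y).2‖ := by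
      by_contra! hcon
      have := (hN k (F y) hcon).2
      rw [F.symm_apply_apply] at this
      linarith
    simpa using hJle (F y) (k + 1) (hF0 y h4) h5
  have hmi : (m : ℝ) ≤ i := by exact_mod_cast (by omega : m ≤ i)
  have hki : (k : ℝ) = i + 1 := by exact_mod_cast hi
  have h6 : |Real.log (1 + J (F y)) - Real.log (1 + J y)| ≤ 2 / m := by
    refine (abs_log_sub_log_le hm0 (by linarith) (by linarith)).trans ?_
    gcongr
    rw [abs_le]
    constructor <;> linarith
  have h7 : 2 / (m : ℝ) < δ / 2 := by
    rw [div_lt_iff₀ hδ] at hm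
    rw [div_lt_iff₀ hm0]
    linarith
  rw [Real.dist_eq, sub_zero, hR y h4, hR (F y) (hF0 y h4), abs_lt]
  rw [abs_le] at h6
  have := norm_nonneg y.2
  have := norm_nonneg (F y).2
  constructor <;> linarith [h6.1, h6.2]

end Radial

namespace RadialScale

section Basic

variable {V : Type*} [TopologicalSpace V] (R : RadialScale V)

theorem symm_fst (p : V × ℝ) : (R.toHomeo.symm p).1 = p.1 := by
  rw [← R.fst_eq, R.toHomeo.apply_symm_apply]

theorem toHomeo_symm_snd (p : V × ℝ) : R.toHomeo (p.1, (R.toHomeo.symm p).2) = p := by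
  rw [← R.symm_fst, Prod.mk.eta, R.toHomeo.apply_symm_apply]

theorem toHomeo_neg_log (v : V) (z : ℂ) :
    R.toHomeo (v, -Real.log ‖z‖) = (v, R.height (v, z)) :=
  Prod.ext (R.fst_eq _) rfl

theorem lt_symm_snd {v : V} {s l : ℝ} :
    l < (R.toHomeo.symm (v, s)).2 ↔ (R.toHomeo (v, l)).2 < s := by
  have h := (R.mono v).lt_iff_lt (a := l) (b := (R.toHomeo.symm (v, s)).2)
  simp only [R.toHomeo_symm_snd (v, s)] at h
  exact h.symm

theorem tendsto_height (v : V) :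
    Tendsto R.height (𝓝[{y | y.2 ≠ 0}] (v, 0)) atTop := by
  rw [tendsto_atTop]
  intro b
  set l := (R.toHomeo.symm (v, b + 1)).2 with hl
  have h1 : (R.toHomeo (v, l)).2 = b + 1 := by rw [hl, R.toHomeo_symm_snd (v, b + 1)]
  have e1 : ∀ᶠ y : V × ℂ in 𝓝 (v, 0), b < (R.toHomeo (y.1, l)).2 := by
    refine ContinuousAt.eventually_lt (by fun_prop) ?_ (by rw [h1]; linarith)
    exact Continuous.continuousAt (by fun_prop)
  have e2 : ∀ᶠ y : V × ℂ in 𝓝 (v, 0), ‖y.2‖ < Real.exp (-l) :=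
    ContinuousAt.eventually_lt (by fun_prop) (by fun_prop) (by simp [Real.exp_pos])
  filter_upwards [nhdsWithin_le_nhds e1, nhdsWithin_le_nhds e2, self_mem_nhdsWithin]
    with y h1 h2 (h3 : y.2 ≠ 0)
  refine h1.le.trans ((R.mono y.1).monotone ?_)
  have := (Real.log_lt_iff_lt_exp (norm_pos_iff.2 h3)).2 h2
  linarith

theorem tendsto_symm_snd (v : V) :
    Tendsto (fun p => (R.toHomeo.symm p).2) (𝓝 v ×ˢ atTop) atTop := by
  rw [tendsto_atTop]
  intro l
  have e1 : ∀ᶠ w in 𝓝 v, (R.toHomeo (w, l)).2 < (R.toHomeo (v, l)).2 + 1 :=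
    ContinuousAt.eventually_lt (f := fun w => (R.toHomeo (w, l)).2)
      (Continuous.continuousAt (by fun_prop)) (by fun_prop) (by linarith)
  filter_upwards [e1.prod_mk (eventually_gt_atTop ((R.toHomeo (v, l)).2 + 1))] with p hp
  exact (R.lt_symm_snd.2 (hp.1.trans hp.2)).le

theorem continuousAt_height {y : V × ℂ} (hy : y.2 ≠ 0) : ContinuousAt R.height y := by
  have h1 : ContinuousAt (fun y : V × ℂ => Real.log ‖y.2‖) y :=
    ContinuousAt.log (by fun_prop) (norm_ne_zero_iff.2 hy)
  unfold height
  exact ((continuous_snd.comp R.toHomeo.continuous).continuousAt).comp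
    (f := fun y : V × ℂ => (y.1, -Real.log ‖y.2‖)) (continuousAt_fst.prodMk h1.neg)

/-- Polar coordinates on the complement of the zero section of `V × ℂ`. -/
noncomputable def polar (x : (V × ℝ) × ℝ) : V × ℂ :=
  (x.1.1, Complex.exp (⟨-(R.toHomeo.symm x.1).2, x.2⟩ : ℂ))

@[simp] theorem polar_fst (x : (V × ℝ) × ℝ) : (R.polar x).1 = x.1.1 := rfl

theorem polar_snd_ne (x : (V × ℝ) × ℝ) : (R.polar x).2 ≠ 0 := Complex.exp_ne_zero _

theorem continuous_polar : Continuous R.polar := by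
  have : Continuous fun x : (V × ℝ) × ℝ => (⟨-(R.toHomeo.symm x.1).2, x.2⟩ : ℂ) := by
    have h : (fun x : (V × ℝ) × ℝ => (⟨-(R.toHomeo.symm x.1).2, x.2⟩ : ℂ)) =
        fun x => Complex.equivRealProdCLM.symm (-(R.toHomeo.symm x.1).2, x.2) := by
      ext x
      simp [Complex.equivRealProdCLM_symm_apply, Complex.ext_iff]
    rw [h]
    fun_prop
  exact (continuous_fst.comp continuous_fst).prodMk (Complex.continuous_exp.comp this)

theorem norm_polar (x : (V × ℝ) × ℝ) :
    ‖(R.polar x).2‖ = Real.exp (-(R.toHomeo.symm x.1).2) := by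
  simp [polar, Complex.norm_exp]

theorem height_polar (x : (V × ℝ) × ℝ) : R.height (R.polar x) = x.1.2 := by
  rw [height, norm_polar, Real.log_exp, neg_neg, polar_fst, R.toHomeo_symm_snd]

theorem polar_re (x : (V × ℝ) × ℝ) :
    (R.polar x).2.re = Real.exp (-(R.toHomeo.symm x.1).2) * Real.cos x.2 := by
  simp [polar, Complex.exp_re]

theorem polar_im (x : (V × ℝ) × ℝ) :
    (R.polar x).2.im = Real.exp (-(R.toHomeo.symm x.1).2) * Real.sin x.2 := by
  simp [polar, Complex.exp_im]

theorem polar_eq {v : V} {s t : ℝ} {z : ℂ} (hs : s = R.height (v, z)) {r : ℝ} (hr : 0 < r)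
    (hz : z = r * Complex.exp (t * Complex.I)) : R.polar ((v, s), t) = (v, z) := by
  have hz' : ‖z‖ = r := by simp [hz, Complex.norm_exp, abs_of_pos hr]
  have h1 : R.toHomeo.symm (v, s) = (v, -Real.log r) := by
    rw [hs, ← R.toHomeo_neg_log, R.toHomeo.symm_apply_apply, hz']
  rw [polar, h1]
  refine Prod.ext rfl ?_
  have h2 : (⟨- -Real.log r, t⟩ : ℂ) = (Real.log r : ℂ) + t * Complex.I := by
    simp [Complex.ext_iff]
  simp only
  rw [h2, Complex.exp_add, ← Complex.ofReal_exp, Real.exp_log hr, hz]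

theorem polar_eq_polar {a b : (V × ℝ) × ℝ} (h : R.polar a = R.polar b) :
    a.1 = b.1 ∧ ∃ m : ℤ, a.2 = b.2 + m * (2 * Real.pi) := by
  refine ⟨Prod.ext (congrArg (fun y : V × ℂ => y.1) h) ?_, ?_⟩
  · rw [← R.height_polar a, h, R.height_polar]
  · have h2 := congrArg Prod.snd h
    obtain ⟨m, hm⟩ := Complex.exp_eq_exp_iff_exists_int.1 h2
    refine ⟨m, ?_⟩
    have := congrArg Complex.im hm
    simpa using this

theorem polar_add_two_pi (p : V × ℝ) (t : ℝ) (m : ℤ) :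
    R.polar (p, t + m * (2 * Real.pi)) = R.polar (p, t) := by
  refine Prod.ext rfl (Complex.exp_eq_exp_iff_exists_int.2 ⟨m, ?_⟩)
  simp [Complex.ext_iff]

theorem tendsto_polar (v : V) : Tendsto R.polar ((𝓝 v ×ˢ atTop) ×ˢ ⊤) (𝓝 (v, 0)) := by
  rw [nhds_prod_eq]
  refine Tendsto.prodMk ?_ ?_
  · exact tendsto_fst.comp tendsto_fst
  · rw [tendsto_zero_iff_norm_tendsto_zero]
    refine Tendsto.congr (fun x => (R.norm_polar x).symm) ?_
    exact Real.tendsto_exp_neg_atTop_nhds_zero.comp ((R.tendsto_symm_snd v).comp tendsto_fst)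

end Basic

section Lift

variable {V : Type*} [NormedAddCommGroup V] [NormedSpace ℝ V] (R : RadialScale V)

theorem exists_deck {a b : (V × ℝ) × ℝ → (V × ℝ) × ℝ} (ha : Continuous a) (hb : Continuous b)
    (h : ∀ x, R.polar (a x) = R.polar (b x)) :
    ∃ m : ℤ, ∀ x, a x = ((b x).1, (b x).2 + m * (2 * Real.pi)) := by
  choose h1 m hm using fun x => R.polar_eq_polar (h x)
  have hpi := Real.two_pi_pos
  have hcont : Continuous fun x => (m x : ℝ) := by
    have : (fun x => (m x : ℝ)) = fun x => ((a x).2 - (b x).2) / (2 * Real.pi) := by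
      ext x
      rw [hm x]
      field_simp
      ring
    rw [this]
    fun_prop
  have hcont' : Continuous m := Int.isClosedEmbedding_coe_real.isEmbedding.continuous_iff.2 hcont
  refine ⟨m 0, fun x => Prod.ext (h1 x) ?_⟩
  rw [hm x, PreconnectedSpace.constant inferInstance hcont' (x := x) (y := 0)]

theorem exists_lift (F : V × ℂ → V × ℂ) (hF : Continuous F) (h0 : ∀ y, y.2 ≠ 0 → (F y).2 ≠ 0) :
    ∃ f : (V × ℝ) × ℝ → (V × ℝ) × ℝ, Continuous f ∧ ∀ x, R.polar (f x) = F (R.polar x) := by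
  have hc := R.continuous_polar
  obtain ⟨L, hL, hL2⟩ := Complex.exists_continuousOn_eqOn_exp_comp (X := (V × ℝ) × ℝ)
    (U := univ) (by
      have := (convex_univ (𝕜 := ℝ) (E := (V × ℝ) × ℝ)).contractibleSpace univ_nonempty
      exact SimplyConnectedSpace.ofContractible _) isOpen_univ
    (g := fun x => (F (R.polar x)).2) (by fun_prop)
    (by rintro ⟨x, -, hx⟩; exact h0 _ (R.polar_snd_ne x) hx)
  rw [continuousOn_univ] at hL
  refine ⟨fun x => (((F (R.polar x)).1, R.height (F (R.polar x))), (L x).im), ?_, fun x => ?_⟩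
  · refine Continuous.prodMk (Continuous.prodMk (by fun_prop) ?_) (by fun_prop)
    rw [continuous_iff_continuousAt]
    intro x
    exact (R.continuousAt_height (h0 _ (R.polar_snd_ne x))).comp
      (f := fun x => F (R.polar x)) (Continuous.continuousAt (by fun_prop))
  · refine R.polar_eq rfl (r := Real.exp (L x).re) (Real.exp_pos _) ?_
    have := hL2 (mem_univ x)
    simp only [Function.comp_apply] at this
    rw [← this, Complex.ofReal_exp, ← Complex.exp_add, Complex.re_add_im]

theorem exists_lift_homeomorph (F : (V × ℂ) ≃ₜ (V × ℂ)) (h0 : ∀ y, (F y).2 = 0 ↔ y.2 = 0) :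
    ∃ f : ((V × ℝ) × ℝ) ≃ₜ ((V × ℝ) × ℝ), ∀ x, R.polar (f x) = F (R.polar x) := by
  obtain ⟨f, hf, hfF⟩ := R.exists_lift F F.continuous fun y => (h0 y).not.2
  obtain ⟨g, hg, hgF⟩ := R.exists_lift F.symm F.symm.continuous fun y hy hy' =>
    hy (by rw [← F.apply_symm_apply y]; exact (h0 _).2 hy')
  obtain ⟨m, hm⟩ := R.exists_deck (hg.comp hf) continuous_id
    fun x => by simp [hgF, hfF]
  set g' : (V × ℝ) × ℝ → (V × ℝ) × ℝ := fun x => ((g x).1, (g x).2 + (-m : ℤ) * (2 * Real.pi))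
  have hg' : Continuous g' := by fun_prop
  have hgF' : ∀ x, R.polar (g' x) = F.symm (R.polar x) := fun x => by
    rw [← hgF, R.polar_add_two_pi]
  have hgf : ∀ x, g' (f x) = x := by
    intro x
    have h := hm x
    simp only [Function.comp_apply, id] at h
    simp only [g', h]
    refine Prod.ext rfl ?_
    push_cast
    ring
  obtain ⟨k, hk⟩ := R.exists_deck (hf.comp hg') continuous_id
    fun x => by simp [hgF', hfF]
  have hk0 : k = 0 := by
    have h := hk (f 0)
    simp only [Function.comp_apply, id, hgf] at h
    have h2 := congrArg Prod.snd h
    have := Real.two_pi_pos.ne'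
    simpa [this] using h2
  refine ⟨⟨⟨f, g', hgf, fun x => ?_⟩, hf, hg'⟩, hfF⟩
  have h := hk x
  simpa [hk0] using h

theorem exists_oriented_lift (F : (V × ℂ) ≃ₜ (V × ℂ)) (h0 : ∀ y, (F y).2 = 0 ↔ y.2 = 0) :
    ∃ (F₁ : (V × ℂ) ≃ₜ (V × ℂ)) (f : ((V × ℝ) × ℝ) ≃ₜ ((V × ℝ) × ℝ)),
      (∀ v, ∀ r : ℝ, F₁ (v, r) = F (v, r)) ∧
      (∀ y, (F₁ y).2 = 0 ↔ y.2 = 0) ∧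
      (∀ v l, Tendsto (fun y => R.height (F y) - R.height y) (𝓝[{y | y.2 ≠ 0}] (v, 0)) l →
        Tendsto (fun y => R.height (F₁ y) - R.height y) (𝓝[{y | y.2 ≠ 0}] (v, 0)) l) ∧
      (∀ x, R.polar (f x) = F₁ (R.polar x)) ∧
      ∀ p t, f (p, t + 2 * Real.pi) = ((f (p, t)).1, (f (p, t)).2 + 2 * Real.pi) := by
  obtain ⟨f, hf⟩ := R.exists_lift_homeomorph F h0
  have key : ∀ (F : (V × ℂ) ≃ₜ (V × ℂ)) (f : ((V × ℝ) × ℝ) ≃ₜ ((V × ℝ) × ℝ)),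
      (∀ x, R.polar (f x) = F (R.polar x)) → ∃ d : ℤ, ∀ p t,
        f (p, t + 2 * Real.pi) = ((f (p, t)).1, (f (p, t)).2 + d * (2 * Real.pi)) := by
    intro F f hf
    obtain ⟨d, hd⟩ := R.exists_deck (a := fun x => f (x.1, x.2 + 2 * Real.pi)) (b := f)
      (by fun_prop) (by fun_prop) fun x => by
        have := R.polar_add_two_pi x.1 x.2 1
        rw [Int.cast_one, one_mul] at this
        simp [hf, this]
    exact ⟨d, fun p t => hd (p, t)⟩
  obtain ⟨d, hd⟩ := key F f hf
  obtain ⟨d', hd'⟩ := key F.symm f.symm fun x => by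
    rw [Homeomorph.eq_symm_apply, ← hf, f.apply_symm_apply]
  have hmul : ∀ k : ℤ, ∀ p t, f.symm (p, t + k * (2 * Real.pi)) =
      ((f.symm (p, t)).1, (f.symm (p, t)).2 + k * d' * (2 * Real.pi)) := by
    intro k
    induction k using Int.induction_on with
    | zero => simp
    | succ k ih =>
      intro p t
      have h := hd' p (t + k * (2 * Real.pi))
      push_cast at ih ⊢
      rw [ih] at h
      rw [show t + ((k : ℝ) + 1) * (2 * Real.pi) = t + k * (2 * Real.pi) + 2 * Real.pi by ring, h]
      simp only [Prod.mk.injEq, true_and]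
      ring
    | pred k ih =>
      intro p t
      have h := hd' p (t + (-(k : ℝ) - 1) * (2 * Real.pi))
      rw [show t + (-(k : ℝ) - 1) * (2 * Real.pi) + 2 * Real.pi =
        t + (-(k : ℝ)) * (2 * Real.pi) by ring] at h
      push_cast at ih ⊢
      rw [ih] at h
      obtain ⟨h1, h2⟩ := Prod.mk.injEq _ _ _ _ ▸ h
      refine Prod.ext h1.symm ?_
      simp only
      linarith
  have hdd : d * d' = 1 := by
    have h := hd (0, 0) 0
    have h2 := congrArg f.symm h
    rw [hmul, f.symm_apply_apply, f.symm_apply_apply] at h2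
    have h3 := congrArg Prod.snd h2
    simp only at h3
    have h4 : (2 * Real.pi) * (d * d' - 1 : ℝ) = 0 := by linarith
    have h5 := (mul_eq_zero.1 h4).resolve_left Real.two_pi_pos.ne'
    have h6 : (d * d' : ℝ) = 1 := by linarith
    exact_mod_cast h6
  rcases Int.eq_one_or_neg_one_of_mul_eq_one hdd with rfl | rfl
  · refine ⟨F, f, fun _ _ => rfl, h0, fun _ _ h => h, hf, fun p t => ?_⟩
    rw [hd]
    simp
  · let c : (V × ℂ) ≃ₜ (V × ℂ) :=
      (Homeomorph.refl V).prodCongr Complex.conjLIE.toHomeomorph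
    have hc : ∀ y : V × ℂ, c y = (y.1, (starRingEnd ℂ) y.2) := fun y => rfl
    refine ⟨c.trans F, ((Homeomorph.refl (V × ℝ)).prodCongr (Homeomorph.neg ℝ)).trans f,
      fun v r => ?_, fun y => ?_, fun v l h => ?_, fun x => ?_, fun p t => ?_⟩
    · simp [hc]
    · simp [h0, hc]
    · have hcv : Tendsto c (𝓝[{y | y.2 ≠ 0}] (v, 0)) (𝓝[{y | y.2 ≠ 0}] (v, 0)) := by
        refine tendsto_nhdsWithin_iff.2 ⟨?_, ?_⟩
        · have := c.continuous.tendsto (v, 0)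
          simp only [hc, map_zero] at this
          exact this.mono_left nhdsWithin_le_nhds
        · filter_upwards [self_mem_nhdsWithin] with y (hy : y.2 ≠ 0)
          simpa [hc] using hy
      refine (h.comp hcv).congr fun y => ?_
      simp [height, hc]
    · simp only [Homeomorph.trans_apply, hf, hc]
      congr 1
      refine Prod.ext rfl ?_
      simp only [polar]
      rw [← Complex.exp_conj]
      congr 1
    · simp only [Homeomorph.trans_apply]
      have h := hd p (-t - 2 * Real.pi)
      simp only [sub_add_cancel] at h
      have e : ∀ t, ((Homeomorph.refl (V × ℝ)).prodCongr (Homeomorph.neg ℝ)) (p, t) = (p, -t) :=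
        fun t => rfl
      rw [e, e, h, show -(t + 2 * Real.pi) = -t - 2 * Real.pi by ring]
      simp

end Lift

end RadialScale

/-- A slowly growing function of the angle, vanishing on `[-π, π]`. -/
noncomputable def slowGrowth (t : ℝ) : ℝ := Real.log (1 + max (|t| - Real.pi) 0)

theorem one_le_one_add_max (u : ℝ) : 1 ≤ 1 + max u 0 := by
  linarith [le_max_right u 0]

theorem continuous_slowGrowth : Continuous slowGrowth := by
  unfold slowGrowth
  refine Continuous.log (by fun_prop) fun t => ?_
  linarith [one_le_one_add_max (|t| - Real.pi)]

theorem slowGrowth_nonneg (t : ℝ) : 0 ≤ slowGrowth t :=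
  Real.log_nonneg (one_le_one_add_max _)

theorem slowGrowth_eq_zero {t : ℝ} (h : |t| ≤ Real.pi) : slowGrowth t = 0 := by
  rw [slowGrowth, max_eq_right (by linarith)]
  simp

theorem abs_slowGrowth_sub_le {s t K : ℝ} (h : |s - t| ≤ K) :
    |slowGrowth s - slowGrowth t| ≤ K / (1 + max (|t| - Real.pi - K) 0) := by
  have hK : 0 ≤ K := (abs_nonneg _).trans h
  have h1 : |(1 + max (|s| - Real.pi) 0) - (1 + max (|t| - Real.pi) 0)| ≤ K := by
    rw [add_sub_add_left_eq_sub]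
    refine (abs_max_sub_max_le_abs _ _ _).trans ?_
    rw [sub_sub_sub_cancel_right]
    exact (abs_abs_sub_abs_le _ _).trans h
  have h2 := abs_abs_sub_abs_le s t
  rw [abs_le] at h2
  refine (abs_log_sub_log_le (m := 1 + max (|t| - Real.pi - K) 0)
    (by linarith [one_le_one_add_max (|t| - Real.pi - K)]) ?_ ?_).trans ?_
  · have := max_le_max_right 0 (by linarith [h2.1] : |t| - Real.pi - K ≤ |s| - Real.pi)
    linarith
  · have := max_le_max_right 0 (by linarith : |t| - Real.pi - K ≤ |t| - Real.pi)
    linarith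
  · have := one_le_one_add_max (|t| - Real.pi - K)
    gcongr

theorem abs_slowGrowth_sub_le_self {s t K : ℝ} (h : |s - t| ≤ K) :
    |slowGrowth s - slowGrowth t| ≤ K := by
  have hK : 0 ≤ K := (abs_nonneg _).trans h
  exact (abs_slowGrowth_sub_le h).trans (div_le_self hK (one_le_one_add_max _))

theorem tendsto_one_add_max {α : Type*} {l : Filter α} {u : α → ℝ} (c : ℝ)
    (hu : Tendsto u l atTop) : Tendsto (fun x => 1 + max (u x - c) 0) l atTop :=
  tendsto_atTop_mono (fun x => by linarith [le_max_left (u x - c) 0])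
    (tendsto_atTop_add_const_right l (-c) hu)

theorem tendsto_slowGrowth {α : Type*} {l : Filter α} {t : α → ℝ}
    (ht : Tendsto (fun x => |t x|) l atTop) : Tendsto (fun x => slowGrowth (t x)) l atTop :=
  Real.tendsto_log_atTop.comp (tendsto_one_add_max Real.pi ht)

theorem tendsto_slowGrowth_sub {α : Type*} {l : Filter α} {s t : α → ℝ} {K : ℝ}
    (h : ∀ x, |s x - t x| ≤ K) (ht : Tendsto (fun x => |t x|) l atTop) :
    Tendsto (fun x => slowGrowth (s x) - slowGrowth (t x)) l (𝓝 0) := by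
  refine squeeze_zero_norm (fun x => abs_slowGrowth_sub_le (h x)) ?_
  refine Tendsto.div_atTop tendsto_const_nhds ?_
  refine (tendsto_one_add_max (Real.pi + K) ht).congr fun x => ?_
  rw [sub_sub]

/-- A fibred family of increasing homeomorphisms of the line onto `(0, π)`. -/
structure IsSlabMap {P : Type*} [TopologicalSpace P] (θ : P × ℝ → ℝ) : Prop where
  cont : Continuous θ
  mono : ∀ p, StrictMono fun t => θ (p, t)
  range_eq : ∀ p, range (fun t => θ (p, t)) = Ioo 0 Real.pi

namespace IsSlabMap

variable {P α : Type*} [TopologicalSpace P] {θ : P × ℝ → ℝ}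
  {l : Filter α} {p : α → P} {t : α → ℝ} {p₀ : P}

theorem mem_Ioo (hθ : IsSlabMap θ) (p : P) (t : ℝ) : θ (p, t) ∈ Ioo 0 Real.pi :=
  hθ.range_eq p ▸ mem_range_self t

theorem eventually_lt (hθ : IsSlabMap θ) (hp : Tendsto p l (𝓝 p₀)) {N c : ℝ} (h : θ (p₀, N) < c) :
    ∀ᶠ x in l, θ (p x, N) < c := by
  have := hθ.cont
  have h1 : Continuous fun q => θ (q, N) := by fun_prop
  exact (h1.tendsto p₀).comp hp (Iio_mem_nhds h)

theorem eventually_gt (hθ : IsSlabMap θ) (hp : Tendsto p l (𝓝 p₀)) {N c : ℝ} (h : c < θ (p₀, N)) :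
    ∀ᶠ x in l, c < θ (p x, N) := by
  have := hθ.cont
  have h1 : Continuous fun q => θ (q, N) := by fun_prop
  exact (h1.tendsto p₀).comp hp (Ioi_mem_nhds h)

theorem tendsto_atBot_iff (hθ : IsSlabMap θ) (hp : Tendsto p l (𝓝 p₀)) :
    Tendsto (fun x => θ (p x, t x)) l (𝓝 0) ↔ Tendsto t l atBot := by
  constructor
  · intro h
    rw [tendsto_atBot]
    intro N
    have h0 := (hθ.mem_Ioo p₀ N).1
    filter_upwards [h (Iio_mem_nhds (half_pos h0)),
      hθ.eventually_gt hp (half_lt_self h0)] with x h1 h2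
    exact ((hθ.mono (p x)).lt_iff_lt.1 (lt_trans h1 h2)).le
  · intro h
    refine tendsto_order.2 ⟨fun c hc => .of_forall fun x => hc.trans (hθ.mem_Ioo _ _).1,
      fun c hc => ?_⟩
    have hc' : min c Real.pi / 2 ∈ Ioo 0 Real.pi := by
      have := Real.pi_pos
      have := min_le_right c Real.pi
      have : 0 < min c Real.pi := lt_min hc Real.pi_pos
      constructor <;> linarith
    obtain ⟨N, hN⟩ := (hθ.range_eq p₀).symm ▸ hc'
    simp only at hN
    have h3 : θ (p₀, N) < c := by
      have := min_le_left c Real.pi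
      rw [hN]
      linarith
    filter_upwards [hθ.eventually_lt hp h3, h.eventually (eventually_lt_atBot N)] with x h1 h2
    exact (hθ.mono (p x) h2).trans h1

theorem tendsto_atTop_iff (hθ : IsSlabMap θ) (hp : Tendsto p l (𝓝 p₀)) :
    Tendsto (fun x => θ (p x, t x)) l (𝓝 Real.pi) ↔ Tendsto t l atTop := by
  constructor
  · intro h
    rw [tendsto_atTop]
    intro N
    obtain ⟨c, h1, h2⟩ := exists_between (hθ.mem_Ioo p₀ N).2
    filter_upwards [h (Ioi_mem_nhds h2), hθ.eventually_lt hp h1] with x h1 h2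
    exact ((hθ.mono (p x)).lt_iff_lt.1 (lt_trans h2 h1)).le
  · intro h
    refine tendsto_order.2 ⟨fun c hc => ?_,
      fun c hc => .of_forall fun x => (hθ.mem_Ioo _ _).2.trans hc⟩
    obtain ⟨c', h1, h2⟩ := exists_between (max_lt hc Real.pi_pos)
    have hc' : c' ∈ Ioo 0 Real.pi := ⟨(le_max_right _ _).trans_lt h1, h2⟩
    obtain ⟨N, hN⟩ := (hθ.range_eq p₀).symm ▸ hc'
    simp only at hN
    have h3 : c < θ (p₀, N) := hN ▸ (le_max_left _ _).trans_lt h1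
    filter_upwards [hθ.eventually_gt hp h3, h.eventually (eventually_gt_atTop N)] with x h1 h2
    exact h1.trans (hθ.mono (p x) h2)

end IsSlabMap

theorem isSlabMap_arctan {P : Type*} [TopologicalSpace P] {a m : ℝ} (ha : 0 < a) :
    IsSlabMap fun x : P × ℝ => Real.pi / 2 + Real.arctan (a * (x.2 - m)) := by
  refine ⟨by fun_prop, fun p s t hst => ?_, fun p => ?_⟩
  · simp only [add_lt_add_iff_left]
    refine Real.arctan_strictMono ?_
    gcongr
  · ext y
    constructor
    · rintro ⟨t, rfl⟩
      have h1 := Real.neg_pi_div_two_lt_arctan (a * (t - m))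
      have h2 := Real.arctan_lt_pi_div_two (a * (t - m))
      constructor <;> simp only <;> linarith
    · rintro ⟨h1, h2⟩
      refine ⟨Real.tan (y - Real.pi / 2) / a + m, ?_⟩
      simp only [add_sub_cancel_right]
      rw [mul_div_cancel₀ _ ha.ne', Real.arctan_tan (by linarith) (by linarith)]
      ring

theorem exists_isSlabMap_eq {P : Type*} [TopologicalSpace P] {c c' : P → ℝ}
    (hc : Continuous c) (hc' : Continuous c') (h0 : ∀ p, 0 < c p) (h1 : ∀ p, c p < c' p)
    (hpi : ∀ p, c' p < Real.pi) :
    ∃ θ : P × ℝ → ℝ, IsSlabMap θ ∧ ∀ p t, c p ≤ t → t ≤ c' p → θ (p, t) = t := by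
  set w : ℝ → ℝ := fun u => max u 0 / (1 + max u 0) with hw
  have hw1 : ∀ u : ℝ, 0 < 1 + max u 0 := fun u => by linarith [one_le_one_add_max u]
  have hwc : Continuous w := by
    simp only [hw]
    fun_prop (disch := exact fun u => (hw1 u).ne')
  have hwm : Monotone w := by
    intro u v huv
    simp only [hw]
    rw [div_le_div_iff₀ (hw1 u) (hw1 v)]
    have := max_le_max_right 0 huv
    nlinarith
  have hws : ∀ u v, 0 ≤ u → u < v → w u < w v := by
    intro u v hu huv
    simp only [hw]
    rw [div_lt_div_iff₀ (hw1 u) (hw1 v), max_eq_left hu, max_eq_left (hu.trans huv.le)]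
    nlinarith
  have hw0 : ∀ u, u ≤ 0 → w u = 0 := fun u hu => by simp [hw, max_eq_right hu]
  have hwn : ∀ u, 0 ≤ w u := fun u => div_nonneg (le_max_right _ _) (hw1 u).le
  have hwl : ∀ u, w u < 1 := fun u => by
    simp only [hw]
    rw [div_lt_one (hw1 u)]
    linarith
  have hwsurj : ∀ y, 0 ≤ y → y < 1 → ∃ u, 0 ≤ u ∧ w u = y := by
    intro y hy hy1
    have : 0 < 1 - y := by linarith
    have h : 0 ≤ y / (1 - y) := by positivity
    refine ⟨y / (1 - y), h, ?_⟩
    simp only [hw, max_eq_left h]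
    field_simp
    ring
  set θ : P × ℝ → ℝ := fun x => min (max x.2 (c x.1)) (c' x.1) +
    (Real.pi - c' x.1) * w (x.2 - c' x.1) - c x.1 * w (c x.1 - x.2) with hθ
  have hmid : ∀ p t, c p ≤ t → t ≤ c' p → θ (p, t) = t := by
    intro p t h2 h3
    simp only [hθ]
    rw [hw0 _ (by linarith), hw0 _ (by linarith), max_eq_left h2, min_eq_left h3]
    ring
  have hlow : ∀ p t, t ≤ c p → θ (p, t) = c p - c p * w (c p - t) := by
    intro p t h2
    simp only [hθ]
    rw [hw0 (t - c' p) (by linarith [h1 p]), max_eq_right h2, min_eq_left (h1 p).le]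
    ring
  have hhigh : ∀ p t, c' p ≤ t → θ (p, t) = c' p + (Real.pi - c' p) * w (t - c' p) := by
    intro p t h2
    have := h1 p
    simp only [hθ]
    rw [hw0 (c p - t) (by linarith), max_eq_left (by linarith), min_eq_right h2]
    ring
  refine ⟨θ, ⟨by simp only [hθ]; fun_prop, fun p s t hst => ?_, fun p => ?_⟩, hmid⟩
  · have e1 : min (max s (c p)) (c' p) ≤ min (max t (c p)) (c' p) := by gcongr
    have e2 : w (s - c' p) ≤ w (t - c' p) := hwm (by linarith)
    have e3 : w (c p - t) ≤ w (c p - s) := hwm (by linarith)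
    have q1 : 0 < Real.pi - c' p := by linarith [hpi p]
    have q2 := h0 p
    have f2 := mul_le_mul_of_nonneg_left e2 q1.le
    have f3 := mul_le_mul_of_nonneg_left e3 q2.le
    simp only [hθ]
    rcases lt_or_ge s (c p) with h | h
    · have e3 : w (c p - t) < w (c p - s) := by
        rcases le_total t (c p) with h' | h'
        · exact hws _ _ (by linarith) (by linarith)
        · rw [hw0 _ (by linarith : c p - t ≤ 0), ← hw0 0 le_rfl]
          exact hws _ _ le_rfl (by linarith)
      have f3 := mul_lt_mul_of_pos_left e3 q2
      linarith
    rcases lt_or_ge (c' p) t with h' | h'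
    · have e2 : w (s - c' p) < w (t - c' p) := by
        rcases le_total (c' p) s with h'' | h''
        · exact hws _ _ (by linarith) (by linarith)
        · rw [hw0 _ (by linarith : s - c' p ≤ 0), ← hw0 0 le_rfl]
          exact hws _ _ le_rfl (by linarith)
      have f2 := mul_lt_mul_of_pos_left e2 q1
      linarith
    · have : min (max s (c p)) (c' p) < min (max t (c p)) (c' p) := by
        rw [max_eq_left h, max_eq_left (h.trans hst.le), min_eq_left h',
          min_eq_left (hst.le.trans h')]
        exact hst
      linarith
  · have q1 : 0 < Real.pi - c' p := by linarith [hpi p]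
    have q2 := h0 p
    have q3 := h1 p
    ext y
    constructor
    · rintro ⟨t, rfl⟩
      simp only
      rcases le_total t (c p) with h | h
      · rw [hlow p t h]
        have := hwl (c p - t)
        have := hwn (c p - t)
        constructor <;> nlinarith
      rcases le_total t (c' p) with h' | h'
      · rw [hmid p t h h']
        constructor <;> linarith
      · rw [hhigh p t h']
        have := hwl (t - c' p)
        have := hwn (t - c' p)
        constructor <;> nlinarith
    · rintro ⟨h2, h3⟩
      rcases le_total y (c p) with h | h
      · obtain ⟨u, hu, hwu⟩ := hwsurj (1 - y / c p)
          (by rw [sub_nonneg, div_le_one q2]; exact h) (by linarith [div_pos h2 q2])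
        refine ⟨c p - u, ?_⟩
        simp only
        rw [hlow p _ (by linarith), sub_sub_cancel, hwu]
        field_simp
        ring
      rcases le_total y (c' p) with h' | h'
      · exact ⟨y, hmid p y h h'⟩
      · obtain ⟨u, hu, hwu⟩ := hwsurj ((y - c' p) / (Real.pi - c' p))
          (div_nonneg (by linarith) q1.le) (by rw [div_lt_one q1]; linarith)
        refine ⟨c' p + u, ?_⟩
        simp only
        rw [hhigh p _ (by linarith), add_sub_cancel_left, hwu, mul_div_cancel₀ _ q1.ne']
        ring

/-- A map of the polar cover which moves angles boundedly and which, near the zero section,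
moves points by an asymptotically negligible amount in the other directions. -/
structure IsControlled {V : Type*} [TopologicalSpace V]
    (f : (V × ℝ) × ℝ → (V × ℝ) × ℝ) : Prop where
  angle : ∃ K, ∀ x, |(f x).2 - x.2| ≤ K
  base : ∀ v, Tendsto (fun x => (f x).1.1) ((𝓝 v ×ˢ atTop) ×ˢ ⊤) (𝓝 v)
  height : ∀ v, Tendsto (fun x => (f x).1.2 - x.1.2) ((𝓝 v ×ˢ atTop) ×ˢ ⊤) (𝓝 0)

namespace RadialScale

variable {V : Type*} [NormedAddCommGroup V] (R : RadialScale V)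

/-- Polar coordinates of a point of `V × ℂ`, with the angle in `[0, π]`. -/
noncomputable def unpolar (y : V × ℂ) : (V × ℝ) × ℝ :=
  ((y.1, R.height y), Real.arccos (y.2.re / ‖y.2‖))

theorem polar_unpolar {y : V × ℂ} (h0 : y.2 ≠ 0) (him : 0 ≤ y.2.im) :
    R.polar (R.unpolar y) = y := by
  refine R.polar_eq rfl (norm_pos_iff.2 h0) ?_
  rw [← Complex.arg_of_im_nonneg_of_ne_zero him h0, Complex.norm_mul_exp_arg_mul_I]

theorem unpolar_polar (x : (V × ℝ) × ℝ) (h : x.2 ∈ Icc 0 Real.pi) :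
    R.unpolar (R.polar x) = x := by
  refine Prod.ext (Prod.ext rfl (R.height_polar x)) ?_
  simp only [unpolar]
  rw [R.norm_polar, R.polar_re, mul_div_cancel_left₀ _ (Real.exp_pos _).ne',
    Real.arccos_cos h.1 h.2]

theorem continuousAt_angle {y : V × ℂ} (hy : y.2 ≠ 0) :
    ContinuousAt (fun y : V × ℂ => Real.arccos (y.2.re / ‖y.2‖)) y := by
  have h1 : Continuous fun y : V × ℂ => y.2.re := Complex.continuous_re.comp continuous_snd
  exact Real.continuous_arccos.continuousAt.comp (f := fun y : V × ℂ => y.2.re / ‖y.2‖)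
    (h1.continuousAt.div (by fun_prop) (norm_ne_zero_iff.2 hy))

theorem continuousAt_unpolar {y : V × ℂ} (hy : y.2 ≠ 0) : ContinuousAt R.unpolar y :=
  (continuousAt_fst.prodMk (R.continuousAt_height hy)).prodMk (continuousAt_angle hy)

/-- The chart of the open upper half space associated with a slab map. -/
noncomputable def slabChart (θ : (V × ℝ) × ℝ → ℝ) (x : (V × ℝ) × ℝ) : V × ℂ :=
  R.polar ((x.1.1, x.1.2 - slowGrowth x.2), θ ((x.1.1, x.1.2 - slowGrowth x.2), x.2))

variable {θ θ' : (V × ℝ) × ℝ → ℝ}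

theorem slabChart_im_pos (hθ : IsSlabMap θ) (x : (V × ℝ) × ℝ) : 0 < (R.slabChart θ x).2.im := by
  have h := hθ.mem_Ioo (x.1.1, x.1.2 - slowGrowth x.2) x.2
  rw [slabChart, R.polar_im]
  exact mul_pos (Real.exp_pos _) (Real.sin_pos_of_pos_of_lt_pi h.1 h.2)

theorem range_slabChart (hθ : IsSlabMap θ) : range (R.slabChart θ) = {y | 0 < y.2.im} := by
  ext y
  constructor
  · rintro ⟨x, rfl⟩
    exact R.slabChart_im_pos hθ x
  · intro (hy : 0 < y.2.im)
    have hy0 : y.2 ≠ 0 := fun h => by simp [h] at hy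
    have h1 : Real.arccos (y.2.re / ‖y.2‖) ∈ Ioo 0 Real.pi := by
      rw [← Complex.arg_of_im_nonneg_of_ne_zero hy.le hy0]
      refine ⟨lt_of_le_of_ne (Complex.arg_nonneg_iff.2 hy.le) fun h => ?_,
        Complex.arg_lt_pi_iff.2 (.inr hy.ne')⟩
      exact hy.ne (Complex.arg_eq_zero_iff.1 h.symm).2.symm
    obtain ⟨t, ht⟩ := (hθ.range_eq (y.1, R.height y)).symm ▸ h1
    simp only at ht
    refine ⟨((y.1, R.height y + slowGrowth t), t), ?_⟩
    simp only [slabChart, add_sub_cancel_right, ht]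
    exact R.polar_unpolar hy0 hy.le

theorem isOpenEmbedding_slabChart (hθ : IsSlabMap θ) : IsOpenEmbedding (R.slabChart θ) := by
  let shear : ((V × ℝ) × ℝ) ≃ₜ ((V × ℝ) × ℝ) :=
    { toFun := fun x => ((x.1.1, x.1.2 - slowGrowth x.2), x.2)
      invFun := fun x => ((x.1.1, x.1.2 + slowGrowth x.2), x.2)
      left_inv := fun x => by simp
      right_inv := fun x => by simp
      continuous_toFun := by have := continuous_slowGrowth; fun_prop
      continuous_invFun := by have := continuous_slowGrowth; fun_prop }
  have h1 := (fiberwise_isOpenEmbedding hθ.cont hθ.mono).comp shear.isOpenEmbedding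
  have heq : R.slabChart θ = R.polar ∘ ((fun x => (x.1, θ x)) ∘ shear) := rfl
  have hinv : ∀ x, R.unpolar (R.slabChart θ x) = ((fun x => (x.1, θ x)) ∘ shear) x := fun x => by
    rw [heq]
    exact R.unpolar_polar _ (Ioo_subset_Icc_self (hθ.mem_Ioo _ _))
  refine .of_continuous_injective_isOpenMap (R.continuous_polar.comp h1.continuous) ?_ ?_
  · intro x y hxy
    refine h1.injective ?_
    rw [← hinv, ← hinv, hxy]
  · intro U hU
    have h2 : R.slabChart θ '' U =
        {y | 0 < y.2.im} ∩ R.unpolar ⁻¹' (((fun x => (x.1, θ x)) ∘ shear) '' U) := by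
      ext y
      constructor
      · rintro ⟨x, hx, rfl⟩
        exact ⟨R.slabChart_im_pos hθ x, x, hx, (hinv x).symm⟩
      · rintro ⟨hy, hy2⟩
        rw [← R.range_slabChart hθ] at hy
        obtain ⟨x, rfl⟩ := hy
        obtain ⟨x', hx', hxx⟩ := hy2
        rw [hinv] at hxx
        exact ⟨x, h1.injective hxx ▸ hx', rfl⟩
    rw [h2]
    refine ContinuousOn.isOpen_inter_preimage (fun y hy => ?_) ?_ (h1.isOpenMap U hU)
    · refine (R.continuousAt_unpolar fun h => ?_).continuousWithinAt
      simp only [mem_ofPred_eq, h, Complex.zero_im, lt_irrefl] at hy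
    · exact isOpen_lt continuous_const (Complex.continuous_im.comp continuous_snd)

theorem tendsto_slabChart_comp (hθ : IsSlabMap θ) (hθ' : IsSlabMap θ')
    {f : (V × ℝ) × ℝ → (V × ℝ) × ℝ} (hf : IsControlled f) {y : V × ℂ} (hy : y.2.im ≤ 0) :
    Tendsto (R.slabChart θ' ∘ f) (comap (R.slabChart θ) (𝓝 y)) (𝓝 y) := by
  obtain ⟨K, hK⟩ := hf.angle
  set l := comap (R.slabChart θ) (𝓝 y) with hl
  have hψ : Tendsto (R.slabChart θ) l (𝓝 y) := tendsto_comap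
  have hne : ∀ x, (R.slabChart θ x).2 ≠ 0 := fun x => R.polar_snd_ne _
  have hv : Tendsto (fun x : (V × ℝ) × ℝ => x.1.1) l (𝓝 y.1) :=
    (continuous_fst.tendsto y).comp hψ
  have hh : ∀ x, R.height (R.slabChart θ x) = x.1.2 - slowGrowth x.2 := fun x =>
    R.height_polar _
  have hcontrol : Tendsto (fun x : (V × ℝ) × ℝ => x.1.2) l atTop →
      Tendsto (fun x => (f x).1.1) l (𝓝 y.1) ∧ Tendsto (fun x => (f x).1.2 - x.1.2) l (𝓝 0) := by
    intro h
    have h2 : Tendsto (fun x : (V × ℝ) × ℝ => x) l ((𝓝 y.1 ×ˢ atTop) ×ˢ ⊤) :=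
      (hv.prodMk h).prodMk tendsto_top
    exact ⟨(hf.base y.1).comp h2, (hf.height y.1).comp h2⟩
  rcases hy.lt_or_eq with him | him
  · have : l = ⊥ := by
      rw [← empty_mem_iff_bot, hl, mem_comap]
      refine ⟨{y | y.2.im < 0}, (isOpen_lt (Complex.continuous_im.comp continuous_snd)
        continuous_const).mem_nhds him, fun x hx => ?_⟩
      exact (lt_asymm (R.slabChart_im_pos hθ x) hx).elim
    rw [this]
    exact tendsto_bot
  by_cases h0 : y.2 = 0
  · obtain ⟨v, z⟩ := y
    simp only at h0 hv hcontrol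
    subst h0
    have hs : Tendsto (fun x : (V × ℝ) × ℝ => x.1.2 - slowGrowth x.2) l atTop := by
      refine ((R.tendsto_height v).comp (tendsto_nhdsWithin_iff.2 ⟨hψ, .of_forall hne⟩)).congr hh
    have hs' : Tendsto (fun x : (V × ℝ) × ℝ => x.1.2) l atTop :=
      tendsto_atTop_mono (fun x => by linarith [slowGrowth_nonneg x.2]) hs
    obtain ⟨h1, h2⟩ := hcontrol hs'
    have h3 : Tendsto (fun x => (f x).1.2 - slowGrowth (f x).2) l atTop := by
      refine tendsto_atTop_mono (fun x => ?_)
        (tendsto_atTop_add_const_right l (-K) (hs.atTop_add h2))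
      have := abs_slowGrowth_sub_le_self (hK x)
      rw [abs_le] at this
      linarith [this.2]
    exact (R.tendsto_polar v).comp ((h1.prodMk h3).prodMk tendsto_top)
  · set s₀ := R.height y with hs₀
    set α := Real.arccos (y.2.re / ‖y.2‖) with hα
    have hs : Tendsto (fun x : (V × ℝ) × ℝ => x.1.2 - slowGrowth x.2) l (𝓝 s₀) :=
      ((R.continuousAt_height h0).tendsto.comp hψ).congr hh
    have hp : Tendsto (fun x : (V × ℝ) × ℝ => (x.1.1, x.1.2 - slowGrowth x.2)) l
        (𝓝 (y.1, s₀)) := hv.prodMk_nhds hs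
    have ha : Tendsto (fun x : (V × ℝ) × ℝ => θ ((x.1.1, x.1.2 - slowGrowth x.2), x.2)) l
        (𝓝 α) := by
      refine ((continuousAt_angle h0).tendsto.comp hψ).congr fun x => ?_
      exact congrArg Prod.snd (R.unpolar_polar _ (Ioo_subset_Icc_self (hθ.mem_Ioo _ _)))
    have key : Tendsto (fun x : (V × ℝ) × ℝ => |x.2|) l atTop →
        Tendsto (fun x => ((f x).1.1, (f x).1.2 - slowGrowth (f x).2)) l (𝓝 (y.1, s₀)) := by
      intro h
      have h1 : Tendsto (fun x : (V × ℝ) × ℝ => x.1.2) l atTop := by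
        refine (hs.add_atTop (tendsto_slowGrowth h)).congr fun x => ?_
        ring
      obtain ⟨h2, h3⟩ := hcontrol h1
      refine h2.prodMk_nhds ?_
      have h4 := (hs.add h3).sub (tendsto_slowGrowth_sub hK h)
      simp only [add_zero, sub_zero] at h4
      refine h4.congr fun x => ?_
      ring
    have fin : Tendsto (fun x => ((f x).1.1, (f x).1.2 - slowGrowth (f x).2)) l
        (𝓝 (y.1, s₀)) → Tendsto (fun x => θ' (((f x).1.1, (f x).1.2 - slowGrowth (f x).2),
          (f x).2)) l (𝓝 α) → Tendsto (R.slabChart θ' ∘ f) l (𝓝 y) := by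
      intro h1 h2
      have h3 := (R.continuous_polar.tendsto ((y.1, s₀), α)).comp (h1.prodMk_nhds h2)
      rwa [show R.polar ((y.1, s₀), α) = y from R.polar_unpolar h0 him.ge] at h3
    have hre : |y.2.re| = ‖y.2‖ := by
      rw [Complex.abs_re_eq_norm]
      exact him
    have hn : 0 < ‖y.2‖ := norm_pos_iff.2 h0
    rcases le_total 0 y.2.re with hre' | hre'
    · have hα0 : α = 0 := by
        rw [hα, ← hre, abs_of_nonneg hre', div_self, Real.arccos_one]
        rw [abs_of_nonneg hre'] at hre
        exact hre ▸ hn.ne'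
      rw [hα0] at ha fin
      have ht := (hθ.tendsto_atBot_iff hp).1 ha
      have h5 := key (tendsto_abs_atBot_atTop.comp ht)
      refine fin h5 ((hθ'.tendsto_atBot_iff h5).2 ?_)
      refine tendsto_atBot_mono (fun x => ?_) (tendsto_atBot_add_const_right l K ht)
      have := (abs_le.1 (hK x)).2
      linarith
    · have hα0 : α = Real.pi := by
        rw [hα, ← hre, abs_of_nonpos hre', div_neg, div_self, Real.arccos_neg_one]
        rw [abs_of_nonpos hre'] at hre
        intro h
        rw [h] at hre
        simp at hre
        exact hn.ne hre
      rw [hα0] at ha fin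
      have ht := (hθ.tendsto_atTop_iff hp).1 ha
      have h5 := key (tendsto_abs_atTop_atTop.comp ht)
      refine fin h5 ((hθ'.tendsto_atTop_iff h5).2 ?_)
      refine tendsto_atTop_mono (fun x => ?_) (tendsto_atTop_add_const_right l (-K) ht)
      have := (abs_le.1 (hK x)).1
      linarith

theorem exists_pushdown (f : ((V × ℝ) × ℝ) ≃ₜ ((V × ℝ) × ℝ)) (hf : IsControlled f)
    (hf' : IsControlled f.symm) {β₁ β₂ : ℝ} (hβ : β₁ < β₂) {b : Set ℝ} (hb : b ⊆ {β₁, β₂})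
    (hbn : b.Nonempty) (hfb : ∀ β ∈ b, ∀ p, (f (p, β)).2 ∈ Ioo 0 Real.pi) :
    ∃ G : (V × ℂ) ≃ₜ (V × ℂ), (∀ y, y.2.im ≤ 0 → G y = y) ∧ ∀ β ∈ b,
      G '' (R.polar '' {x | x.2 = Real.pi / 2 + Real.arctan (2 / (β₂ - β₁) * (β - (β₁ + β₂) / 2))})
        = R.polar '' (f '' {x | x.2 = β}) := by
  have hpi := Real.pi_pos
  set B : Set ((V × ℝ) × ℝ) := f '' {x | x.2 ∈ b} with hB
  have hbc : IsClosed b := ((Set.toFinite {β₁, β₂}).subset hb).isClosed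
  have hBc : IsClosed B := f.isClosedMap _ (hbc.preimage continuous_snd)
  have hBn : B.Nonempty := by
    obtain ⟨β, hβ⟩ := hbn
    exact ⟨_, (0, β), hβ, rfl⟩
  have hB' : ∀ x ∈ B, x.2 ∈ Ioo 0 Real.pi := by
    rintro _ ⟨⟨p, β⟩, hx, rfl⟩
    exact hfb β hx p
  have dist_eq : ∀ (p : V × ℝ) (s t : ℝ), dist (p, s) (p, t) = |s - t| := fun p s t => by
    simp [Prod.dist_eq, Real.dist_eq]
  have hpos : ∀ t, t ∉ Ioo 0 Real.pi → ∀ p : V × ℝ, 0 < Metric.infDist (p, t) B := by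
    intro t ht p
    rw [← hBc.notMem_iff_infDist_pos hBn]
    exact fun h => ht (hB' _ h)
  have hcont : ∀ t, Continuous fun p : V × ℝ => Metric.infDist (p, t) B := fun t =>
    (Metric.continuous_infDist_pt B).comp (by fun_prop)
  have hc1 := hcont 0
  have hc2 := hcont Real.pi
  have h3pi := Real.pi_gt_three
  obtain ⟨θ, hθ, hθB⟩ := exists_isSlabMap_eq (P := V × ℝ)
    (c := fun p => min 1 (Metric.infDist (p, 0) B))
    (c' := fun p => Real.pi - min 1 (Metric.infDist (p, Real.pi) B))
    (by fun_prop) (by fun_prop) (fun p => lt_min one_pos (hpos 0 (by simp) p))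
    (fun p => by
      have := min_le_left 1 (Metric.infDist (p, (0 : ℝ)) B)
      have := min_le_left 1 (Metric.infDist (p, Real.pi) B)
      linarith)
    (fun p => by
      have := lt_min one_pos (hpos Real.pi (by simp) p)
      linarith)
  have hθB' : ∀ x ∈ B, θ x = x.2 := by
    rintro ⟨p, t⟩ hx
    have ht := hB' _ hx
    simp only at ht
    refine hθB p t ((min_le_right _ _).trans ?_) ?_
    · refine (Metric.infDist_le_dist_of_mem hx).trans ?_
      rw [dist_eq, zero_sub, abs_neg, abs_of_pos ht.1]
    · have := (min_le_right 1 _).trans (Metric.infDist_le_dist_of_mem (x := (p, Real.pi)) hx)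
      rw [dist_eq, abs_of_pos (by linarith [ht.2])] at this
      linarith
  have ha : 0 < 2 / (β₂ - β₁) := div_pos two_pos (by linarith)
  have hθ₁ := isSlabMap_arctan (P := V × ℝ) (m := (β₁ + β₂) / 2) ha
  set θ₁ : (V × ℝ) × ℝ → ℝ :=
    fun x => Real.pi / 2 + Real.arctan (2 / (β₂ - β₁) * (x.2 - (β₁ + β₂) / 2)) with hθ₁'
  have hnot : ∀ y, y ∉ range (R.slabChart θ₁) → y.2.im ≤ 0 := fun y hy => by
    rw [R.range_slabChart hθ₁] at hy
    exact not_lt.1 hy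
  obtain ⟨G, hG1, hG2⟩ := exists_extend_homeomorph (R.isOpenEmbedding_slabChart hθ₁)
    (R.isOpenEmbedding_slabChart hθ) ((R.range_slabChart hθ₁).trans (R.range_slabChart hθ).symm) f
    (fun y hy => R.tendsto_slabChart_comp hθ₁ hθ hf (hnot y hy))
    (fun y hy => R.tendsto_slabChart_comp hθ hθ₁ hf' (hnot y hy))
  refine ⟨G, fun y hy => hG2 y ?_, fun β hβb => ?_⟩
  · rw [R.range_slabChart hθ₁]
    exact not_lt.2 hy
  · have e1 : R.polar '' {x | x.2 = Real.pi / 2 +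
        Real.arctan (2 / (β₂ - β₁) * (β - (β₁ + β₂) / 2))} = R.slabChart θ₁ '' {x | x.2 = β} := by
      ext y
      constructor
      · rintro ⟨⟨⟨v, s⟩, t⟩, hx, rfl⟩
        refine ⟨((v, s + slowGrowth β), β), rfl, ?_⟩
        simp only [mem_ofPred_eq] at hx
        simp [slabChart, hθ₁', hx]
      · rintro ⟨⟨⟨v, s⟩, t⟩, hx, rfl⟩
        simp only [mem_ofPred_eq] at hx
        subst hx
        exact ⟨_, rfl, rfl⟩
    have e2 : ∀ x ∈ B, R.slabChart θ x = R.polar x := by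
      intro x hx
      have h := hB' x hx
      have h0 : slowGrowth x.2 = 0 :=
        slowGrowth_eq_zero (by rw [abs_of_pos h.1]; exact h.2.le)
      rw [slabChart, h0, sub_zero]
      simp only [Prod.mk.eta]
      rw [hθB' x hx]
    rw [e1, ← image_comp, ← image_comp]
    refine image_congr fun x (hx : x.2 = β) => ?_
    rw [Function.comp_apply, hG1, Function.comp_apply, e2]
    exact ⟨x, by rw [mem_ofPred_eq, hx]; exact hβb, rfl⟩

end RadialScale

section Periodic

variable {P : Type*}

theorem apply_add_int_mul_two_pi {f : P × ℝ → P × ℝ}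
    (hf : ∀ p t, f (p, t + 2 * Real.pi) = ((f (p, t)).1, (f (p, t)).2 + 2 * Real.pi))
    (p : P) (t : ℝ) (k : ℤ) :
    f (p, t + k * (2 * Real.pi)) = ((f (p, t)).1, (f (p, t)).2 + k * (2 * Real.pi)) := by
  induction k using Int.induction_on with
  | zero => simp
  | succ i ih =>
    have := hf p (t + i * (2 * Real.pi))
    push_cast at ih ⊢
    rw [show t + (i + 1) * (2 * Real.pi) = t + i * (2 * Real.pi) + 2 * Real.pi by ring, this, ih]
    exact Prod.ext rfl (by simp only; ring)
  | pred i ih =>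
    have := hf p (t + (-i - 1) * (2 * Real.pi))
    push_cast at ih ⊢
    rw [show t + (-i - 1) * (2 * Real.pi) + 2 * Real.pi = t + -i * (2 * Real.pi) by ring, ih]
      at this
    have h1 := congrArg Prod.fst this
    have h2 := congrArg Prod.snd this
    simp only at h1 h2
    exact Prod.ext h1.symm (by simp only; linarith)

variable [NormedAddCommGroup P] [NormedSpace ℝ P]

theorem exists_angle_bound (f : (P × ℝ) ≃ₜ (P × ℝ))
    (hf : ∀ p t, f (p, t + 2 * Real.pi) = ((f (p, t)).1, (f (p, t)).2 + 2 * Real.pi))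
    (h0 : ∀ p, (f (p, 0)).2 ∈ Ioo 0 Real.pi) : ∃ K, ∀ x, |(f x).2 - x.2| ≤ K := by
  have hpi := Real.pi_pos
  have ivt : ∀ (s : Set (P × ℝ)) (_ : Convex ℝ s) (c : ℝ) (a b : P × ℝ),
      f a ∈ s → f b ∈ s → a.2 ≤ c → c ≤ b.2 → ∃ q, f (q, c) ∈ s := by
    intro s hs c a b ha hb hac hcb
    have hcont : ContinuousOn (fun y => (f.symm y).2) s :=
      (continuous_snd.comp f.symm.continuous).continuousOn
    obtain ⟨y, hy, hyc⟩ := hs.isPreconnected.intermediate_value ha hb hcont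
      (show c ∈ Icc _ _ by simpa using ⟨hac, hcb⟩)
    refine ⟨(f.symm y).1, ?_⟩
    rw [← hyc]
    simpa using hy
  have key : ∀ p t, 0 ≤ t → t < 2 * Real.pi →
      0 < (f (p, t)).2 ∧ (f (p, t)).2 < 3 * Real.pi := by
    intro p t ht ht'
    constructor
    · by_contra! hcon
      have hs : Convex ℝ {y : P × ℝ | y.2 ≤ 0} :=
        (convex_Iic (0 : ℝ)).linear_preimage (LinearMap.snd ℝ P ℝ)
      have h2 := apply_add_int_mul_two_pi hf p t (-1)
      obtain ⟨q, hq⟩ := ivt _ hs 0 (p, t + (-1 : ℤ) * (2 * Real.pi)) (p, t)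
        (by rw [h2]; change (f (p, t)).2 + _ ≤ 0; push_cast; linarith) hcon
        (by push_cast; linarith) ht
      exact absurd (h0 q).1 (not_lt.2 hq)
    · by_contra! hcon
      have hs : Convex ℝ {y : P × ℝ | 3 * Real.pi ≤ y.2} :=
        (convex_Ici (3 * Real.pi : ℝ)).linear_preimage (LinearMap.snd ℝ P ℝ)
      obtain ⟨q, hq⟩ := ivt _ hs (2 * Real.pi) (p, t) (p, t + 2 * Real.pi) hcon
        (by rw [hf]; change _ ≤ (f (p, t)).2 + _; linarith) ht'.le (by simp only; linarith)
      have := hf q 0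
      rw [zero_add] at this
      simp only [this, mem_ofPred_eq] at hq
      linarith [(h0 q).2]
  refine ⟨5 * Real.pi, fun x => ?_⟩
  obtain ⟨p, t⟩ := x
  set k : ℤ := ⌊t / (2 * Real.pi)⌋
  have hk1 : k * (2 * Real.pi) ≤ t := (le_div_iff₀ (by positivity)).1 (Int.floor_le _)
  have hk2 : t < (k + 1) * (2 * Real.pi) :=
    (div_lt_iff₀ (by positivity)).1 (Int.lt_floor_add_one _)
  obtain ⟨h1, h2⟩ := key p (t - k * (2 * Real.pi)) (by linarith) (by linarith)
  have h3 := apply_add_int_mul_two_pi hf p (t - k * (2 * Real.pi)) k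
  rw [sub_add_cancel] at h3
  rw [h3, abs_le]
  simp only
  constructor <;> linarith

end Periodic

namespace RadialScale

variable {V : Type*} [NormedAddCommGroup V] (R : RadialScale V)

/-- A preconnected family of angles with positive sine lies in a single translate of `(0, π)`. -/
theorem exists_int_forall_mem_Ioo {P : Type*} [TopologicalSpace P] [PreconnectedSpace P]
    [Nonempty P]
    {g : P → ℝ} (hg : Continuous g) (h : ∀ p, 0 < Real.sin (g p)) :
    ∃ k : ℤ, ∀ p, g p + k * (2 * Real.pi) ∈ Ioo 0 Real.pi := by
  have hpi := Real.pi_pos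
  obtain ⟨p₀⟩ := ‹Nonempty P›
  set k : ℤ := ⌊g p₀ / (2 * Real.pi)⌋
  have hk1 : k * (2 * Real.pi) ≤ g p₀ := (le_div_iff₀ (by positivity)).1 (Int.floor_le _)
  have hk2 : g p₀ < (k + 1) * (2 * Real.pi) :=
    (div_lt_iff₀ (by positivity)).1 (Int.lt_floor_add_one _)
  have hs : ∀ p, 0 < Real.sin (g p + (-k : ℤ) * (2 * Real.pi)) := fun p => by
    rw [Real.sin_add_int_mul_two_pi]; exact h p
  have hc : Continuous fun p => g p + (-k : ℤ) * (2 * Real.pi) := by fun_prop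
  have hp₀ : g p₀ + (-k : ℤ) * (2 * Real.pi) ∈ Ioo 0 Real.pi := by
    have h1 := hs p₀
    push_cast at h1 ⊢
    constructor
    · rcases (show 0 ≤ g p₀ + -k * (2 * Real.pi) by linarith).eq_or_lt with h2 | h2
      · rw [← h2] at h1; simp at h1
      · exact h2
    · by_contra! h2
      have h3 := Real.sin_nonpos_of_nonpos_of_neg_pi_le
        (x := g p₀ + -k * (2 * Real.pi) - 2 * Real.pi) (by linarith) (by linarith)
      rw [Real.sin_sub_two_pi] at h3
      linarith
  refine ⟨-k, fun p => ⟨?_, ?_⟩⟩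
  · by_contra! h1
    obtain ⟨q, hq⟩ := mem_range_of_exists_le_of_exists_ge hc ⟨p, h1⟩ ⟨p₀, hp₀.1.le⟩
    have := hs q
    simp only [hq, Real.sin_zero, lt_irrefl] at this
  · by_contra! h1
    obtain ⟨q, hq⟩ := mem_range_of_exists_le_of_exists_ge hc ⟨p₀, hp₀.2.le⟩ ⟨p, h1⟩
    have := hs q
    simp only [hq, Real.sin_pi, lt_irrefl] at this

theorem isControlled_lift {F : V × ℂ → V × ℂ}
    (hFc : Continuous F) (hF : ∀ v, F (v, 0) = (v, 0))
    (hh : ∀ v, Tendsto (fun y => R.height (F y) - R.height y) (𝓝[{y | y.2 ≠ 0}] (v, 0)) (𝓝 0))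
    {f : (V × ℝ) × ℝ → (V × ℝ) × ℝ} (hf : ∀ x, R.polar (f x) = F (R.polar x))
    (hK : ∃ K, ∀ x, |(f x).2 - x.2| ≤ K) : IsControlled f := by
  have hp : ∀ v, Tendsto R.polar ((𝓝 v ×ˢ atTop) ×ˢ ⊤) (𝓝[{y | y.2 ≠ 0}] (v, 0)) := fun v =>
    tendsto_nhdsWithin_iff.2 ⟨R.tendsto_polar v, .of_forall R.polar_snd_ne⟩
  refine ⟨hK, fun v => ?_, fun v => ?_⟩
  · have h1 : Tendsto (fun y => (F y).1) (𝓝 (v, 0)) (𝓝 v) := by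
      have := (continuous_fst.comp hFc).tendsto (v, 0)
      simpa only [Function.comp_def, hF] using this
    refine (h1.comp (R.tendsto_polar v)).congr fun x => ?_
    simp [← hf]
  · refine ((hh v).comp (hp v)).congr fun x => ?_
    simp only [Function.comp, ← hf, R.height_polar]

theorem isControlled_lift_homeomorph {F : (V × ℂ) ≃ₜ (V × ℂ)} (h0 : ∀ y, (F y).2 = 0 ↔ y.2 = 0)
    (hF : ∀ v, F (v, 0) = (v, 0))
    (hh : ∀ v, Tendsto (fun y => R.height (F y) - R.height y) (𝓝[{y | y.2 ≠ 0}] (v, 0)) (𝓝 0))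
    {f : ((V × ℝ) × ℝ) ≃ₜ ((V × ℝ) × ℝ)} (hf : ∀ x, R.polar (f x) = F (R.polar x))
    (hK : ∃ K, ∀ x, |(f x).2 - x.2| ≤ K) : IsControlled f ∧ IsControlled f.symm := by
  have hs0 : ∀ y, y.2 ≠ 0 → (F.symm y).2 ≠ 0 := fun y hy h => hy (by
    rw [← F.apply_symm_apply y]; exact (h0 _).2 h)
  have hsF : ∀ v, F.symm (v, 0) = (v, 0) := fun v => by
    rw [F.symm_apply_eq, hF]
  refine ⟨R.isControlled_lift F.continuous hF hh hf hK,
    R.isControlled_lift (F := F.symm) F.symm.continuous hsF (fun v => ?_) (fun x => ?_) ?_⟩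
  · have h1 : Tendsto F.symm (𝓝[{y | y.2 ≠ 0}] (v, 0)) (𝓝[{y | y.2 ≠ 0}] (v, 0)) := by
      refine tendsto_nhdsWithin_iff.2 ⟨?_, eventually_nhdsWithin_of_forall hs0⟩
      have := F.symm.continuous.tendsto (v, 0)
      rw [hsF] at this
      exact this.mono_left nhdsWithin_le_nhds
    have h2 := ((hh v).comp h1).neg
    rw [neg_zero] at h2
    refine h2.congr fun y => ?_
    simp
  · apply F.injective; rw [← hf, f.apply_symm_apply, F.apply_symm_apply]
  · obtain ⟨K, hK⟩ := hK
    refine ⟨K, fun x => ?_⟩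
    have := hK (f.symm x)
    rwa [f.apply_symm_apply, abs_sub_comm] at this

theorem image_polar_angle {V : Type*} [TopologicalSpace V] (R : RadialScale V) (a : ℝ) :
    R.polar '' {x | x.2 = a} =
    {y | ∃ r : ℝ, 0 < r ∧ y.2 = r * Complex.exp (a * Complex.I)} := by
  ext ⟨v, z⟩
  constructor
  · rintro ⟨⟨⟨w, s⟩, t⟩, rfl : t = a, h⟩
    refine ⟨_, Real.exp_pos (-(R.toHomeo.symm (w, s)).2), ?_⟩
    rw [← h, polar]
    simp only
    rw [show (⟨-(R.toHomeo.symm (w, s)).2, t⟩ : ℂ) =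
      ((-(R.toHomeo.symm (w, s)).2 : ℝ) : ℂ) + t * Complex.I by simp [Complex.ext_iff],
      Complex.exp_add, Complex.ofReal_exp]
  · rintro ⟨r, hr, hz⟩
    exact ⟨((v, R.height (v, z)), a), rfl, R.polar_eq rfl hr hz⟩

end RadialScale

section Transverse

variable {V : Type*} [NormedAddCommGroup V] [NormedSpace ℝ V]

theorem snd_eq_zero_iff_of_fixes {V : Type*} [TopologicalSpace V] {F : (V × ℂ) ≃ₜ (V × ℂ)}
    (hF : ∀ v, F (v, 0) = (v, 0))
    (y : V × ℂ) : (F y).2 = 0 ↔ y.2 = 0 := by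
  constructor
  · intro h
    have h1 : F y = F ((F y).1, 0) := by rw [hF, ← h]
    rw [F.injective h1]
  · intro h
    rw [show y = (y.1, 0) from Prod.ext rfl h, hF]

theorem exists_controlled_lift {F : (V × ℂ) ≃ₜ (V × ℂ)} (hF : ∀ v, F (v, 0) = (v, 0))
    (hpos : ∀ v, ∀ r : ℝ, 0 < r → 0 < (F (v, r)).2.im) :
    ∃ (R : RadialScale V) (F₁ : (V × ℂ) ≃ₜ (V × ℂ)) (f : ((V × ℝ) × ℝ) ≃ₜ ((V × ℝ) × ℝ)),
      (∀ v, ∀ r : ℝ, F₁ (v, r) = F (v, r)) ∧ (∀ x, R.polar (f x) = F₁ (R.polar x)) ∧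
      (∀ p t, f (p, t + 2 * Real.pi) = ((f (p, t)).1, (f (p, t)).2 + 2 * Real.pi)) ∧
      (∀ p, (f (p, 0)).2 ∈ Ioo 0 Real.pi) ∧ IsControlled f ∧ IsControlled f.symm := by
  obtain ⟨R, hR⟩ := exists_radialScale F hF
  obtain ⟨F₁, f, hF₁, h0, hh, hf, hper⟩ :=
    R.exists_oriented_lift F (snd_eq_zero_iff_of_fixes hF)
  have hsin : ∀ p, 0 < Real.sin (f (p, 0)).2 := by
    intro p
    have h1 : R.polar (p, 0) = (p.1, ((Real.exp (-(R.toHomeo.symm p).2) : ℝ) : ℂ)) := by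
      refine Prod.ext rfl (Complex.ext ?_ ?_)
      · rw [R.polar_re]
        change _ = Complex.re (Complex.ofReal _)
        rw [Complex.ofReal_re]
        simp
      · rw [R.polar_im]
        change _ = Complex.im (Complex.ofReal _)
        rw [Complex.ofReal_im]
        simp
    have h2 := hpos p.1 _ (Real.exp_pos (-(R.toHomeo.symm p).2))
    rw [← hF₁, ← h1, ← hf, R.polar_im] at h2
    exact pos_of_mul_pos_right h2 (Real.exp_pos _).le
  obtain ⟨k, hk⟩ := RadialScale.exists_int_forall_mem_Ioo
    (g := fun p : V × ℝ => (f (p, 0)).2) (by fun_prop) hsin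
  set g : ((V × ℝ) × ℝ) ≃ₜ ((V × ℝ) × ℝ) :=
    f.trans ((Homeomorph.refl _).prodCongr (Homeomorph.addRight (k * (2 * Real.pi))))
  have hg : ∀ x, g x = ((f x).1, (f x).2 + k * (2 * Real.pi)) := fun x => rfl
  have hgF : ∀ x, R.polar (g x) = F₁ (R.polar x) := fun x => by
    rw [hg, R.polar_add_two_pi, hf]
  have hgper : ∀ p t, g (p, t + 2 * Real.pi) = ((g (p, t)).1, (g (p, t)).2 + 2 * Real.pi) :=
    fun p t => by rw [hg, hg, hper]; exact Prod.ext rfl (by simp only; ring)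
  have hF₁0 : ∀ v, F₁ (v, 0) = (v, 0) := fun v => by
    have := hF₁ v 0
    rwa [Complex.ofReal_zero, hF] at this
  refine ⟨R, F₁, g, hF₁, hgF, hgper, hk, ?_⟩
  exact R.isControlled_lift_homeomorph h0 hF₁0 (fun v => hh v _ (hR v)) hgF
    (exists_angle_bound g hgper hk)

theorem pi_div_two_add_arctan (β₁ β₂ : ℝ) (h : β₁ < β₂) :
    Real.pi / 2 + Real.arctan (2 / (β₂ - β₁) * (β₁ - (β₁ + β₂) / 2)) = Real.pi / 4 ∧
    Real.pi / 2 + Real.arctan (2 / (β₂ - β₁) * (β₂ - (β₁ + β₂) / 2)) = 3 * Real.pi / 4 := by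
  have h' : β₂ - β₁ ≠ 0 := by linarith
  have h1 : 2 / (β₂ - β₁) * (β₁ - (β₁ + β₂) / 2) = -1 := by field_simp; ring
  have h2 : 2 / (β₂ - β₁) * (β₂ - (β₁ + β₂) / 2) = 1 := by field_simp; ring
  rw [h1, h2, Real.arctan_neg, Real.arctan_one]
  constructor <;> ring

theorem ray_pi_div_four {V : Type*} : {y : V × ℂ | ∃ r : ℝ, 0 < r ∧
      y.2 = r * Complex.exp ((Real.pi / 4 : ℝ) * Complex.I)} =
    {y | 0 < y.2.im ∧ y.2.re = y.2.im} := by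
  have h2 : (0 : ℝ) < √2 / 2 := by positivity
  have he : Complex.exp ((Real.pi / 4 : ℝ) * Complex.I) = ⟨√2 / 2, √2 / 2⟩ := by
    apply Complex.ext
    · rw [Complex.exp_ofReal_mul_I_re, Real.cos_pi_div_four]
    · rw [Complex.exp_ofReal_mul_I_im, Real.sin_pi_div_four]
  ext y
  rw [he]
  generalize √2 / 2 = c at h2
  constructor
  · rintro ⟨r, hr, h⟩
    simp only [mem_ofPred_eq, h]
    simp
    positivity
  · rintro ⟨h1, h3⟩
    refine ⟨y.2.im / c, by positivity, Complex.ext ?_ ?_⟩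
    · rw [Complex.re_ofReal_mul]; field_simp; linarith
    · rw [Complex.im_ofReal_mul]; field_simp

theorem ray_three_pi_div_four {V : Type*} : {y : V × ℂ | ∃ r : ℝ, 0 < r ∧
      y.2 = r * Complex.exp ((3 * Real.pi / 4 : ℝ) * Complex.I)} =
    {y | 0 < y.2.im ∧ y.2.re = -y.2.im} := by
  have h2 : (0 : ℝ) < √2 / 2 := by positivity
  have he : Complex.exp ((3 * Real.pi / 4 : ℝ) * Complex.I) = ⟨-(√2 / 2), √2 / 2⟩ := by
    have h3 : 3 * Real.pi / 4 = Real.pi - Real.pi / 4 := by ring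
    apply Complex.ext
    · rw [Complex.exp_ofReal_mul_I_re, h3, Real.cos_pi_sub, Real.cos_pi_div_four]
    · rw [Complex.exp_ofReal_mul_I_im, h3, Real.sin_pi_sub, Real.sin_pi_div_four]
  ext y
  rw [he]
  generalize √2 / 2 = c at h2
  constructor
  · rintro ⟨r, hr, h⟩
    simp only [mem_ofPred_eq, h]
    simp
    positivity
  · rintro ⟨h1, h3⟩
    refine ⟨y.2.im / c, by positivity, Complex.ext ?_ ?_⟩
    · rw [Complex.re_ofReal_mul]; field_simp; linarith
    · rw [Complex.im_ofReal_mul]; field_simp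

theorem ray_zero {V : Type*} :
    {y : V × ℂ | ∃ r : ℝ, 0 < r ∧ y.2 = r * Complex.exp ((0 : ℝ) * Complex.I)} =
    {y | y.2.im = 0 ∧ 0 < y.2.re} := by
  ext y
  constructor
  · rintro ⟨r, hr, h⟩
    simp only [mem_ofPred_eq, h]
    simpa
  · rintro ⟨h1, h3⟩
    exact ⟨y.2.re, h3, Complex.ext (by simp) (by simp [h1])⟩

theorem ray_pi {V : Type*} (k : ℤ) : {y : V × ℂ | ∃ r : ℝ, 0 < r ∧
      y.2 = r * Complex.exp ((Real.pi + k * (2 * Real.pi) : ℝ) * Complex.I)} =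
    {y | y.2.im = 0 ∧ y.2.re < 0} := by
  have he : Complex.exp ((Real.pi + k * (2 * Real.pi) : ℝ) * Complex.I) = -1 := by
    apply Complex.ext
    · rw [Complex.exp_ofReal_mul_I_re, Real.cos_add_int_mul_two_pi]; simp
    · rw [Complex.exp_ofReal_mul_I_im, Real.sin_add_int_mul_two_pi]; simp
  ext y
  rw [he]
  constructor
  · rintro ⟨r, hr, h⟩
    simp only [mem_ofPred_eq, h]
    simpa
  · rintro ⟨h1, h3⟩
    exact ⟨-y.2.re, by linarith, Complex.ext (by simp) (by simp [h1])⟩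

theorem exists_straighten_half {F : (V × ℂ) ≃ₜ (V × ℂ)} (hF : ∀ v, F (v, 0) = (v, 0))
    (hpos : ∀ v, ∀ r : ℝ, 0 < r → 0 < (F (v, r)).2.im) :
    ∃ G : (V × ℂ) ≃ₜ (V × ℂ), (∀ y, y.2.im ≤ 0 → G y = y) ∧
      G '' {y | 0 < y.2.im ∧ y.2.re = y.2.im} = F '' {y | y.2.im = 0 ∧ 0 < y.2.re} := by
  obtain ⟨R, F₁, f, hF₁, hf, hper, hf0, hc, hc'⟩ := exists_controlled_lift hF hpos
  obtain ⟨G, hG, hGb⟩ := R.exists_pushdown f hc hc' (β₁ := 0) (β₂ := 1) one_pos (b := {0})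
    (by simp) (by simp) (by simpa using hf0)
  refine ⟨G, hG, ?_⟩
  have h1 := hGb 0 rfl
  rw [(pi_div_two_add_arctan 0 1 one_pos).1, R.image_polar_angle, ray_pi_div_four,
    image_image, image_congr fun x _ => hf x, ← image_image F₁, R.image_polar_angle, ray_zero] at h1
  rw [h1]
  refine image_congr fun y hy => ?_
  rw [show y = (y.1, ((y.2.re : ℝ) : ℂ)) from Prod.ext rfl (Complex.ext (by simp) (by simp [hy.1]))]
  exact hF₁ _ _

theorem exists_straighten_fold {F : (V × ℂ) ≃ₜ (V × ℂ)} (hF : ∀ v, F (v, 0) = (v, 0))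
    (hpos : ∀ v, ∀ r : ℝ, 0 < r → 0 < (F (v, r)).2.im)
    (hneg : ∀ v, ∀ r : ℝ, r < 0 → 0 < (F (v, r)).2.im) :
    ∃ G : (V × ℂ) ≃ₜ (V × ℂ), (∀ y, y.2.im ≤ 0 → G y = y) ∧
      G '' {y | 0 < y.2.im ∧ |y.2.re| = y.2.im} = F '' {y | y.2.im = 0 ∧ y.2.re ≠ 0} := by
  have hpi := Real.pi_pos
  obtain ⟨R, F₁, f, hF₁, hf, hper, hf0, hc, hc'⟩ := exists_controlled_lift hF hpos
  have hsin : ∀ p, 0 < Real.sin (f (p, Real.pi)).2 := by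
    intro p
    have h1 : R.polar (p, Real.pi) = (p.1, ((-Real.exp (-(R.toHomeo.symm p).2) : ℝ) : ℂ)) := by
      refine Prod.ext rfl (Complex.ext ?_ ?_)
      · rw [R.polar_re]
        change _ = Complex.re (Complex.ofReal _)
        rw [Complex.ofReal_re]
        simp
      · rw [R.polar_im]
        change _ = Complex.im (Complex.ofReal _)
        rw [Complex.ofReal_im]
        simp
    have h2 := hneg p.1 _ (neg_lt_zero.2 (Real.exp_pos (-(R.toHomeo.symm p).2)))
    rw [← hF₁, ← h1, ← hf, R.polar_im] at h2
    exact pos_of_mul_pos_right h2 (Real.exp_pos _).le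
  obtain ⟨k, hk⟩ := RadialScale.exists_int_forall_mem_Ioo
    (g := fun p : V × ℝ => (f (p, Real.pi)).2) (by fun_prop) hsin
  set β := Real.pi + k * (2 * Real.pi) with hβ
  have hβ0 : β ≠ 0 := by
    intro h
    have : ((1 + k * 2 : ℤ) : ℝ) * Real.pi = 0 := by push_cast; linarith
    have := (mul_eq_zero.1 this).resolve_right hpi.ne'
    have : 1 + k * 2 = 0 := by exact_mod_cast this
    omega
  have hfβ : ∀ p, (f (p, β)).2 ∈ Ioo 0 Real.pi := fun p => by
    rw [apply_add_int_mul_two_pi hper]; exact hk p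
  have hb : ({0, β} : Set ℝ) ⊆ {min 0 β, max 0 β} := by
    rcases le_total 0 β with h | h
    · rw [min_eq_left h, max_eq_right h]
    · rw [min_eq_right h, max_eq_left h, pair_comm]
  obtain ⟨G, hG, hGb⟩ := R.exists_pushdown f hc hc' (β₁ := min 0 β) (β₂ := max 0 β)
    (min_lt_max.2 hβ0.symm) (b := {0, β}) hb (by simp) (by
      rintro _ (rfl | rfl)
      exacts [hf0, hfβ])
  refine ⟨G, hG, ?_⟩
  have hE : ∀ β, R.polar '' (f '' {x | x.2 = β}) = F₁ '' (R.polar '' {x | x.2 = β}) := fun β => by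
    rw [image_image, image_congr fun x _ => hf x, ← image_image F₁]
  have hFF : F₁ '' {y | y.2.im = 0 ∧ y.2.re ≠ 0} = F '' {y | y.2.im = 0 ∧ y.2.re ≠ 0} := by
    refine image_congr fun y hy => ?_
    rw [show y = (y.1, ((y.2.re : ℝ) : ℂ)) from
      Prod.ext rfl (Complex.ext (by simp) (by simp [hy.1]))]
    exact hF₁ _ _
  have hS : {y : V × ℂ | y.2.im = 0 ∧ y.2.re ≠ 0} =
      {y | y.2.im = 0 ∧ 0 < y.2.re} ∪ {y | y.2.im = 0 ∧ y.2.re < 0} := by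
    ext y
    simp only [mem_ofPred_eq, mem_union, ne_iff_lt_or_gt]
    tauto
  have hT : {y : V × ℂ | 0 < y.2.im ∧ |y.2.re| = y.2.im} =
      {y | 0 < y.2.im ∧ y.2.re = y.2.im} ∪ {y | 0 < y.2.im ∧ y.2.re = -y.2.im} := by
    ext y
    simp only [mem_ofPred_eq, mem_union]
    constructor
    · rintro ⟨h1, h2⟩
      rcases abs_eq h1.le |>.1 h2 with h | h
      · exact .inl ⟨h1, h⟩
      · exact .inr ⟨h1, h⟩
    · rintro (⟨h1, h2⟩ | ⟨h1, h2⟩)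
      · exact ⟨h1, by rw [h2, abs_of_pos h1]⟩
      · exact ⟨h1, by rw [h2, abs_neg, abs_of_pos h1]⟩
  have g0 := hGb 0 (by simp)
  have gβ := hGb β (by simp)
  rw [hE, R.image_polar_angle, R.image_polar_angle, ray_zero] at g0
  rw [hE, R.image_polar_angle, R.image_polar_angle, hβ, ray_pi, ← hβ] at gβ
  have hr := pi_div_two_add_arctan _ _ (min_lt_max.2 hβ0.symm)
  rw [← hFF, hS, image_union, ← g0, ← gβ, hT, image_union]
  rcases le_total 0 β with h | h
  · rw [min_eq_left h, max_eq_right h] at hr ⊢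
    rw [hr.1, hr.2, ray_pi_div_four, ray_three_pi_div_four]
  · rw [min_eq_right h, max_eq_left h] at hr ⊢
    rw [hr.1, hr.2, ray_pi_div_four, ray_three_pi_div_four, union_comm]

end Transverse

section Symmetries

variable {V : Type*} [TopologicalSpace V]

/-- Complex conjugation on the fibres of `V × ℂ`. -/
noncomputable def conjFiber (V : Type*) [TopologicalSpace V] : (V × ℂ) ≃ₜ (V × ℂ) :=
  (Homeomorph.refl V).prodCongr Complex.conjCLE.toHomeomorph

/-- Negation on the fibres of `V × ℂ`. -/
noncomputable def negFiber (V : Type*) [TopologicalSpace V] : (V × ℂ) ≃ₜ (V × ℂ) :=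
  (Homeomorph.refl V).prodCongr (Homeomorph.neg ℂ)

@[simp] theorem conjFiber_re (y : V × ℂ) : (conjFiber V y).2.re = y.2.re := rfl
@[simp] theorem conjFiber_im (y : V × ℂ) : (conjFiber V y).2.im = -y.2.im := rfl
@[simp] theorem conjFiber_zero (v : V) : conjFiber V (v, 0) = (v, 0) :=
  Prod.ext rfl (Complex.ext rfl (by simp))
@[simp] theorem conjFiber_conjFiber (y : V × ℂ) : conjFiber V (conjFiber V y) = y :=
  Prod.ext rfl (Complex.ext rfl (by simp))

@[simp] theorem negFiber_re (y : V × ℂ) : (negFiber V y).2.re = -y.2.re := rfl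
@[simp] theorem negFiber_im (y : V × ℂ) : (negFiber V y).2.im = -y.2.im := rfl
@[simp] theorem negFiber_zero (v : V) : negFiber V (v, 0) = (v, 0) :=
  Prod.ext rfl (by change -(0 : ℂ) = 0; simp)
@[simp] theorem negFiber_negFiber (y : V × ℂ) : negFiber V (negFiber V y) = y :=
  Prod.ext rfl (neg_neg y.2)

theorem negFiber_mk (v : V) (r : ℝ) : negFiber V (v, r) = (v, ((-r : ℝ) : ℂ)) :=
  Prod.ext rfl (by change -(r : ℂ) = _; simp)

/-- A bijection which is the identity where `w ≤ 0` preserves the sign of `w`. -/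
theorem pos_apply_iff_of_fixes {X : Type*} {w : X → ℝ} (G : X ≃ X)
    (hG : ∀ y, w y ≤ 0 → G y = y) (y : X) : 0 < w (G y) ↔ 0 < w y := by
  constructor
  · intro h
    by_contra! h1
    rw [hG y h1] at h
    linarith
  · intro h
    by_contra! h1
    have h2 := G.injective (hG _ h1)
    rw [h2] at h1
    linarith

end Symmetries

section Straighten

variable {V : Type*} [NormedAddCommGroup V] [NormedSpace ℝ V]

theorem exists_straighten_transverse {F : (V × ℂ) ≃ₜ (V × ℂ)} (hF : ∀ v, F (v, 0) = (v, 0))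
    (hpos : ∀ v, ∀ r : ℝ, 0 < r → 0 < (F (v, r)).2.im)
    (hneg : ∀ v, ∀ r : ℝ, r < 0 → (F (v, r)).2.im < 0) :
    ∃ G : (V × ℂ) ≃ₜ (V × ℂ), (∀ y, (G y).2.im = 0 ↔ y.2.im = 0) ∧
      G '' {y | y.2.re = |y.2.im|} = F '' {y | y.2.im = 0} := by
  obtain ⟨G, hG, hGr⟩ := exists_straighten_half hF hpos
  obtain ⟨L, hL, hLr⟩ := exists_straighten_half
    (F := (negFiber V).trans (F.trans (conjFiber V))) (by simp [hF]) (by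
      intro v r hr
      simpa [negFiber_mk] using hneg v (-r) (by linarith))
  set L' := (conjFiber V).trans (L.trans (conjFiber V)) with hL'
  have hL'0 : ∀ y, 0 ≤ y.2.im → L' y = y := fun y hy => by
    simp [hL', hL (conjFiber V y) (by simpa using hy)]
  have sG : ∀ y, 0 < (G y).2.im ↔ 0 < y.2.im :=
    pos_apply_iff_of_fixes (w := fun y : V × ℂ => y.2.im) G.toEquiv hG
  have sL : ∀ y, (L' y).2.im < 0 ↔ y.2.im < 0 := fun y => by
    simpa using pos_apply_iff_of_fixes (w := fun y : V × ℂ => -y.2.im) L'.toEquiv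
      (fun y hy => hL'0 y (by linarith)) y
  have hG' : ∀ y, y.2.im < 0 → G (L' y) = L' y := fun y hy => hG _ ((sL y).2 hy).le
  have hUp : ∀ y, 0 ≤ y.2.im → G (L' y) = G y := fun y hy => by rw [hL'0 y hy]
  refine ⟨L'.trans G, fun y => ?_, ?_⟩
  · simp only [Homeomorph.trans_apply]
    rcases lt_trichotomy y.2.im 0 with h | h | h
    · rw [hG' y h]
      have := (sL y).2 h
      constructor <;> intro <;> linarith
    · rw [hUp y h.ge, hG y h.le]
    · rw [hUp y h.le]
      have := (sG y).2 h
      constructor <;> intro <;> linarith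
  · have e1 : {y : V × ℂ | y.2.re = |y.2.im|} = {y | 0 < y.2.im ∧ y.2.re = y.2.im} ∪
        ({y | y.2 = 0} ∪ conjFiber V '' {y | 0 < y.2.im ∧ y.2.re = y.2.im}) := by
      ext y
      simp only [mem_ofPred_eq, mem_union, mem_image]
      constructor
      · intro h
        rcases lt_trichotomy y.2.im 0 with h1 | h1 | h1
        · refine .inr (.inr ⟨conjFiber V y, ?_, conjFiber_conjFiber y⟩)
          rw [abs_of_neg h1] at h
          exact ⟨by simpa using h1, by simpa using h⟩
        · exact .inr (.inl (Complex.ext (by simpa [h1] using h) h1))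
        · exact .inl ⟨h1, by rwa [abs_of_pos h1] at h⟩
      · rintro (⟨h1, h2⟩ | h | ⟨x, ⟨h1, h2⟩, rfl⟩)
        · rw [abs_of_pos h1, h2]
        · simp [h]
        · simp [abs_of_pos h1, h2]
    have e2 : {y : V × ℂ | y.2.im = 0} = {y | y.2.im = 0 ∧ 0 < y.2.re} ∪
        ({y | y.2 = 0} ∪ negFiber V '' {y | y.2.im = 0 ∧ 0 < y.2.re}) := by
      ext y
      simp only [mem_ofPred_eq, mem_union, mem_image]
      constructor
      · intro h
        rcases lt_trichotomy y.2.re 0 with h1 | h1 | h1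
        · exact .inr (.inr ⟨negFiber V y, ⟨by simpa using h, by simpa using h1⟩,
            negFiber_negFiber y⟩)
        · exact .inr (.inl (Complex.ext h1 h))
        · exact .inl ⟨h, h1⟩
      · rintro (⟨h1, h2⟩ | h | ⟨x, ⟨h1, h2⟩, rfl⟩)
        · exact h1
        · simp [h]
        · simpa using h1
    rw [e1, e2, image_union, image_union, image_union, image_union]
    congr 1
    · rw [← hGr]
      exact image_congr fun y hy => hUp y hy.1.le
    · congr 1
      · refine image_congr fun y (hy : y.2 = 0) => ?_
        simp only [Homeomorph.trans_apply]
        rw [hUp y (by simp [hy]), hG y (by simp [hy]), show y = (y.1, 0) from Prod.ext rfl hy, hF]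
      · have h1 : (L'.trans G) '' (conjFiber V '' {y | 0 < y.2.im ∧ y.2.re = y.2.im}) =
            conjFiber V '' (L '' {y | 0 < y.2.im ∧ y.2.re = y.2.im}) := by
          rw [image_image, image_image]
          refine image_congr fun y hy => ?_
          simp only [Homeomorph.trans_apply]
          rw [hG' _ (by simpa using hy.1)]
          simp [hL']
        rw [h1, hLr, image_image, image_image]
        exact image_congr fun y _ => by simp

theorem exists_straighten_touching {F : (V × ℂ) ≃ₜ (V × ℂ)} (hF : ∀ v, F (v, 0) = (v, 0))
    (hpos : ∀ v, ∀ r : ℝ, 0 < r → 0 < (F (v, r)).2.im)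
    (hneg : ∀ v, ∀ r : ℝ, r < 0 → 0 < (F (v, r)).2.im) :
    ∃ G : (V × ℂ) ≃ₜ (V × ℂ), (∀ y, (G y).2.im = 0 ↔ y.2.im = 0) ∧
      G '' {y | y.2.im = |y.2.re|} = F '' {y | y.2.im = 0} := by
  obtain ⟨G, hG, hGr⟩ := exists_straighten_fold hF hpos hneg
  have sG : ∀ y, 0 < (G y).2.im ↔ 0 < y.2.im :=
    pos_apply_iff_of_fixes (w := fun y : V × ℂ => y.2.im) G.toEquiv hG
  refine ⟨G, fun y => ?_, ?_⟩
  · rcases le_or_gt y.2.im 0 with h | h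
    · rw [hG y h]
    · have := (sG y).2 h
      constructor <;> intro <;> linarith
  · have e1 : {y : V × ℂ | y.2.im = |y.2.re|} =
        {y | 0 < y.2.im ∧ |y.2.re| = y.2.im} ∪ {y | y.2 = 0} := by
      ext y
      simp only [mem_ofPred_eq, mem_union]
      constructor
      · intro h
        rcases (abs_nonneg y.2.re).eq_or_lt with h1 | h1
        · exact .inr (Complex.ext (abs_eq_zero.1 h1.symm) (by rw [h, ← h1]; rfl))
        · exact .inl ⟨h ▸ h1, h.symm⟩
      · rintro (⟨-, h⟩ | h)
        · exact h.symm
        · simp [h]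
    have e2 : {y : V × ℂ | y.2.im = 0} = {y | y.2.im = 0 ∧ y.2.re ≠ 0} ∪ {y | y.2 = 0} := by
      ext y
      simp only [mem_ofPred_eq, mem_union]
      constructor
      · intro h
        by_cases h1 : y.2.re = 0
        · exact .inr (Complex.ext h1 h)
        · exact .inl ⟨h, h1⟩
      · rintro (⟨h, -⟩ | h)
        · exact h
        · simp [h]
    rw [e1, e2, image_union, image_union, hGr]
    congr 1
    refine image_congr fun y (hy : y.2 = 0) => ?_
    rw [hG y (by simp [hy]), show y = (y.1, 0) from Prod.ext rfl hy, hF]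

/-- A preconnected space on which a continuous real function has no zero lies on one side. -/
theorem forall_pos_or_forall_neg {X : Type*} [TopologicalSpace X] {s : Set X}
    (hs : IsPreconnected s) {w : X → ℝ} (hw : ContinuousOn w s) (h0 : ∀ x ∈ s, w x ≠ 0) :
    (∀ x ∈ s, 0 < w x) ∨ ∀ x ∈ s, w x < 0 := by
  by_contra! h
  obtain ⟨⟨a, ha, ha'⟩, b, hb, hb'⟩ := h
  obtain ⟨c, hc, hc'⟩ := hs.intermediate_value ha hb hw ⟨ha', hb'⟩
  exact h0 c hc hc'

theorem exists_straighten {F : (V × ℂ) ≃ₜ (V × ℂ)} (hF : ∀ v, F (v, 0) = (v, 0))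
    (hW : ∀ y, y.2.im = 0 → (F y).2.im = 0 → y.2 = 0) :
    ∃ G : (V × ℂ) ≃ₜ (V × ℂ), (∀ y, (G y).2.im = 0 ↔ y.2.im = 0) ∧
      (G '' {y | y.2.re = |y.2.im|} = F '' {y | y.2.im = 0} ∨
        G '' {y | y.2.im = |y.2.re|} = F '' {y | y.2.im = 0}) := by
  have hc : Continuous fun x : V × ℝ => (F (x.1, x.2)).2.im := by
    have : Continuous fun x : V × ℝ => (x.1, (x.2 : ℂ)) := by fun_prop
    exact Complex.continuous_im.comp (continuous_snd.comp (F.continuous.comp this))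
  have h0 : ∀ x : V × ℝ, x.2 ≠ 0 → (F (x.1, x.2)).2.im ≠ 0 := fun x hx h => hx (by
    simpa using hW (x.1, x.2) (by simp) h)
  have hp : IsPreconnected {x : V × ℝ | 0 < x.2} :=
    ((convex_Ioi (0 : ℝ)).linear_preimage (LinearMap.snd ℝ V ℝ)).isPreconnected
  have hn : IsPreconnected {x : V × ℝ | x.2 < 0} :=
    ((convex_Iio (0 : ℝ)).linear_preimage (LinearMap.snd ℝ V ℝ)).isPreconnected
  have hneg : F '' {y | y.2.im = 0} = (negFiber V).trans F '' {y | y.2.im = 0} := by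
    rw [show ((negFiber V).trans F : V × ℂ → V × ℂ) = F ∘ negFiber V from rfl, image_comp]
    congr 1
    ext y
    constructor
    · intro h
      exact ⟨negFiber V y, by simpa using h, by simp⟩
    · rintro ⟨x, hx, rfl⟩
      simpa using hx
  have hconj : F '' {y | y.2.im = 0} =
      conjFiber V '' (F.trans (conjFiber V) '' {y | y.2.im = 0}) := by
    rw [image_image]
    simp
  rcases forall_pos_or_forall_neg hp hc.continuousOn fun x hx => h0 x (ne_of_gt hx) with h1 | h1 <;>
  rcases forall_pos_or_forall_neg hn hc.continuousOn fun x hx => h0 x (ne_of_lt hx) with h2 | h2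
  · obtain ⟨G, hG, h⟩ := exists_straighten_touching hF (fun v r hr => h1 (v, r) hr)
      (fun v r hr => h2 (v, r) hr)
    exact ⟨G, hG, .inr h⟩
  · obtain ⟨G, hG, h⟩ := exists_straighten_transverse hF (fun v r hr => h1 (v, r) hr)
      (fun v r hr => h2 (v, r) hr)
    exact ⟨G, hG, .inl h⟩
  · obtain ⟨G, hG, h⟩ := exists_straighten_transverse (F := (negFiber V).trans F) (by simp [hF])
      (fun v r hr => by simpa [negFiber_mk] using h2 (v, -r) (by simpa using hr))
      (fun v r hr => by simpa [negFiber_mk] using h1 (v, -r) (by simpa using hr))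
    exact ⟨G, hG, .inl (by rw [h, hneg])⟩
  · obtain ⟨G, hG, h⟩ := exists_straighten_touching (F := F.trans (conjFiber V)) (by simp [hF])
      (fun v r hr => by simpa using h1 (v, r) hr) (fun v r hr => by simpa using h2 (v, r) hr)
    refine ⟨G.trans (conjFiber V), by simpa using hG, .inr ?_⟩
    rw [hconj, ← h, image_image]
    rfl

end Straighten

/-- `Y` is homeomorphic to `A × ℝ` in such a way that `Z ∩ Y` corresponds to `A × {0}`. -/
def FlatIn {X : Type*} [TopologicalSpace X] (A : Type*) [TopologicalSpace A] (Y Z : Set X) : Prop :=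
  ∃ φ : Y ≃ₜ A × ℝ, ∀ y : Y, (y : X) ∈ Z ↔ (φ y).2 = 0

/-- The fibrewise real and imaginary parts, as a homeomorphism. -/
noncomputable def prodComplex (V : Type*) [TopologicalSpace V] : ((V × ℝ) × ℝ) ≃ₜ (V × ℂ) :=
  (Homeomorph.prodAssoc V ℝ ℝ).trans
    ((Homeomorph.refl V).prodCongr Complex.equivRealProdCLM.toHomeomorph.symm)

@[simp] theorem prodComplex_fst {V : Type*} [TopologicalSpace V] (x : (V × ℝ) × ℝ) :
    (prodComplex V x).1 = x.1.1 := rfl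

@[simp] theorem prodComplex_snd {V : Type*} [TopologicalSpace V] (x : (V × ℝ) × ℝ) :
    (prodComplex V x).2 = ⟨x.1.2, x.2⟩ := rfl

@[simp] theorem prodComplex_symm_apply {V : Type*} [TopologicalSpace V] (y : V × ℂ) :
    (prodComplex V).symm y = ((y.1, y.2.re), y.2.im) := rfl

section Charts

variable {X : Type*} [TopologicalSpace X]

theorem FlatIn.exists_extend {A A' : Type*} [TopologicalSpace A] [TopologicalSpace A']
    {Y Z : Set X} (h : FlatIn A Y Z) (ψ : ↥(Y ∩ Z) ≃ₜ A') :
    ∃ e : Y ≃ₜ A' × ℝ, (∀ y : Y, (y : X) ∈ Z ↔ (e y).2 = 0) ∧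
      ∀ (y : Y) (hy : (y : X) ∈ Z), (e y).1 = ψ ⟨y, y.2, hy⟩ := by
  obtain ⟨φ, hφ⟩ := h
  have hmem : ∀ a : A, ((φ.symm (a, 0) : Y) : X) ∈ Y ∩ Z := fun a =>
    ⟨(φ.symm (a, 0)).2, (hφ _).2 (by simp)⟩
  let τ : A ≃ₜ ↥(Y ∩ Z) :=
    { toFun := fun a => ⟨φ.symm (a, 0), hmem a⟩
      invFun := fun y => (φ ⟨y, y.2.1⟩).1
      left_inv := fun a => by simp
      right_inv := fun y => by
        have h1 : (φ ⟨y, y.2.1⟩).2 = 0 := (hφ ⟨y, y.2.1⟩).1 y.2.2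
        apply Subtype.ext
        have h2 : ((φ ⟨y, y.2.1⟩).1, (0 : ℝ)) = φ ⟨y, y.2.1⟩ := by rw [← h1]
        simp [h2]
      continuous_toFun := by fun_prop
      continuous_invFun := by fun_prop }
  refine ⟨φ.trans ((τ.trans ψ).prodCongr (Homeomorph.refl ℝ)), hφ, fun y hy => ?_⟩
  change ψ (τ (φ y).1) = _
  congr 1
  exact τ.apply_symm_apply ⟨y, y.2, hy⟩

/-- In a suitable chart, `A` and `B` are transverse hyperplanes of `Y`. -/
def CrossChart {V : Type*} [TopologicalSpace V] {Y : Set X} (A B : Set X) (e : Y ≃ₜ V × ℂ) :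
    Prop :=
  (∀ y : Y, (y : X) ∈ A ↔ (e y).2.im = 0) ∧ ∀ y : Y, (y : X) ∈ B ↔ (e y).2.re = 0

/-- In a suitable chart, `A` and `B` touch along their intersection. -/
def TouchChart {V : Type*} [TopologicalSpace V] {Y : Set X} (A B : Set X) (e : Y ≃ₜ V × ℂ) :
    Prop :=
  (∀ y : Y, (y : X) ∈ A ↔ max (e y).2.re (e y).2.im = 0) ∧
    ∀ y : Y, (y : X) ∈ B ↔ min (e y).2.re (e y).2.im = 0

theorem exists_flat_chart {A₀ V : Type*} [TopologicalSpace A₀] [TopologicalSpace V]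
    {Y A B : Set X} (hA : FlatIn A₀ Y A) (η : ↥(Y ∩ A) ≃ₜ V × ℝ)
    (hη : ∀ y : ↥(Y ∩ A), (y : X) ∈ B ↔ (η y).2 = 0) :
    ∃ e : Y ≃ₜ V × ℂ, (∀ y : Y, (y : X) ∈ A ↔ (e y).2.im = 0) ∧
      (∀ y : Y, (y : X) ∈ A → ((y : X) ∈ B ↔ (e y).2.re = 0)) ∧
      ∀ (y : Y) (hy : (y : X) ∈ A), (e y).1 = (η ⟨y, y.2, hy⟩).1 := by
  obtain ⟨e, he, he'⟩ := hA.exists_extend η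
  refine ⟨e.trans (prodComplex V), by simpa using he, fun y hy => ?_, fun y hy => ?_⟩
  · simp [he' y hy, ← hη]
  · simp [he' y hy]

/-- Shears turning the two standard positions of a topological hyperplane relative to a
hyperplane into crossing and touching charts. -/
theorem exists_cross_shear (V : Type*) [TopologicalSpace V] :
    ∃ s : (V × ℂ) ≃ₜ (V × ℂ), ∀ y, ((s y).2.im = 0 ↔ y.2.im = 0) ∧
      ((s y).2.re = 0 ↔ y.2.re = |y.2.im|) := by
  let s : ((V × ℝ) × ℝ) ≃ₜ ((V × ℝ) × ℝ) :=
    { toFun := fun x => ((x.1.1, x.1.2 - |x.2|), x.2)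
      invFun := fun x => ((x.1.1, x.1.2 + |x.2|), x.2)
      left_inv := fun x => by simp
      right_inv := fun x => by simp
      continuous_toFun := by fun_prop
      continuous_invFun := by fun_prop }
  refine ⟨(prodComplex V).symm.trans (s.trans (prodComplex V)), fun y => ⟨?_, ?_⟩⟩
  · simp [s]
  · simp [s, sub_eq_zero]

theorem exists_touch_shear (V : Type*) [TopologicalSpace V] :
    ∃ s : (V × ℂ) ≃ₜ (V × ℂ), ∀ y, (max (s y).2.re (s y).2.im = 0 ↔ y.2.im = 0) ∧
      (min (s y).2.re (s y).2.im = 0 ↔ y.2.im = |y.2.re|) := by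
  let s : ((V × ℝ) × ℝ) ≃ₜ ((V × ℝ) × ℝ) :=
    { toFun := fun x => ((x.1.1, x.2 - max x.1.2 0), x.2 - max (-x.1.2) 0)
      invFun := fun x => ((x.1.1, x.2 - x.1.2), max x.1.2 x.2)
      left_inv := fun x => by
        rcases le_total x.1.2 0 with h | h
        · refine Prod.ext (Prod.ext rfl ?_) ?_ <;> simp [h]
        · refine Prod.ext (Prod.ext rfl ?_) ?_ <;> simp [h]
      right_inv := fun x => by
        rcases le_total x.1.2 x.2 with h | h
        · refine Prod.ext (Prod.ext rfl ?_) ?_ <;> simp [h]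
        · refine Prod.ext (Prod.ext rfl ?_) ?_ <;> simp [h]
      continuous_toFun := by fun_prop
      continuous_invFun := by fun_prop }
  refine ⟨(prodComplex V).symm.trans (s.trans (prodComplex V)), fun y => ?_⟩
  simp only [s, Homeomorph.trans_apply, prodComplex_symm_apply, prodComplex_snd,
    Homeomorph.homeomorph_mk_coe, Equiv.coe_fn_mk]
  rcases le_total y.2.re 0 with h | h
  · simp [h, abs_of_nonpos h, add_eq_zero_iff_eq_neg]
  · simp [h, abs_of_nonneg h, sub_eq_zero]

theorem exists_cross_or_touch_chart {V V' A₀ B₀ : Type*} [NormedAddCommGroup V] [NormedSpace ℝ V]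
    [TopologicalSpace V'] [TopologicalSpace A₀] [TopologicalSpace B₀] {Y A B : Set X}
    (hA : FlatIn A₀ Y A) (hAB : FlatIn V (Y ∩ A) B)
    (hB : FlatIn B₀ Y B) (hBA : FlatIn V' (Y ∩ B) A) :
    ∃ e : Y ≃ₜ V × ℂ, CrossChart A B e ∨ TouchChart A B e := by
  obtain ⟨η, hη⟩ := hAB
  have hmem : ∀ v : V, ((η.symm (v, 0) : ↥(Y ∩ A)) : X) ∈ Y ∩ B ∩ A := fun v =>
    ⟨⟨(η.symm (v, 0)).2.1, (hη _).2 (by simp)⟩, (η.symm (v, 0)).2.2⟩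
  let τ : ↥(Y ∩ B ∩ A) ≃ₜ V :=
    { toFun := fun y => (η ⟨y, y.2.1.1, y.2.2⟩).1
      invFun := fun v => ⟨η.symm (v, 0), hmem v⟩
      left_inv := fun y => by
        have h1 : (η ⟨y, y.2.1.1, y.2.2⟩).2 = 0 := (hη ⟨y, y.2.1.1, y.2.2⟩).1 y.2.1.2
        apply Subtype.ext
        have h2 : ((η ⟨y, y.2.1.1, y.2.2⟩).1, (0 : ℝ)) = η ⟨y, y.2.1.1, y.2.2⟩ := by rw [← h1]
        simp [h2]
      right_inv := fun a => by
        change (η (η.symm (a, 0))).1 = a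
        simp
      continuous_toFun := by fun_prop
      continuous_invFun := by fun_prop }
  obtain ⟨ζ, hζ, hζ'⟩ := hBA.exists_extend τ
  obtain ⟨e₁, h₁, h₁B, h₁f⟩ := exists_flat_chart hA η hη
  obtain ⟨e₂, h₂, h₂A, h₂f⟩ := exists_flat_chart hB ζ hζ
  have hagree : ∀ y : Y, (y : X) ∈ A → (y : X) ∈ B → e₁ y = e₂ y := by
    intro y hyA hyB
    refine Prod.ext ?_ (Complex.ext ?_ ?_)
    · rw [h₁f y hyA, h₂f y hyB, hζ' ⟨y, y.2, hyB⟩ hyA]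
      rfl
    · rw [(h₁B y hyA).1 hyB, (h₂A y hyB).1 hyA]
    · rw [(h₁ y).1 hyA, (h₂ y).1 hyB]
  have hF : ∀ v, e₂.symm.trans e₁ (v, 0) = (v, 0) := by
    intro v
    have hyB : (e₂.symm (v, 0) : X) ∈ B := (h₂ _).2 (by simp)
    have hyA : (e₂.symm (v, 0) : X) ∈ A := (h₂A _ hyB).2 (by simp)
    simp [hagree _ hyA hyB]
  obtain ⟨G, hG, hGB⟩ := exists_straighten hF (fun y hy hy' => by
    have hyB : (e₂.symm y : X) ∈ B := (h₂ _).2 (by simpa using hy)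
    have hyA : (e₂.symm y : X) ∈ A := (h₁ _).2 hy'
    exact Complex.ext (by simpa using (h₂A _ hyB).1 hyA) hy)
  have hA' : ∀ y : Y, (y : X) ∈ A ↔ (G.symm (e₁ y)).2.im = 0 := fun y => by
    rw [h₁, ← hG (G.symm (e₁ y)), G.apply_symm_apply]
  have hB' : ∀ {S : Set (V × ℂ)}, G '' S = e₂.symm.trans e₁ '' {y | y.2.im = 0} →
      ∀ y : Y, (y : X) ∈ B ↔ G.symm (e₁ y) ∈ S := by
    intro S hS y
    have h3 : G.symm (e₁ y) ∈ S ↔ e₁ y ∈ G '' S := by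
      constructor
      · exact fun h => ⟨_, h, G.apply_symm_apply _⟩
      · rintro ⟨x, hx, h⟩
        rwa [← h, G.symm_apply_apply]
    rw [h3, hS, h₂]
    constructor
    · exact fun h => ⟨e₂ y, h, by simp⟩
    · rintro ⟨x, hx, h⟩
      have : x = e₂ y := by
        rw [← e₁.injective h]
        exact (e₂.apply_symm_apply x).symm
      rwa [← this]
  rcases hGB with h | h
  · obtain ⟨s, hs⟩ := exists_cross_shear V
    exact ⟨e₁.trans (G.symm.trans s), .inl ⟨fun y => (hA' y).trans (hs _).1.symm,
      fun y => (hB' h y).trans (hs _).2.symm⟩⟩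
  · obtain ⟨s, hs⟩ := exists_touch_shear V
    exact ⟨e₁.trans (G.symm.trans s), .inr ⟨fun y => (hA' y).trans (hs _).1.symm,
      fun y => (hB' h y).trans (hs _).2.symm⟩⟩

end Charts

section Rays

variable (V : Type*)

/-- The half axis `{im = 0, s * re > 0}` of `V × ℂ`. -/
def realRay (s : ℝ) : Set (V × ℂ) := {y | y.2.im = 0 ∧ 0 < s * y.2.re}

/-- The half axis `{re = 0, s * im > 0}` of `V × ℂ`. -/
def imagRay (s : ℝ) : Set (V × ℂ) := {y | y.2.re = 0 ∧ 0 < s * y.2.im}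

/-- A closed quadrant of `V × ℂ` with the zero section removed. -/
def quadrant (s t : ℝ) : Set (V × ℂ) :=
  {y | 0 ≤ s * y.2.re ∧ 0 ≤ t * y.2.im ∧ 0 < s * y.2.re + t * y.2.im}

variable {V} [NormedAddCommGroup V] [NormedSpace ℝ V]

theorem convex_setOf_combo_pos (s t : ℝ) :
    Convex ℝ {y : V × ℂ | 0 < s * y.2.re + t * y.2.im} :=
  (convex_Ioi (0 : ℝ)).linear_preimage
    ((s • Complex.reLm + t • Complex.imLm).comp (LinearMap.snd ℝ V ℂ))

theorem convex_setOf_combo_nonneg (s t : ℝ) :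
    Convex ℝ {y : V × ℂ | 0 ≤ s * y.2.re + t * y.2.im} :=
  (convex_Ici (0 : ℝ)).linear_preimage
    ((s • Complex.reLm + t • Complex.imLm).comp (LinearMap.snd ℝ V ℂ))

theorem convex_setOf_combo_eq_zero (s t : ℝ) :
    Convex ℝ {y : V × ℂ | s * y.2.re + t * y.2.im = 0} :=
  (convex_singleton (0 : ℝ)).linear_preimage
    ((s • Complex.reLm + t • Complex.imLm).comp (LinearMap.snd ℝ V ℂ))

theorem convex_realRay (s : ℝ) : Convex ℝ (realRay V s) := by
  convert (convex_setOf_combo_eq_zero (V := V) 0 1).inter (convex_setOf_combo_pos s 0) using 1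
  ext y
  simp [realRay]

theorem convex_imagRay (s : ℝ) : Convex ℝ (imagRay V s) := by
  convert (convex_setOf_combo_eq_zero (V := V) 1 0).inter (convex_setOf_combo_pos 0 s) using 1
  ext y
  simp [imagRay]

theorem convex_quadrant (s t : ℝ) : Convex ℝ (quadrant V s t) := by
  convert (convex_setOf_combo_nonneg (V := V) s 0).inter
    ((convex_setOf_combo_nonneg 0 t).inter (convex_setOf_combo_pos s t)) using 1
  ext y
  simp [quadrant]

end Rays

/-- `u` vanishes on `s` and `v` has no zero there. -/
def OnlyZero {T : Type*} (u v : T → ℝ) (s : Set T) : Prop := ∀ x ∈ s, u x = 0 ∧ v x ≠ 0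

/-- `A` and `B` are the zero sets of the maximum and of the minimum of `u` and `v`. -/
structure IsFold {T : Type*} [TopologicalSpace T] (A B : Set T) (u v : T → ℝ) : Prop where
  cont_left : Continuous u
  cont_right : Continuous v
  mem_max : ∀ x, x ∈ A ↔ max (u x) (v x) = 0
  mem_min : ∀ x, x ∈ B ↔ min (u x) (v x) = 0

namespace IsFold

variable {T : Type*} [TopologicalSpace T] {A B : Set T} {u v : T → ℝ}

theorem swap (h : IsFold A B u v) : IsFold A B v u :=
  ⟨h.cont_right, h.cont_left, fun x => by rw [max_comm]; exact h.mem_max x,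
    fun x => by rw [min_comm]; exact h.mem_min x⟩

theorem neg (h : IsFold A B u v) : IsFold B A (fun x => -u x) (fun x => -v x) :=
  ⟨h.cont_left.neg, h.cont_right.neg,
    fun x => by rw [max_neg_neg, neg_eq_zero]; exact h.mem_min x,
    fun x => by rw [min_neg_neg, neg_eq_zero]; exact h.mem_max x⟩

theorem mem_and_iff (h : IsFold A B u v) (x : T) : x ∈ A ∧ x ∈ B ↔ u x = 0 ∧ v x = 0 := by
  rw [h.mem_max, h.mem_min]
  constructor
  · rintro ⟨h1, h2⟩
    have := le_max_left (u x) (v x)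
    have := le_max_right (u x) (v x)
    have := min_le_left (u x) (v x)
    have := min_le_right (u x) (v x)
    constructor <;> linarith
  · rintro ⟨h1, h2⟩
    simp [h1, h2]

theorem mem_or_iff (h : IsFold A B u v) (x : T) : x ∈ A ∨ x ∈ B ↔ u x = 0 ∨ v x = 0 := by
  rw [h.mem_max, h.mem_min]
  rcases le_total (u x) (v x) with h1 | h1
  · rw [max_eq_right h1, min_eq_left h1, or_comm]
  · rw [max_eq_left h1, min_eq_right h1]

theorem neg_of_mem_max (h : IsFold A B u v) {x : T} (hx : x ∈ A) (hu : u x ≠ 0) :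
    u x < 0 := by
  have h1 := (h.mem_max x).1 hx
  exact lt_of_le_of_ne (h1 ▸ le_max_left _ _) hu

theorem pos_of_mem_min (h : IsFold A B u v) {x : T} (hx : x ∈ B) (hu : u x ≠ 0) :
    0 < u x := by
  have h1 := (h.mem_min x).1 hx
  exact lt_of_le_of_ne (h1 ▸ min_le_left _ _) hu.symm

theorem onlyZero_or (h : IsFold A B u v) {s : Set T} (hs : IsPreconnected s)
    (h1 : ∀ x ∈ s, x ∈ A ∨ x ∈ B) (h2 : ∀ x ∈ s, ¬(x ∈ A ∧ x ∈ B)) :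
    OnlyZero u v s ∨ OnlyZero v u s := by
  have hu := h.cont_left
  have hv := h.cont_right
  have key : ∀ x ∈ s, (u x = 0 ∧ v x ≠ 0) ∨ (v x = 0 ∧ u x ≠ 0) := fun x hx => by
    have := (h.mem_or_iff x).1 (h1 x hx)
    have := (h.mem_and_iff x).not.1 (h2 x hx)
    tauto
  rcases forall_pos_or_forall_neg hs (w := fun x => |u x| - |v x|)
    (Continuous.continuousOn (by fun_prop)) (fun x hx => by
      rcases key x hx with ⟨h3, h4⟩ | ⟨h3, h4⟩ <;> simp [h3, h4]) with h3 | h3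
  · refine .inr fun x hx => (key x hx).resolve_left fun h4 => ?_
    have := h3 x hx
    rw [h4.1, abs_zero] at this
    linarith [abs_nonneg (v x)]
  · refine .inl fun x hx => (key x hx).resolve_right fun h4 => ?_
    have := h3 x hx
    rw [h4.1, abs_zero] at this
    linarith [abs_nonneg (u x)]

theorem not_onlyZero_both (h : IsFold A B u v) {K A' B' : Set T} (hK : IsPreconnected K)
    (hAK : A' ⊆ K) (hBK : B' ⊆ K) (hAne : A'.Nonempty) (hBne : B'.Nonempty)
    (hA : A' ⊆ A) (hB : B' ⊆ B) (hcov : ∀ x ∈ K, x ∈ A ∨ x ∈ B → x ∈ A' ∨ x ∈ B') :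
    ¬(OnlyZero v u A' ∧ OnlyZero v u B') := by
  rintro ⟨h1, h2⟩
  obtain ⟨p, hp⟩ := hAne
  obtain ⟨q, hq⟩ := hBne
  obtain ⟨r, hr, hr0⟩ := hK.intermediate_value (hAK hp) (hBK hq) h.cont_left.continuousOn
    (show (0 : ℝ) ∈ Icc (u p) (u q) from
      ⟨(h.neg_of_mem_max (hA hp) (h1 p hp).2).le,
        (h.pos_of_mem_min (hB hq) (h2 q hq).2).le⟩)
  rcases hcov r hr ((h.mem_or_iff r).2 (.inl hr0)) with h3 | h3
  · exact (h1 r h3).2 hr0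
  · exact (h2 r h3).2 hr0

theorem onlyZero_opposite (h : IsFold A B u v) {K A' B' : Set T} (hK : IsPreconnected K)
    (hA'c : IsPreconnected A') (hB'c : IsPreconnected B')
    (hAK : A' ⊆ K) (hBK : B' ⊆ K) (hAne : A'.Nonempty) (hBne : B'.Nonempty)
    (hA : ∀ x ∈ A', x ∈ A ∧ x ∉ B) (hB : ∀ x ∈ B', x ∈ B ∧ x ∉ A)
    (hcov : ∀ x ∈ K, x ∈ A ∨ x ∈ B → x ∈ A' ∨ x ∈ B') :
    (OnlyZero u v A' ∧ OnlyZero v u B') ∨ (OnlyZero v u A' ∧ OnlyZero u v B') := by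
  have n1 := h.not_onlyZero_both hK hAK hBK hAne hBne (fun x hx => (hA x hx).1)
    (fun x hx => (hB x hx).1) hcov
  have n2 := h.swap.not_onlyZero_both hK hAK hBK hAne hBne (fun x hx => (hA x hx).1)
    (fun x hx => (hB x hx).1) hcov
  have h1 := h.onlyZero_or hA'c (fun x hx => .inl (hA x hx).1) (fun x hx h => (hA x hx).2 h.2)
  have h2 := h.onlyZero_or hB'c (fun x hx => .inr (hB x hx).1) (fun x hx h => (hB x hx).2 h.1)
  tauto

/-- On `Y`, the zero sets of `u` and `v` are `A` and `B`. -/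
def Aligned (A B : Set T) (u v : T → ℝ) (Y : Set T) : Prop :=
  ∀ x ∈ Y, (x ∈ A ↔ u x = 0) ∧ (x ∈ B ↔ v x = 0)

/-- In a chart of `Y`, `A` and `B` touch along their intersection and the zero sets of `u` and
`v` are the coordinate hyperplanes. -/
def Hybrid {V : Type*} [TopologicalSpace V] (A B : Set T) (u v : T → ℝ) {Y : Set T}
    (e : Y ≃ₜ V × ℂ) : Prop :=
  TouchChart A B e ∧ (∀ y : Y, u y = 0 ↔ (e y).2.re = 0) ∧ ∀ y : Y, v y = 0 ↔ (e y).2.im = 0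

theorem aligned_of_onlyZero (h : IsFold A B u v) {Y : Set T}
    (h1 : OnlyZero u v ((Y ∩ A) \ B)) (h2 : OnlyZero v u ((Y ∩ B) \ A)) :
    Aligned A B u v Y := by
  intro x hx
  have h3 := h.mem_and_iff x
  have h4 := h.mem_or_iff x
  have h5 := h1 x
  have h6 := h2 x
  simp only [Set.mem_sdiff, mem_inter_iff] at h5 h6
  tauto

/-- The fibrewise exchange of real and imaginary parts. -/
noncomputable def swapFiber (V : Type*) [TopologicalSpace V] : (V × ℂ) ≃ₜ (V × ℂ) :=
  (prodComplex V).symm.trans (((Homeomorph.prodAssoc V ℝ ℝ).trans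
    (((Homeomorph.refl V).prodCongr (Homeomorph.prodComm ℝ ℝ)).trans
      (Homeomorph.prodAssoc V ℝ ℝ).symm)).trans (prodComplex V))

theorem swapFiber_re {V : Type*} [TopologicalSpace V] (y : V × ℂ) :
    (swapFiber V y).2.re = y.2.im := rfl

theorem swapFiber_im {V : Type*} [TopologicalSpace V] (y : V × ℂ) :
    (swapFiber V y).2.im = y.2.re := rfl

theorem trichotomy {V : Type*} [NormedAddCommGroup V] [NormedSpace ℝ V] (h : IsFold A B u v)
    {Y : Set T} (hY : IsPreconnected Y) (hYA : IsPreconnected (Y ∩ A))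
    (hYB : IsPreconnected (Y ∩ B))
    (hW : (Y ∩ A ∩ B).Nonempty → ∃ e : Y ≃ₜ V × ℂ, CrossChart A B e ∨ TouchChart A B e) :
    Aligned A B u v Y ∨ Aligned A B v u Y ∨ ∃ e : Y ≃ₜ V × ℂ, Hybrid A B u v e := by
  rcases (Y ∩ A ∩ B).eq_empty_or_nonempty with hemp | hne
  · have hA : (Y ∩ A) \ B = Y ∩ A := by
      rw [sdiff_eq_self_iff_disjoint, disjoint_comm, disjoint_iff_inter_eq_empty, hemp]
    have hB : (Y ∩ B) \ A = Y ∩ B := by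
      rw [sdiff_eq_self_iff_disjoint, disjoint_comm, disjoint_iff_inter_eq_empty,
        inter_right_comm, hemp]
    have hA' : ∀ x ∈ Y ∩ A, x ∈ A ∧ x ∉ B := fun x hx => by
      rw [← hA] at hx; exact ⟨hx.1.2, hx.2⟩
    have hB' : ∀ x ∈ Y ∩ B, x ∈ B ∧ x ∉ A := fun x hx => by
      rw [← hB] at hx; exact ⟨hx.1.2, hx.2⟩
    have key : (OnlyZero u v (Y ∩ A) ∧ OnlyZero v u (Y ∩ B)) ∨
        (OnlyZero v u (Y ∩ A) ∧ OnlyZero u v (Y ∩ B)) := by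
      rcases (Y ∩ A).eq_empty_or_nonempty with hAe | hAne
      · rcases h.onlyZero_or hYB (fun x hx => .inr (hB' x hx).1)
          (fun x hx h => (hB' x hx).2 h.1) with h1 | h1
        · exact .inr ⟨by simp [hAe, OnlyZero], h1⟩
        · exact .inl ⟨by simp [hAe, OnlyZero], h1⟩
      rcases (Y ∩ B).eq_empty_or_nonempty with hBe | hBne
      · rcases h.onlyZero_or hYA (fun x hx => .inl (hA' x hx).1)
          (fun x hx h => (hA' x hx).2 h.2) with h1 | h1
        · exact .inl ⟨h1, by simp [hBe, OnlyZero]⟩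
        · exact .inr ⟨h1, by simp [hBe, OnlyZero]⟩
      exact h.onlyZero_opposite hY hYA hYB inter_subset_left inter_subset_left hAne hBne hA' hB'
        fun x hx => Or.imp (⟨hx, ·⟩) (⟨hx, ·⟩)
    rcases key with ⟨h1, h2⟩ | ⟨h1, h2⟩
    · exact .inl (h.aligned_of_onlyZero (by rwa [hA]) (by rwa [hB]))
    · exact .inr (.inl (h.swap.aligned_of_onlyZero (by rwa [hA]) (by rwa [hB])))
  · obtain ⟨e, he⟩ := hW hne
    set p : V × ℂ → T := fun y => (e.symm y : T) with hp
    have hpc : Continuous p := continuous_subtype_val.comp e.symm.continuous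
    have hpre : ∀ {s : Set (V × ℂ)}, Convex ℝ s → IsPreconnected (p '' s) := fun hs =>
      hs.isPreconnected.image p hpc.continuousOn
    have hpe : ∀ x (hx : x ∈ Y), p (e ⟨x, hx⟩) = x := fun x hx => by simp [hp]
    have hone : (1 : ℝ) * 1 = 1 := one_mul 1
    have rne : ∀ s : ℝ, s * s = 1 → (p '' realRay V s).Nonempty := fun s hs =>
      ⟨_, (0, (s : ℂ)), ⟨by simp, by simp [hs]⟩, rfl⟩
    have ine : ∀ s : ℝ, s * s = 1 → (p '' imagRay V s).Nonempty := fun s hs =>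
      ⟨_, (0, s * Complex.I), ⟨by simp, by simp [hs]⟩, rfl⟩
    have rq : ∀ s t : ℝ, p '' realRay V s ⊆ p '' quadrant V s t := fun s t =>
      image_mono fun y hy => ⟨hy.2.le, by simp [hy.1], by simpa [hy.1] using hy.2⟩
    have iq : ∀ s t : ℝ, p '' imagRay V t ⊆ p '' quadrant V s t := fun s t =>
      image_mono fun y hy => ⟨by simp [hy.1], hy.2.le, by simpa [hy.1] using hy.2⟩
    have qcov : ∀ s t : ℝ, ∀ y ∈ quadrant V s t, y.2.re = 0 ∨ y.2.im = 0 →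
        y ∈ realRay V s ∨ y ∈ imagRay V t := by
      rintro s t y ⟨h1, h2, h3⟩ (h4 | h4)
      · exact .inr ⟨h4, by simpa [h4] using h3⟩
      · exact .inl ⟨h4, by simpa [h4] using h3⟩
    rcases he with he | he
    · have hA : ∀ y, p y ∈ A ↔ y.2.im = 0 := fun y => by simpa using he.1 (e.symm y)
      have hB : ∀ y, p y ∈ B ↔ y.2.re = 0 := fun y => by simpa using he.2 (e.symm y)
      have adj : ∀ s t : ℝ, s * s = 1 → t * t = 1 →
          (OnlyZero u v (p '' realRay V s) ∧ OnlyZero v u (p '' imagRay V t)) ∨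
          (OnlyZero v u (p '' realRay V s) ∧ OnlyZero u v (p '' imagRay V t)) := by
        intro s t hs ht
        refine h.onlyZero_opposite (hpre (convex_quadrant s t)) (hpre (convex_realRay s))
          (hpre (convex_imagRay t)) (rq s t) (iq s t) (rne s hs) (ine t ht) ?_ ?_ ?_
        · rintro _ ⟨y, hy, rfl⟩
          exact ⟨(hA y).2 hy.1, fun h => by simpa [(hB y).1 h] using hy.2⟩
        · rintro _ ⟨y, hy, rfl⟩
          exact ⟨(hB y).2 hy.1, fun h => by simpa [(hA y).1 h] using hy.2⟩
        · rintro _ ⟨y, hy, rfl⟩ hAB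
          rw [hA, hB, or_comm] at hAB
          exact (qcov s t y hy hAB).imp (mem_image_of_mem p) (mem_image_of_mem p)
      have rcov : (Y ∩ A) \ B ⊆ p '' realRay V 1 ∪ p '' realRay V (-1) := by
        rintro x ⟨⟨hxY, hxA⟩, hxB⟩
        have h1 := (he.1 ⟨x, hxY⟩).1 hxA
        have h2 := (he.2 ⟨x, hxY⟩).not.1 hxB
        rcases lt_or_gt_of_ne h2 with h3 | h3
        · exact .inr ⟨_, ⟨h1, by simpa using h3⟩, hpe x hxY⟩
        · exact .inl ⟨_, ⟨h1, by simpa using h3⟩, hpe x hxY⟩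
      have icov : (Y ∩ B) \ A ⊆ p '' imagRay V 1 ∪ p '' imagRay V (-1) := by
        rintro x ⟨⟨hxY, hxB⟩, hxA⟩
        have h1 := (he.2 ⟨x, hxY⟩).1 hxB
        have h2 := (he.1 ⟨x, hxY⟩).not.1 hxA
        rcases lt_or_gt_of_ne h2 with h3 | h3
        · exact .inr ⟨_, ⟨h1, by simpa using h3⟩, hpe x hxY⟩
        · exact .inl ⟨_, ⟨h1, by simpa using h3⟩, hpe x hxY⟩
      have excl : ∀ {s : Set T}, s.Nonempty → OnlyZero u v s → OnlyZero v u s → False := by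
        rintro s ⟨x, hx⟩ h1 h2
        exact (h2 x hx).2 (h1 x hx).1
      have a1 := adj 1 1 (by norm_num) (by norm_num)
      have a2 := adj 1 (-1) (by norm_num) (by norm_num)
      have a3 := adj (-1) 1 (by norm_num) (by norm_num)
      have x1 := excl (rne 1 (by norm_num))
      have x2 := excl (ine 1 (by norm_num))
      have concl : (∀ x ∈ p '' realRay V 1 ∪ p '' realRay V (-1), u x = 0 ∧ v x ≠ 0) ∧
          (∀ x ∈ p '' imagRay V 1 ∪ p '' imagRay V (-1), v x = 0 ∧ u x ≠ 0) ∨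
          (∀ x ∈ p '' realRay V 1 ∪ p '' realRay V (-1), v x = 0 ∧ u x ≠ 0) ∧
          (∀ x ∈ p '' imagRay V 1 ∪ p '' imagRay V (-1), u x = 0 ∧ v x ≠ 0) := by
        rcases a1 with a1 | a1
        · have a2' := a2.resolve_right fun h => x1 a1.1 h.1
          have a3' := a3.resolve_right fun h => x2 h.2 a1.2
          exact .inl ⟨fun x hx => hx.elim (a1.1 x) (a3'.1 x),
            fun x hx => hx.elim (a1.2 x) (a2'.2 x)⟩
        · have a2' := a2.resolve_left fun h => x1 h.1 a1.1
          have a3' := a3.resolve_left fun h => x2 a1.2 h.2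
          exact .inr ⟨fun x hx => hx.elim (a1.1 x) (a3'.1 x),
            fun x hx => hx.elim (a1.2 x) (a2'.2 x)⟩
      rcases concl with ⟨c1, c2⟩ | ⟨c1, c2⟩
      · exact .inl (h.aligned_of_onlyZero (fun x hx => c1 x (rcov hx)) fun x hx => c2 x (icov hx))
      · exact .inr (.inl (h.swap.aligned_of_onlyZero (fun x hx => c1 x (rcov hx))
          fun x hx => c2 x (icov hx)))
    · have hA : ∀ y, p y ∈ A ↔ max y.2.re y.2.im = 0 := fun y => by simpa using he.1 (e.symm y)
      have hB : ∀ y, p y ∈ B ↔ min y.2.re y.2.im = 0 := fun y => by simpa using he.2 (e.symm y)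
      have hor : ∀ y, p y ∈ A ∨ p y ∈ B → y.2.re = 0 ∨ y.2.im = 0 := by
        intro y hy
        rw [hA, hB] at hy
        rcases le_total y.2.re y.2.im with h1 | h1
        · rw [max_eq_right h1, min_eq_left h1] at hy; exact hy.symm
        · rw [max_eq_left h1, min_eq_right h1] at hy; exact hy
      have rA : ∀ x ∈ p '' realRay V (-1), x ∈ A ∧ x ∉ B := by
        rintro _ ⟨y, ⟨h1, h2⟩, rfl⟩
        have h3 : y.2.re < 0 := by simpa using h2
        rw [hA, hB, h1, max_eq_right h3.le, min_eq_left h3.le]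
        exact ⟨rfl, h3.ne⟩
      have iA : ∀ x ∈ p '' imagRay V (-1), x ∈ A ∧ x ∉ B := by
        rintro _ ⟨y, ⟨h1, h2⟩, rfl⟩
        have h3 : y.2.im < 0 := by simpa using h2
        rw [hA, hB, h1, max_eq_left h3.le, min_eq_right h3.le]
        exact ⟨rfl, h3.ne⟩
      have rB : ∀ x ∈ p '' realRay V 1, x ∈ B ∧ x ∉ A := by
        rintro _ ⟨y, ⟨h1, h2⟩, rfl⟩
        have h3 : 0 < y.2.re := by simpa using h2
        rw [hA, hB, h1, max_eq_left h3.le, min_eq_right h3.le]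
        exact ⟨rfl, h3.ne'⟩
      have iB : ∀ x ∈ p '' imagRay V 1, x ∈ B ∧ x ∉ A := by
        rintro _ ⟨y, ⟨h1, h2⟩, rfl⟩
        have h3 : 0 < y.2.im := by simpa using h2
        rw [hA, hB, h1, max_eq_right h3.le, min_eq_left h3.le]
        exact ⟨rfl, h3.ne'⟩
      have a1 := h.onlyZero_opposite (hpre (convex_quadrant (-1) 1)) (hpre (convex_realRay (-1)))
        (hpre (convex_imagRay 1)) (rq _ _) (iq _ _) (rne _ (by norm_num)) (ine _ (by norm_num))
        rA iB (by
          rintro _ ⟨y, hy, rfl⟩ hAB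
          exact (qcov _ _ y hy (hor y hAB)).imp (mem_image_of_mem p) (mem_image_of_mem p))
      have a2 := h.onlyZero_opposite (hpre (convex_quadrant 1 (-1))) (hpre (convex_imagRay (-1)))
        (hpre (convex_realRay 1)) (iq _ _) (rq _ _) (ine _ (by norm_num)) (rne _ (by norm_num))
        iA rB (by
          rintro _ ⟨y, hy, rfl⟩ hAB
          exact (qcov _ _ y hy (hor y hAB)).symm.imp (mem_image_of_mem p) (mem_image_of_mem p))
      have cov : ∀ x (hx : x ∈ Y), x ∈ A ∨ x ∈ B → (x ∈ A ∧ x ∈ B) ∨ x ∈ p '' realRay V 1 ∨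
          x ∈ p '' realRay V (-1) ∨ x ∈ p '' imagRay V 1 ∨ x ∈ p '' imagRay V (-1) := by
        intro x hx hAB
        have h1 := hpe x hx
        generalize e ⟨x, hx⟩ = y at h1
        subst h1
        rcases hor y hAB with h2 | h2
        · rcases lt_trichotomy y.2.im 0 with h3 | h3 | h3
          · exact .inr (.inr (.inr (.inr ⟨y, ⟨h2, by simpa using h3⟩, rfl⟩)))
          · exact .inl (by rw [hA, hB, h2, h3]; simp)
          · exact .inr (.inr (.inr (.inl ⟨y, ⟨h2, by simpa using h3⟩, rfl⟩)))
        · rcases lt_trichotomy y.2.re 0 with h3 | h3 | h3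
          · exact .inr (.inr (.inl ⟨y, ⟨h2, by simpa using h3⟩, rfl⟩))
          · exact .inl (by rw [hA, hB, h2, h3]; simp)
          · exact .inr (.inl ⟨y, ⟨h2, by simpa using h3⟩, rfl⟩)
      have zero : ∀ y : V × ℂ, y.2.re = 0 → y.2.im = 0 → u (p y) = 0 ∧ v (p y) = 0 := by
        intro y h1 h2
        rw [← h.mem_and_iff, hA, hB, h1, h2]
        simp
      have hyb : ∀ u' v' : T → ℝ,
          (∀ x, x ∈ A ∨ x ∈ B ↔ u' x = 0 ∨ v' x = 0) →
          (∀ y : V × ℂ, y.2.re = 0 → y.2.im = 0 → u' (p y) = 0 ∧ v' (p y) = 0) →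
          OnlyZero v' u' (p '' realRay V (-1)) → OnlyZero u' v' (p '' imagRay V 1) →
          OnlyZero u' v' (p '' imagRay V (-1)) → OnlyZero v' u' (p '' realRay V 1) →
          (∀ y, u' (p y) = 0 ↔ y.2.re = 0) ∧ (∀ y, v' (p y) = 0 ↔ y.2.im = 0) := by
        intro u' v' hor' zero' b1 b2 b3 b4
        have r : ∀ y : V × ℂ, y.2.im = 0 → y.2.re ≠ 0 → v' (p y) = 0 ∧ u' (p y) ≠ 0 := by
          intro y h1 h2
          rcases lt_or_gt_of_ne h2 with h3 | h3
          · exact b1 _ ⟨y, ⟨h1, by simpa using h3⟩, rfl⟩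
          · exact b4 _ ⟨y, ⟨h1, by simpa using h3⟩, rfl⟩
        have i : ∀ y : V × ℂ, y.2.re = 0 → y.2.im ≠ 0 → u' (p y) = 0 ∧ v' (p y) ≠ 0 := by
          intro y h1 h2
          rcases lt_or_gt_of_ne h2 with h3 | h3
          · exact b3 _ ⟨y, ⟨h1, by simpa using h3⟩, rfl⟩
          · exact b2 _ ⟨y, ⟨h1, by simpa using h3⟩, rfl⟩
        have n : ∀ y : V × ℂ, y.2.re ≠ 0 → y.2.im ≠ 0 → u' (p y) ≠ 0 ∧ v' (p y) ≠ 0 := by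
          intro y h1 h2
          have h3 := (hor' (p y)).not.1 fun h4 => (hor y h4).elim h1 h2
          exact not_or.1 h3
        refine ⟨fun y => ?_, fun y => ?_⟩ <;> by_cases h1 : y.2.re = 0 <;>
          by_cases h2 : y.2.im = 0
        · exact iff_of_true (zero' y h1 h2).1 h1
        · exact iff_of_true (i y h1 h2).1 h1
        · exact iff_of_false (r y h2 h1).2 h1
        · exact iff_of_false (n y h1 h2).1 h1
        · exact iff_of_true (zero' y h1 h2).2 h2
        · exact iff_of_false (i y h1 h2).2 h2
        · exact iff_of_true (r y h2 h1).1 h2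
        · exact iff_of_false (n y h1 h2).2 h2
      have al : ∀ {u' v' : T → ℝ}, IsFold A B u' v' →
          OnlyZero u' v' (p '' realRay V (-1)) → OnlyZero v' u' (p '' imagRay V 1) →
          OnlyZero u' v' (p '' imagRay V (-1)) → OnlyZero v' u' (p '' realRay V 1) →
          Aligned A B u' v' Y := by
        intro u' v' h' b1 b2 b3 b4
        refine h'.aligned_of_onlyZero ?_ ?_
        · rintro x ⟨⟨hxY, hxA⟩, hxB⟩
          rcases cov x hxY (.inl hxA) with h1 | h1 | h1 | h1 | h1
          · exact absurd h1.2 hxB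
          · exact absurd (rB x h1).1 hxB
          · exact b1 x h1
          · exact absurd (iB x h1).1 hxB
          · exact b3 x h1
        · rintro x ⟨⟨hxY, hxB⟩, hxA⟩
          rcases cov x hxY (.inr hxB) with h1 | h1 | h1 | h1 | h1
          · exact absurd h1.1 hxA
          · exact b4 x h1
          · exact absurd (rA x h1).1 hxA
          · exact b2 x h1
          · exact absurd (iA x h1).1 hxA
      rcases a1 with ⟨b1, b2⟩ | ⟨b1, b2⟩ <;> rcases a2 with ⟨b3, b4⟩ | ⟨b3, b4⟩
      · exact .inl (al h b1 b2 b3 b4)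
      · obtain ⟨c1, c2⟩ := hyb v u h.swap.mem_or_iff (fun y h1 h2 => (zero y h1 h2).symm)
          b1 b2 b3 b4
        refine .inr (.inr ⟨e.trans (swapFiber V), ⟨fun y => ?_, fun y => ?_⟩, fun y => ?_,
          fun y => ?_⟩)
        · rw [Homeomorph.trans_apply, swapFiber_re, swapFiber_im, max_comm]; exact he.1 y
        · rw [Homeomorph.trans_apply, swapFiber_re, swapFiber_im, min_comm]; exact he.2 y
        · rw [Homeomorph.trans_apply, swapFiber_re, ← c2, hp]; simp
        · rw [Homeomorph.trans_apply, swapFiber_im, ← c1, hp]; simp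
      · obtain ⟨c1, c2⟩ := hyb u v h.mem_or_iff zero b1 b2 b3 b4
        refine .inr (.inr ⟨e, he, fun y => ?_, fun y => ?_⟩)
        · rw [← c1, hp]; simp
        · rw [← c2, hp]; simp
      · exact .inr (.inl (al h.swap b1 b2 b3 b4))

end IsFold

/-- Homeomorphisms of two pieces onto the two halves of `D × ℝ` glue to a homeomorphism. -/
theorem exists_glued_homeomorph {X D : Type*} [TopologicalSpace X] [TopologicalSpace D] [Nonempty D]
    {E P Q : Set X} {f : X → ℝ} (hf : Continuous f) (α : P ≃ₜ D × ℝ) (β : Q ≃ₜ D × ℝ)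
    (hEP : ∀ x ∈ E, f x ≤ 0 → x ∈ P) (hEQ : ∀ x ∈ E, 0 ≤ f x → x ∈ Q)
    (hα : ∀ x : P, (α x).2 ≤ 0 ↔ (x : X) ∈ E ∧ f x ≤ 0)
    (hβ : ∀ x : Q, 0 < (β x).2 ↔ (x : X) ∈ E ∧ 0 < f x)
    (hα0 : ∀ x : P, (α x).2 = 0 → f x = 0)
    (hαβ : ∀ x (hP : x ∈ P) (hQ : x ∈ Q), x ∈ E → f x = 0 → α ⟨x, hP⟩ = β ⟨x, hQ⟩) :
    ∃ γ : E ≃ₜ D × ℝ, ∀ x : E, (∃ hP : (x : X) ∈ P, γ x = α ⟨x, hP⟩) ∨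
      ∃ hQ : (x : X) ∈ Q, γ x = β ⟨x, hQ⟩ := by
  classical
  obtain ⟨d₀⟩ := ‹Nonempty D›
  let α' : X → D × ℝ := fun x => if h : x ∈ P then α ⟨x, h⟩ else (d₀, 0)
  let β' : X → D × ℝ := fun x => if h : x ∈ Q then β ⟨x, h⟩ else (d₀, 0)
  have eα : ∀ x (h : x ∈ P), α' x = α ⟨x, h⟩ := fun x h => dif_pos h
  have eβ : ∀ x (h : x ∈ Q), β' x = β ⟨x, h⟩ := fun x h => dif_pos h
  have cα : ContinuousOn α' P := by
    rw [continuousOn_iff_continuous_domRestrict]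
    convert α.continuous using 1
    ext1 x
    exact eα x x.2
  have cβ : ContinuousOn β' Q := by
    rw [continuousOn_iff_continuous_domRestrict]
    convert β.continuous using 1
    ext1 x
    exact eβ x x.2
  let F : E → D × ℝ := fun x => if f x ≤ 0 then α' x else β' x
  let G : D × ℝ → X := fun y => if y.2 ≤ 0 then α.symm y else β.symm y
  have hFα : ∀ x : E, (h : f x ≤ 0) → F x = α ⟨x, hEP x x.2 h⟩ := fun x h => by
    rw [← eα]; exact if_pos h
  have hFβ : ∀ x : E, (h : 0 < f x) → F x = β ⟨x, hEQ x x.2 h.le⟩ := fun x h => by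
    rw [← eβ]; exact if_neg h.not_ge
  have hF : Continuous F := by
    refine continuous_if_le (hf.comp continuous_subtype_val) continuous_const ?_ ?_ ?_
    · exact cα.comp continuous_subtype_val.continuousOn fun x hx => hEP x x.2 hx
    · exact cβ.comp continuous_subtype_val.continuousOn fun x hx => hEQ x x.2 hx
    · intro x hx
      rw [eα x (hEP x x.2 hx.le), eβ x (hEQ x x.2 hx.ge)]
      exact hαβ x _ _ x.2 hx
  have hG : Continuous G := by
    refine Continuous.if_le (by fun_prop) (by fun_prop) continuous_snd continuous_const ?_
    intro y hy
    have h1 : (α (α.symm y)).2 = 0 := by simpa using hy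
    have h2 := (hα (α.symm y)).1 h1.le
    have h3 := hα0 _ h1
    have h4 := hαβ _ (α.symm y).2 (hEQ _ h2.1 h3.ge) h2.1 h3
    rw [Subtype.coe_eta, α.apply_symm_apply] at h4
    conv_rhs => rw [h4]
    simp
  have hGα : ∀ y : D × ℝ, (h : y.2 ≤ 0) → G y = α.symm y := fun y h => if_pos h
  have hGβ : ∀ y : D × ℝ, (h : 0 < y.2) → G y = β.symm y := fun y h => if_neg h.not_ge
  have hα' : ∀ y : D × ℝ, y.2 ≤ 0 → ((α.symm y : P) : X) ∈ E ∧ f (α.symm y) ≤ 0 := fun y hy =>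
    (hα _).1 (by simpa using hy)
  have hβ' : ∀ y : D × ℝ, 0 < y.2 → ((β.symm y : Q) : X) ∈ E ∧ 0 < f (β.symm y) := fun y hy =>
    (hβ _).1 (by simpa using hy)
  have hGE : ∀ y, G y ∈ E := by
    intro y
    rcases le_or_gt y.2 0 with h | h
    · rw [hGα y h]; exact (hα' y h).1
    · rw [hGβ y h]; exact (hβ' y h).1
  refine ⟨⟨⟨F, fun y => ⟨G y, hGE y⟩, fun x => Subtype.ext ?_, fun y => ?_⟩, hF,
    hG.subtype_mk _⟩, fun x => ?_⟩
  · change G (F x) = x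
    rcases le_or_gt (f x) 0 with h | h
    · rw [hGα _ (by rw [hFα x h]; exact (hα _).2 ⟨x.2, h⟩), hFα x h]; simp
    · rw [hGβ _ (by rw [hFβ x h]; exact (hβ _).2 ⟨x.2, h⟩), hFβ x h]; simp
  · rcases le_or_gt y.2 0 with h | h
    · have h1 : f (G y) ≤ 0 := by rw [hGα y h]; exact (hα' y h).2
      rw [hFα _ h1]
      simp [hGα y h]
    · have h1 : 0 < f (G y) := by rw [hGβ y h]; exact (hβ' y h).2
      rw [hFβ _ h1]
      simp [hGβ y h]
  · rcases le_or_gt (f x) 0 with h | h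
    · exact .inl ⟨_, hFα x h⟩
    · exact .inr ⟨_, hFβ x h⟩

/-- A continuous function on `V × ℂ` that vanishes exactly on `{im = 0}` and takes both signs
has constant sign on each side. -/
theorem nonpos_iff_im_nonpos_or {V : Type*} [NormedAddCommGroup V] [NormedSpace ℝ V]
    {g : V × ℂ → ℝ} (hg : Continuous g) (h0 : ∀ y, g y = 0 ↔ y.2.im = 0)
    (hpos : ∃ y, 0 < g y) (hneg : ∃ y, g y < 0) :
    (∀ y, g y ≤ 0 ↔ y.2.im ≤ 0) ∨ ∀ y, g y ≤ 0 ↔ 0 ≤ y.2.im := by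
  have c1 := (convex_setOf_combo_pos (V := V) 0 1).isPreconnected
  have c2 := (convex_setOf_combo_pos (V := V) 0 (-1)).isPreconnected
  simp only [zero_mul, one_mul, neg_mul, zero_add, Left.neg_pos_iff] at c1 c2
  have h1 := forall_pos_or_forall_neg c1 hg.continuousOn fun y hy h => hy.ne' ((h0 y).1 h)
  have h2 := forall_pos_or_forall_neg c2 hg.continuousOn fun y hy h => hy.ne ((h0 y).1 h)
  obtain ⟨p, hp⟩ := hpos
  obtain ⟨q, hq⟩ := hneg
  simp only [Set.mem_ofPred_eq] at h1 h2
  rcases h1 with h1 | h1 <;> rcases h2 with h2 | h2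
  · exfalso
    rcases lt_trichotomy q.2.im 0 with h | h | h
    · exact (h2 q h).not_gt hq
    · exact hq.ne ((h0 q).2 h)
    · exact (h1 q h).not_gt hq
  · refine .inl fun y => ?_
    rcases lt_trichotomy y.2.im 0 with h | h | h
    · exact iff_of_true (h2 y h).le h.le
    · exact iff_of_true ((h0 y).2 h).le h.le
    · exact iff_of_false (h1 y h).not_ge h.not_ge
  · refine .inr fun y => ?_
    rcases lt_trichotomy y.2.im 0 with h | h | h
    · exact iff_of_false (h2 y h).not_ge h.not_ge
    · exact iff_of_true ((h0 y).2 h).le h.ge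
    · exact iff_of_true (h1 y h).le h.le
  · exfalso
    rcases lt_trichotomy p.2.im 0 with h | h | h
    · exact (h2 p h).not_gt hp
    · exact hp.ne' ((h0 p).2 h)
    · exact (h1 p h).not_gt hp

namespace IsFold

variable {T : Type*} [TopologicalSpace T] {A B : Set T} {u v : T → ℝ}

theorem hybrid_neg {V : Type*} [NormedAddCommGroup V] {Y : Set T} {e : Y ≃ₜ V × ℂ}
    (he : Hybrid A B u v e) :
    Hybrid B A (fun x => -u x) (fun x => -v x) (e.trans (Homeomorph.neg (V × ℂ))) := by
  refine ⟨⟨fun y => ?_, fun y => ?_⟩, fun y => ?_, fun y => ?_⟩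
  · simp [he.1.2, max_neg_neg]
  · simp [he.1.1, min_neg_neg]
  · simp [he.2.1]
  · simp [he.2.2]

theorem aligned_neg {T : Type*} {A B Y : Set T} {u v : T → ℝ} (h : Aligned A B v u Y) :
    Aligned B A (fun x => -u x) (fun x => -v x) Y := fun x hx =>
  ⟨by simpa using (h x hx).2, by simpa using (h x hx).1⟩

theorem hybrid_exists_signs {V : Type*} [NormedAddCommGroup V] (h : IsFold A B u v) {Z : Set T}
    {e : Z ≃ₜ V × ℂ} (he : Hybrid A B u v e) :
    (∃ x ∈ Z, x ∈ A ∧ x ∉ B ∧ u x = 0 ∧ v x < 0) ∧ ∃ x ∈ Z, x ∈ A ∧ x ∉ B ∧ v x = 0 ∧ u x < 0 := by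
  have key : ∀ w : ℂ, ((e.symm (0, w) : Z) : T) ∈ Z ∧
      (((e.symm (0, w) : Z) : T) ∈ A ↔ max w.re w.im = 0) ∧
      (((e.symm (0, w) : Z) : T) ∈ B ↔ min w.re w.im = 0) ∧
      (u (e.symm (0, w)) = 0 ↔ w.re = 0) ∧ (v (e.symm (0, w)) = 0 ↔ w.im = 0) := fun w =>
    ⟨(e.symm (0, w)).2, by simp [he.1.1], by simp [he.1.2], by simp [he.2.1], by simp [he.2.2]⟩
  constructor
  · obtain ⟨h1, h2, h3, h4, h5⟩ := key (-Complex.I)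
    refine ⟨_, h1, h2.2 (by simp), h3.not.2 (by simp), h4.2 (by simp), ?_⟩
    exact h.swap.neg_of_mem_max (h2.2 (by simp)) (h5.not.2 (by simp))
  · obtain ⟨h1, h2, h3, h4, h5⟩ := key (-1)
    refine ⟨_, h1, h2.2 (by simp), h3.not.2 (by simp), h5.2 (by simp), ?_⟩
    exact h.neg_of_mem_max (h2.2 (by simp)) (h4.not.2 (by simp))

theorem sub_eq_zero_iff (h : IsFold A B u v) {x : T} (hx : x ∈ A) : v x - u x = 0 ↔ x ∈ B := by
  have h1 := (h.mem_max x).1 hx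
  rw [h.mem_min, sub_eq_zero]
  constructor
  · intro h2
    rw [h2, max_self] at h1
    rw [h2, min_self, h1]
  · intro h2
    rcases le_total (u x) (v x) with h3 | h3 <;> simp [h3] at h1 h2 <;> linarith

/-- If `A` and `B` touch inside `Z = Y ∩ C`, then `B` and `C` cannot touch inside `Y ∩ A`. -/
theorem not_touchChart {V V' : Type*} [NormedAddCommGroup V] [NormedSpace ℝ V]
    [NormedAddCommGroup V'] (h : IsFold A B u v) {Y C : Set T}
    {e' : ↥(Y ∩ C) ≃ₜ V' × ℂ} (he' : Hybrid A B u v e') (e : ↥(Y ∩ A) ≃ₜ V × ℂ) :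
    ¬TouchChart B C e := by
  intro he
  have hc : IsPreconnected {y : V × ℂ | 0 < max y.2.re y.2.im} := by
    have h1 := convex_setOf_combo_pos (V := V) 1 0
    have h2 := convex_setOf_combo_pos (V := V) 0 1
    have h3 := h1.isPreconnected.union (0, (1 + Complex.I)) (by simp) (by simp) h2.isPreconnected
    convert h3 using 1
    ext y
    simp
  have hcont : Continuous fun y : V × ℂ => v (e.symm y) - u (e.symm y) :=
    (h.cont_right.comp (continuous_subtype_val.comp e.symm.continuous)).sub
      (h.cont_left.comp (continuous_subtype_val.comp e.symm.continuous))
  have hs := forall_pos_or_forall_neg hc hcont.continuousOn (fun y hy h0 => by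
    rw [h.sub_eq_zero_iff (e.symm y).2.2, he.1, e.apply_symm_apply] at h0
    exact (lt_of_lt_of_eq hy h0).ne rfl)
  obtain ⟨⟨p, hp, hpA, hpB, hpu, hpv⟩, q, hq, hqA, hqB, hqv, hqu⟩ := h.hybrid_exists_signs he'
  have key : ∀ x (hx : x ∈ Y ∩ C) (hxA : x ∈ A), x ∉ B →
      e ⟨x, hx.1, hxA⟩ ∈ {y : V × ℂ | 0 < max y.2.re y.2.im} := by
    intro x hx hxA hxB
    have h1 := (he.1 ⟨x, hx.1, hxA⟩).not.1 hxB
    have h2 := (he.2 ⟨x, hx.1, hxA⟩).1 hx.2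
    refine lt_of_le_of_ne ?_ (Ne.symm h1)
    rw [← h2]
    exact min_le_max
  rcases hs with hs | hs
  · have := hs _ (key p hp hpA hpB)
    simp only [Homeomorph.symm_apply_apply] at this
    linarith
  · have := hs _ (key q hq hqA hqB)
    simp only [Homeomorph.symm_apply_apply] at this
    linarith

theorem exists_oriented_crossChart {V V' : Type*} [NormedAddCommGroup V] [NormedSpace ℝ V]
    [NormedAddCommGroup V'] (h : IsFold A B u v) {Y C : Set T}
    {e' : ↥(Y ∩ C) ≃ₜ V' × ℂ} (he' : Hybrid A B u v e') (e : ↥(Y ∩ A) ≃ₜ V × ℂ)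
    (he : CrossChart B C e) :
    ∃ e : ↥(Y ∩ A) ≃ₜ V × ℂ, CrossChart B C e ∧ ∀ x, (e x).2.im ≤ 0 ↔ v x ≤ u x := by
  obtain ⟨⟨p, hp, hpA, hpB, hpu, hpv⟩, q, hq, hqA, hqB, hqv, hqu⟩ := h.hybrid_exists_signs he'
  have hcont : Continuous fun y : V × ℂ => v (e.symm y) - u (e.symm y) :=
    (h.cont_right.comp (continuous_subtype_val.comp e.symm.continuous)).sub
      (h.cont_left.comp (continuous_subtype_val.comp e.symm.continuous))
  rcases nonpos_iff_im_nonpos_or hcont (fun y => by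
      rw [h.sub_eq_zero_iff (e.symm y).2.2, he.1, e.apply_symm_apply])
    ⟨e ⟨q, hq.1, hqA⟩, by simpa [hqv] using hqu⟩ ⟨e ⟨p, hp.1, hpA⟩, by simpa [hpu] using hpv⟩
    with h1 | h1
  · refine ⟨e, he, fun x => ?_⟩
    have := h1 (e x)
    simp only [Homeomorph.symm_apply_apply, sub_nonpos] at this
    exact this.symm
  · refine ⟨e.trans (Homeomorph.neg _), ⟨fun y => by simp [he.1], fun y => by simp [he.2]⟩,
      fun x => ?_⟩
    have := h1 (e x)
    simp only [Homeomorph.symm_apply_apply, sub_nonpos] at this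
    simp [this]

end IsFold

theorem FlatIn.of_homeomorph {X A : Type*} [TopologicalSpace X] [TopologicalSpace A]
    {Y Y' Z Z' : Set X} (h : FlatIn A Y Z) (θ : Y ≃ₜ Y')
    (hθ : ∀ y : Y, (y : X) ∈ Z ↔ (θ y : X) ∈ Z') : FlatIn A Y' Z' := by
  obtain ⟨φ, hφ⟩ := h
  refine ⟨θ.symm.trans φ, fun y => ?_⟩
  rw [Homeomorph.trans_apply, ← hφ, hθ, θ.apply_symm_apply]

/-- A chart in which `A` is `{im = 0}` restricts to a chart of `A`. -/
theorem exists_homeomorph_inter {X V : Type*} [TopologicalSpace X] [TopologicalSpace V]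
    {Y A : Set X} (e : Y ≃ₜ V × ℂ) (h : ∀ y : Y, (y : X) ∈ A ↔ (e y).2.im = 0) :
    ∃ τ : ↥(Y ∩ A) ≃ₜ V × ℝ, ∀ y : ↥(Y ∩ A),
      τ y = ((e ⟨y, y.2.1⟩).1, (e ⟨y, y.2.1⟩).2.re) := by
  have hmem : ∀ d : V × ℝ, ((e.symm (d.1, (d.2 : ℂ)) : Y) : X) ∈ Y ∩ A := fun d =>
    ⟨(e.symm _).2, (h _).2 (by simp)⟩
  refine ⟨⟨⟨fun y => ((e ⟨y, y.2.1⟩).1, (e ⟨y, y.2.1⟩).2.re),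
    fun d => ⟨e.symm (d.1, (d.2 : ℂ)), hmem d⟩, fun y => ?_, fun d => ?_⟩, ?_, ?_⟩, fun y => rfl⟩
  · have h1 : (e ⟨y, y.2.1⟩).2.im = 0 := (h _).1 y.2.2
    have h2 : (((e ⟨y, y.2.1⟩).1, (((e ⟨y, y.2.1⟩).2.re : ℝ) : ℂ)) : V × ℂ) = e ⟨y, y.2.1⟩ :=
      Prod.ext rfl (Complex.ext rfl (by simp [h1]))
    apply Subtype.ext
    simp [h2]
  · simp
  · fun_prop
  · fun_prop

namespace IsFold

variable {T : Type*} [TopologicalSpace T] {A B : Set T} {u v : T → ℝ}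

theorem flatIn_of_hybrid_of_aligned {D V : Type*} [TopologicalSpace D] [NormedAddCommGroup V]
    {Y C : Set T} {e : Y ≃ₜ V × ℂ} (he : Hybrid A B u v e)
    (hC : Aligned A B u v (Y ∩ C)) (hA : FlatIn D (Y ∩ A) C) : FlatIn D (Y ∩ u ⁻¹' {0}) C := by
  let f : V × ℂ → V × ℂ := fun y => (y.1, ⟨0, y.2.im - y.2.re⟩)
  let g : V × ℂ → V × ℂ := fun y => (y.1, ⟨min (-y.2.im) 0, min y.2.im 0⟩)
  have hf : Continuous f := continuous_fst.prodMk
    (Complex.equivRealProdCLM.symm.continuous.comp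
      (f := fun y : V × ℂ => ((0 : ℝ), y.2.im - y.2.re))
      (by fun_prop))
  have hg : Continuous g := continuous_fst.prodMk
    (Complex.equivRealProdCLM.symm.continuous.comp
      (f := fun y : V × ℂ => (min (-y.2.im) 0, min y.2.im 0)) (by fun_prop))
  have hfg : ∀ y, y.2.re = 0 → f (g y) = y := by
    rintro ⟨a, b⟩ hy
    refine Prod.ext rfl (Complex.ext (by simpa [f] using hy.symm) ?_)
    rcases le_total b.im 0 with h | h <;> simp [f, g, h]
  have hgf : ∀ y, max y.2.re y.2.im = 0 → g (f y) = y := by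
    rintro ⟨a, b⟩ hy
    refine Prod.ext rfl (Complex.ext ?_ ?_) <;> simp only [f, g] at hy ⊢ <;>
      rcases le_total b.re b.im with h | h <;> simp_all
  have hg0 : ∀ y, max (g y).2.re (g y).2.im = 0 := by
    rintro ⟨a, b⟩
    rcases le_total b.im 0 with h | h <;> simp [g, h]
  let θ : ↥(Y ∩ A) ≃ₜ ↥(Y ∩ u ⁻¹' {0}) :=
    { toFun := fun x => ⟨e.symm (f (e ⟨x, x.2.1⟩)), (e.symm _).2, (he.2.1 _).2 (by simp [f])⟩
      invFun := fun x => ⟨e.symm (g (e ⟨x, x.2.1⟩)), (e.symm _).2,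
        (he.1.1 _).2 (by rw [e.apply_symm_apply]; exact hg0 _)⟩
      left_inv := fun x => Subtype.ext <| by
        simp [hgf _ ((he.1.1 ⟨x, x.2.1⟩).1 x.2.2)]
      right_inv := fun x => Subtype.ext <| by
        simp [hfg _ ((he.2.1 ⟨x, x.2.1⟩).1 x.2.2)]
      continuous_toFun := by fun_prop
      continuous_invFun := by fun_prop }
  have hfix : ∀ x : ↥(Y ∩ A), u x = 0 → (θ x : T) = x := by
    intro x hx
    have h1 : f (e ⟨x, x.2.1⟩) = e ⟨x, x.2.1⟩ := by
      have h2 := (he.2.1 ⟨x, x.2.1⟩).1 hx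
      exact Prod.ext rfl (Complex.ext h2.symm (by simp [f, h2]))
    simp [θ, h1]
  refine hA.of_homeomorph θ fun x => ⟨fun hx => ?_, fun hx => ?_⟩
  · rwa [hfix x ((hC x ⟨x.2.1, hx⟩).1.1 x.2.2)]
  · have h1 : (θ x : T) ∈ A := (hC _ ⟨(θ x).2.1, hx⟩).1.2 (θ x).2.2
    have h2 : (⟨θ x, (θ x).2.1, h1⟩ : ↥(Y ∩ A)) = x :=
      θ.injective (Subtype.ext (hfix ⟨θ x, (θ x).2.1, h1⟩ (θ x).2.2))
    rw [← h2]
    exact hx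

theorem flatIn_of_hybrid_of_hybrid {V V₁ V₂ : Type*} [NormedAddCommGroup V] [NormedAddCommGroup V₁]
    [NormedSpace ℝ V₁] [NormedAddCommGroup V₂] [NormedSpace ℝ V₂] (h : IsFold A B u v)
    {Y C : Set T} {e' : ↥(Y ∩ C) ≃ₜ V × ℂ} (he' : Hybrid A B u v e')
    (e₁ : ↥(Y ∩ A) ≃ₜ V₁ × ℂ) (he₁ : CrossChart B C e₁)
    (e₂ : ↥(Y ∩ B) ≃ₜ V₂ × ℂ) (he₂ : CrossChart A C e₂) :
    FlatIn (V₁ × ℝ) (Y ∩ u ⁻¹' {0}) C := by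
  obtain ⟨α, hα, hα'⟩ := h.exists_oriented_crossChart he' e₁ he₁
  obtain ⟨β, hβ, hβ'⟩ := h.neg.exists_oriented_crossChart (hybrid_neg he') e₂ he₂
  simp only [neg_le_neg_iff] at hβ'
  obtain ⟨τ, hτ⟩ := exists_homeomorph_inter α hα.1
  obtain ⟨σ, hσ⟩ := exists_homeomorph_inter β hβ.1
  let η : V₂ × ℝ ≃ₜ V₁ × ℝ := σ.symm.trans
    ((Homeomorph.setCongr (inter_right_comm Y B A)).trans τ)
  have hη : ∀ y : ↥(Y ∩ B ∩ A), η (σ y) = τ ⟨y, ⟨y.2.1.1, y.2.2⟩, y.2.1.2⟩ := fun y => by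
    simp [η, Homeomorph.setCongr]
  have hη0 : ∀ d, (η d).2 = 0 ↔ d.2 = 0 := by
    intro d
    obtain ⟨y, rfl⟩ := σ.surjective d
    rw [hη, hτ, hσ, ← hα.2, ← hβ.2]
  let α' : ↥(Y ∩ A) ≃ₜ (V₁ × ℝ) × ℝ := α.trans (prodComplex V₁).symm
  let β' : ↥(Y ∩ B) ≃ₜ (V₁ × ℝ) × ℝ :=
    (β.trans (prodComplex V₂).symm).trans (η.prodCongr (Homeomorph.neg ℝ))
  have mA := fun x : ↥(Y ∩ A) => (h.mem_max x).1 x.2.2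
  have mB := fun x : ↥(Y ∩ B) => (h.mem_min x).1 x.2.2
  obtain ⟨γ, hγ⟩ := exists_glued_homeomorph (E := Y ∩ u ⁻¹' {0}) (f := fun x => v x - u x)
    (h.cont_right.sub h.cont_left) α' β'
    (fun x hx hx' => ⟨hx.1, (h.mem_max x).2 (by
      rw [max_eq_left (sub_nonpos.1 hx')]; exact hx.2)⟩)
    (fun x hx hx' => ⟨hx.1, (h.mem_min x).2 (by
      rw [min_eq_left (sub_nonneg.1 hx')]; exact hx.2)⟩)
    (fun x => by
      change (α x).2.im ≤ 0 ↔ _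
      rw [hα', sub_nonpos]
      refine ⟨fun h1 => ⟨⟨x.2.1, ?_⟩, h1⟩, And.right⟩
      have := mA x
      rwa [max_eq_left h1] at this)
    (fun x => by
      change 0 < -(β x).2.im ↔ _
      rw [neg_pos, lt_iff_le_and_ne, hβ', Ne, ← hβ.1, sub_pos, h.mem_max]
      have h2 := mB x
      constructor
      · rintro ⟨h1, h3⟩
        rw [min_eq_left h1] at h2
        rw [max_eq_right h1] at h3
        exact ⟨⟨x.2.1, h2⟩, lt_of_le_of_ne h1 (h2.trans_ne (Ne.symm h3))⟩
      · rintro ⟨h1, h3⟩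
        have h4 : u x = 0 := h1.2
        rw [max_eq_right h3.le]
        exact ⟨h3.le, (h4 ▸ h3).ne'⟩)
    (fun x hx => (h.sub_eq_zero_iff x.2.2).2 ((hα.1 x).2 hx))
    (fun x hP hQ _ _ => by
      have h1 := hη ⟨x, hQ, hP.2⟩
      rw [hσ, hτ] at h1
      refine Prod.ext h1.symm ?_
      change (α ⟨x, hP⟩).2.im = -(β ⟨x, hQ⟩).2.im
      rw [(hα.1 _).1 hQ.2, (hβ.1 _).1 hP.2, neg_zero])
  refine ⟨γ.trans ((Homeomorph.prodAssoc V₁ ℝ ℝ).trans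
    (((Homeomorph.refl V₁).prodCongr (Homeomorph.prodComm ℝ ℝ)).trans
      (Homeomorph.prodAssoc V₁ ℝ ℝ).symm)), fun x => ?_⟩
  change _ ↔ (γ x).1.2 = 0
  rcases hγ x with ⟨hP, h1⟩ | ⟨hQ, h1⟩
  · rw [h1]
    exact hα.2 ⟨x, hP⟩
  · rw [h1]
    change _ ↔ (η ((β ⟨x, hQ⟩).1, (β ⟨x, hQ⟩).2.re)).2 = 0
    rw [hη0]
    exact hβ.2 ⟨x, hQ⟩

end IsFold

theorem FlatIn.congr_right {X A : Type*} [TopologicalSpace X] [TopologicalSpace A]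
    {Y Z Z' : Set X} (h : FlatIn A Y Z) (hZ : ∀ x ∈ Y, x ∈ Z ↔ x ∈ Z') : FlatIn A Y Z' := by
  obtain ⟨φ, hφ⟩ := h
  exact ⟨φ, fun y => (hZ y y.2).symm.trans (hφ y)⟩

theorem FlatIn.congr_model {X A A' : Type*} [TopologicalSpace X] [TopologicalSpace A]
    [TopologicalSpace A'] {Y Z : Set X} (h : FlatIn A Y Z) (ψ : A ≃ₜ A') : FlatIn A' Y Z := by
  obtain ⟨φ, hφ⟩ := h
  exact ⟨φ.trans (ψ.prodCongr (Homeomorph.refl ℝ)), hφ⟩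

theorem FlatIn.nonempty_homeomorph {X A : Type*} [TopologicalSpace X] [TopologicalSpace A]
    {Y Z : Set X} (h : FlatIn A Y Z) : Nonempty (↥(Y ∩ Z) ≃ₜ A) := by
  obtain ⟨φ, hφ⟩ := h
  have hmem : ∀ a : A, ((φ.symm (a, 0) : Y) : X) ∈ Y ∩ Z := fun a =>
    ⟨(φ.symm (a, 0)).2, (hφ _).2 (by simp)⟩
  refine ⟨⟨⟨fun y => (φ ⟨y, y.2.1⟩).1, fun a => ⟨φ.symm (a, 0), hmem a⟩, fun y => ?_,
    fun a => by simp⟩, by fun_prop, by fun_prop⟩⟩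
  have h1 : (φ ⟨y, y.2.1⟩).2 = 0 := (hφ ⟨y, y.2.1⟩).1 y.2.2
  have h2 : ((φ ⟨y, y.2.1⟩).1, (0 : ℝ)) = φ ⟨y, y.2.1⟩ := by rw [← h1]
  exact Subtype.ext (by simp [h2])

theorem FlatIn.isPreconnected {X A : Type*} [TopologicalSpace X] [TopologicalSpace A]
    [PreconnectedSpace A] {Y Z : Set X} (h : FlatIn A Y Z) : IsPreconnected (Y ∩ Z) := by
  obtain ⟨τ⟩ := h.nonempty_homeomorph
  have h1 : range (fun a => (τ.symm a : X)) = Y ∩ Z := by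
    rw [show (fun a => (τ.symm a : X)) = Subtype.val ∘ τ.symm from rfl, range_comp,
      τ.symm.surjective.range_eq, image_univ, Subtype.range_val]
  rw [← h1]
  exact isPreconnected_range (continuous_subtype_val.comp τ.symm.continuous)

/-- `ℝᵏ × ℝ ≃ ℝᵏ⁺¹`, with the last coordinate put first. -/
def prodHomeomorphFinSucc (k : ℕ) : ((Fin k → ℝ) × ℝ) ≃ₜ (Fin (k + 1) → ℝ) where
  toFun x := Fin.cons x.2 x.1
  invFun y := (Fin.tail y, y 0)
  left_inv x := by simp
  right_inv y := by simp
  continuous_toFun := by fun_prop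
  continuous_invFun := by unfold Fin.tail; fun_prop

/-- The intersection of the members of a family indexed by `S`. -/
def interOf {ι T : Type*} (H : ι → Set T) (S : Finset ι) : Set T := {x | ∀ i ∈ S, x ∈ H i}

theorem interOf_insert {ι T : Type*} [DecidableEq ι] (H : ι → Set T) (S : Finset ι) (a : ι) :
    interOf H (insert a S) = interOf H S ∩ H a := by
  ext x
  simp only [interOf, Finset.mem_insert, forall_eq_or_imp, Set.mem_ofPred_eq, mem_inter_iff]
  exact and_comm

/-- A family whose members are nonempty and such that the members with index outside `S` are
disjoint from or flat in the intersection of the members with index in `S`, this intersection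
having codimension the number of elements of `S`. -/
structure IsSimpleFamily {ι T : Type*} [TopologicalSpace T] (n : ℕ) (H : ι → Set T) : Prop where
  nonempty : ∀ i, (H i).Nonempty
  exists_flatIn : ∀ (S : Finset ι) (i : ι), i ∉ S → (interOf H S ∩ H i).Nonempty →
    ∃ k, k + 1 + S.card = n ∧ FlatIn (Fin k → ℝ) (interOf H S) (H i)

namespace IsSimpleFamily

variable {ι T : Type*}

variable [TopologicalSpace T] {n : ℕ} {H : ι → Set T}

theorem flat (hH : IsSimpleFamily n H) {Y : Set T} {S : Finset ι} (hY : Y = interOf H S) {i : ι}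
    (hi : i ∉ S) (hne : (Y ∩ H i).Nonempty) :
    ∃ k, k + 1 + S.card = n ∧ FlatIn (Fin k → ℝ) Y (H i) := by
  subst hY
  exact hH.exists_flatIn S i hi hne

variable [DecidableEq ι]

theorem isPreconnected [PreconnectedSpace T] (hH : IsSimpleFamily n H) {Y : Set T} {S : Finset ι}
    (hY : Y = interOf H S) : IsPreconnected Y := by
  rcases Y.eq_empty_or_nonempty with h | h
  · rw [h]; exact isPreconnected_empty
  induction S using Finset.induction_on with
  | empty =>
    rw [hY]
    simpa [interOf] using isPreconnected_univ (α := T)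
  | insert a S ha ih =>
    rw [interOf_insert] at hY
    rw [hY] at h ⊢
    obtain ⟨k, -, hk⟩ := hH.exists_flatIn S a ha h
    exact hk.isPreconnected

theorem exists_chart (hH : IsSimpleFamily n H) {Y : Set T} {S : Finset ι} (hY : Y = interOf H S)
    {a b : ι} (hab : a ≠ b) (ha : a ∉ S) (hb : b ∉ S) (hne : (Y ∩ H a ∩ H b).Nonempty) :
    ∃ k, k + 2 + S.card = n ∧
      ∃ e : Y ≃ₜ (Fin k → ℝ) × ℂ, CrossChart (H a) (H b) e ∨ TouchChart (H a) (H b) e := by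
  have hne' : (Y ∩ H b ∩ H a).Nonempty := by rwa [inter_right_comm]
  obtain ⟨k₁, -, f₁⟩ := hH.flat hY ha (hne.mono inter_subset_left)
  obtain ⟨k₂, -, f₂⟩ := hH.flat hY hb (hne'.mono inter_subset_left)
  obtain ⟨k, hk, f₃⟩ := hH.flat (Y := Y ∩ H a) (S := insert a S)
    (by rw [hY, interOf_insert]) (by simp [hab.symm, hb]) hne
  obtain ⟨k₄, -, f₄⟩ := hH.flat (Y := Y ∩ H b) (S := insert b S)
    (by rw [hY, interOf_insert]) (by simp [hab, ha]) hne'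
  rw [Finset.card_insert_of_notMem ha] at hk
  exact ⟨k, by omega, exists_cross_or_touch_chart f₁ f₃ f₂ f₄⟩

variable [PreconnectedSpace T] {a b : ι} {u v : T → ℝ}

theorem trichotomy (hH : IsSimpleFamily n H) (h : IsFold (H a) (H b) u v) (hab : a ≠ b)
    {Y : Set T} {S : Finset ι} (hY : Y = interOf H S) (ha : a ∉ S) (hb : b ∉ S) :
    IsFold.Aligned (H a) (H b) u v Y ∨ IsFold.Aligned (H a) (H b) v u Y ∨
      ∃ k, k + 2 + S.card = n ∧ ∃ e : Y ≃ₜ (Fin k → ℝ) × ℂ, IsFold.Hybrid (H a) (H b) u v e := by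
  have c₁ := hH.isPreconnected hY
  have c₂ := hH.isPreconnected (Y := Y ∩ H a) (S := insert a S) (by rw [hY, interOf_insert])
  have c₃ := hH.isPreconnected (Y := Y ∩ H b) (S := insert b S) (by rw [hY, interOf_insert])
  rcases (Y ∩ H a ∩ H b).eq_empty_or_nonempty with hemp | hne
  · rcases h.trichotomy (V := ℝ) c₁ c₂ c₃ fun hne => absurd hemp hne.ne_empty with h1 | h1 | ⟨e, he⟩
    · exact .inl h1
    · exact .inr (.inl h1)
    · have : ((e.symm 0 : Y) : T) ∈ Y ∩ H a ∩ H b :=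
        ⟨⟨(e.symm 0).2, (he.1.1 _).2 (by simp)⟩, (he.1.2 _).2 (by simp)⟩
      rw [hemp] at this
      exact this.elim
  · obtain ⟨k, hk, he⟩ := hH.exists_chart hY hab ha hb hne
    rcases h.trichotomy c₁ c₂ c₃ fun _ => he with h1 | h1 | ⟨e, he⟩
    · exact .inl h1
    · exact .inr (.inl h1)
    · exact .inr (.inr ⟨k, hk, e, he⟩)

theorem flatIn_left (hH : IsSimpleFamily n H) (h : IsFold (H a) (H b) u v) (hab : a ≠ b)
    {Y : Set T} {S : Finset ι} (hY : Y = interOf H S) (ha : a ∉ S) (hb : b ∉ S)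
    (hne : (Y ∩ u ⁻¹' {0}).Nonempty) :
    ∃ k, k + 1 + S.card = n ∧ FlatIn (Fin k → ℝ) Y (u ⁻¹' {0}) := by
  obtain ⟨x, hxY, hx⟩ := hne
  rcases hH.trichotomy h hab hY ha hb with h1 | h1 | ⟨k, hk, e, he⟩
  · obtain ⟨k, hk, hf⟩ := hH.flat hY ha ⟨x, hxY, ((h1 x hxY).1).2 hx⟩
    exact ⟨k, hk, hf.congr_right fun x hx => (h1 x hx).1⟩
  · obtain ⟨k, hk, hf⟩ := hH.flat hY hb ⟨x, hxY, ((h1 x hxY).2).2 hx⟩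
    exact ⟨k, hk, hf.congr_right fun x hx => (h1 x hx).2⟩
  · refine ⟨k + 1, by omega, FlatIn.congr_model (A := (Fin k → ℝ) × ℝ) ?_
      (prodHomeomorphFinSucc k)⟩
    exact ⟨(e.trans (IsFold.swapFiber _)).trans (prodComplex _).symm, he.2.1⟩

theorem flatIn_left_right (hH : IsSimpleFamily n H) (h : IsFold (H a) (H b) u v) (hab : a ≠ b)
    {Y : Set T} {S : Finset ι} (hY : Y = interOf H S) (ha : a ∉ S) (hb : b ∉ S)
    (hne : (Y ∩ u ⁻¹' {0} ∩ v ⁻¹' {0}).Nonempty) :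
    ∃ k, k + 2 + S.card = n ∧ FlatIn (Fin k → ℝ) (Y ∩ u ⁻¹' {0}) (v ⁻¹' {0}) := by
  obtain ⟨x, ⟨hxY, hxu⟩, hxv⟩ := hne
  rcases hH.trichotomy h hab hY ha hb with h1 | h1 | ⟨k, hk, e, he⟩
  · have h2 : Y ∩ u ⁻¹' {0} = Y ∩ H a := by
      ext x
      exact and_congr_right fun hx => (h1 x hx).1.symm
    obtain ⟨k, hk, hf⟩ := hH.flat (Y := Y ∩ u ⁻¹' {0}) (S := insert a S) (i := b)
      (by rw [h2, hY, interOf_insert]) (by simp [hab.symm, hb]) ⟨x, ⟨hxY, hxu⟩, (h1 x hxY).2.2 hxv⟩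
    rw [Finset.card_insert_of_notMem ha] at hk
    exact ⟨k, by omega, hf.congr_right fun x hx => (h1 x hx.1).2⟩
  · have h2 : Y ∩ u ⁻¹' {0} = Y ∩ H b := by
      ext x
      exact and_congr_right fun hx => (h1 x hx).2.symm
    obtain ⟨k, hk, hf⟩ := hH.flat (Y := Y ∩ u ⁻¹' {0}) (S := insert b S) (i := a)
      (by rw [h2, hY, interOf_insert]) (by simp [hab, ha]) ⟨x, ⟨hxY, hxu⟩, (h1 x hxY).1.2 hxv⟩
    rw [Finset.card_insert_of_notMem hb] at hk
    exact ⟨k, by omega, hf.congr_right fun x hx => (h1 x hx.1).1⟩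
  · obtain ⟨τ, hτ⟩ := exists_homeomorph_inter (A := u ⁻¹' {0})
      (e.trans (IsFold.swapFiber _)) he.2.1
    refine ⟨k, hk, τ, fun x => ?_⟩
    rw [hτ]
    exact he.2.2 ⟨x, x.2.1⟩

theorem flatIn_left_inter (hH : IsSimpleFamily n H) (h : IsFold (H a) (H b) u v) (hab : a ≠ b)
    {Y : Set T} {S : Finset ι} (hY : Y = interOf H S) (ha : a ∉ S) (hb : b ∉ S) {c : ι}
    (hc : c ∉ S) (hca : c ≠ a) (hcb : c ≠ b) (hne : (Y ∩ u ⁻¹' {0} ∩ H c).Nonempty) :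
    ∃ k, k + 2 + S.card = n ∧ FlatIn (Fin k → ℝ) (Y ∩ u ⁻¹' {0}) (H c) := by
  obtain ⟨x, ⟨hxY, hxu⟩, hxc⟩ := hne
  have hYa : Y ∩ H a = interOf H (insert a S) := by rw [hY, interOf_insert]
  have hYb : Y ∩ H b = interOf H (insert b S) := by rw [hY, interOf_insert]
  have hYc : Y ∩ H c = interOf H (insert c S) := by rw [hY, interOf_insert]
  have hca' : c ∉ insert a S := by simp [hca, hc]
  have hcb' : c ∉ insert b S := by simp [hcb, hc]
  have hac' : a ∉ insert c S := by simp [hca.symm, ha]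
  have hbc' : b ∉ insert c S := by simp [hcb.symm, hb]
  have flatA : x ∈ H a → ∃ k, k + 2 + S.card = n ∧ FlatIn (Fin k → ℝ) (Y ∩ H a) (H c) := by
    intro hxa
    obtain ⟨k, hk, hf⟩ := hH.flat hYa hca' ⟨x, ⟨hxY, hxa⟩, hxc⟩
    rw [Finset.card_insert_of_notMem ha] at hk
    exact ⟨k, by omega, hf⟩
  have flatB : x ∈ H b → ∃ k, k + 2 + S.card = n ∧ FlatIn (Fin k → ℝ) (Y ∩ H b) (H c) := by
    intro hxb
    obtain ⟨k, hk, hf⟩ := hH.flat hYb hcb' ⟨x, ⟨hxY, hxb⟩, hxc⟩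
    rw [Finset.card_insert_of_notMem hb] at hk
    exact ⟨k, by omega, hf⟩
  rcases hH.trichotomy h hab hY ha hb with h1 | h1 | ⟨k, hk, e, he⟩
  · have h2 : Y ∩ u ⁻¹' {0} = Y ∩ H a := by
      ext x
      exact and_congr_right fun hx => (h1 x hx).1.symm
    rw [h2]
    exact flatA ((h1 x hxY).1.2 hxu)
  · have h2 : Y ∩ u ⁻¹' {0} = Y ∩ H b := by
      ext x
      exact and_congr_right fun hx => (h1 x hx).2.symm
    rw [h2]
    exact flatB ((h1 x hxY).2.2 hxu)
  rcases hH.trichotomy h hab hYc hac' hbc' with h2 | h2 | ⟨k', hk', e', he'⟩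
  · obtain ⟨m, hm, hf⟩ := flatA ((h2 x ⟨hxY, hxc⟩).1.2 hxu)
    exact ⟨m, hm, IsFold.flatIn_of_hybrid_of_aligned he h2 hf⟩
  · obtain ⟨m, hm, hf⟩ := flatB ((h2 x ⟨hxY, hxc⟩).2.2 hxu)
    have h3 := IsFold.flatIn_of_hybrid_of_aligned (IsFold.hybrid_neg he) (IsFold.aligned_neg h2) hf
    have h4 : (fun x => -u x) ⁻¹' {0} = u ⁻¹' {0} := by
      ext x
      simp
    rw [h4] at h3
    exact ⟨m, hm, h3⟩
  · have hz := (e'.symm 0).2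
    have hzA := (he'.1.1 (e'.symm 0)).2 (by simp)
    have hzB := (he'.1.2 (e'.symm 0)).2 (by simp)
    obtain ⟨k₁, hk₁, e₁, he₁⟩ := hH.exists_chart hYa hcb.symm (by simp [hab.symm, hb]) hca'
      ⟨_, ⟨⟨hz.1, hzA⟩, hzB⟩, hz.2⟩
    obtain ⟨k₂, hk₂, e₂, he₂⟩ := hH.exists_chart hYb hca.symm (by simp [hab, ha]) hcb'
      ⟨_, ⟨⟨hz.1, hzB⟩, hzA⟩, hz.2⟩
    have he₁' := he₁.resolve_right (h.not_touchChart he' e₁)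
    have he₂' := he₂.resolve_right (h.neg.not_touchChart (IsFold.hybrid_neg he') e₂)
    rw [Finset.card_insert_of_notMem ha] at hk₁
    exact ⟨k₁ + 1, by omega, (h.flatIn_of_hybrid_of_hybrid he' e₁ he₁' e₂ he₂').congr_model
      (prodHomeomorphFinSucc k₁)⟩

end IsSimpleFamily

theorem interOf_congr {ι T : Type*} {H H' : ι → Set T} {S : Finset ι}
    (h : ∀ i ∈ S, H i = H' i) : interOf H S = interOf H' S := by
  ext x
  exact forall₂_congr fun i hi => by rw [h i hi]

/-- The family `H` with `H a` and `H b` replaced by the zero sets of `u` and `v`. -/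
def foldReplace {ι T : Type*} [DecidableEq ι] (H : ι → Set T) (a b : ι) (u v : T → ℝ) (i : ι) :
    Set T :=
  if i = a then u ⁻¹' {0} else if i = b then v ⁻¹' {0} else H i

section Replace

variable {ι T : Type*} [DecidableEq ι] {H : ι → Set T} {a b : ι} {u v : T → ℝ}

theorem foldReplace_left : foldReplace H a b u v a = u ⁻¹' {0} := if_pos rfl

theorem foldReplace_right (hab : a ≠ b) : foldReplace H a b u v b = v ⁻¹' {0} := by
  rw [foldReplace, if_neg hab.symm, if_pos rfl]

theorem foldReplace_of_ne {i : ι} (ha : i ≠ a) (hb : i ≠ b) : foldReplace H a b u v i = H i := by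
  rw [foldReplace, if_neg ha, if_neg hb]

variable [TopologicalSpace T]

theorem IsFold.inter_eq {A B : Set T} (h : IsFold A B u v) : u ⁻¹' {0} ∩ v ⁻¹' {0} = A ∩ B := by
  ext x
  exact (h.mem_and_iff x).symm

theorem IsFold.union_eq {A B : Set T} (h : IsFold A B u v) : u ⁻¹' {0} ∪ v ⁻¹' {0} = A ∪ B := by
  ext x
  exact (h.mem_or_iff x).symm

theorem IsSimpleFamily.foldReplace [PreconnectedSpace T] {n : ℕ} (hH : IsSimpleFamily n H)
    (h : IsFold (H a) (H b) u v) (hab : a ≠ b) (hne : (H a ∩ H b).Nonempty) :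
    IsSimpleFamily n (foldReplace H a b u v) := by
  obtain ⟨z, hz⟩ := hne
  have hz' := hz
  rw [← h.inter_eq] at hz'
  refine ⟨fun i => ?_, fun S i hi hSi => ?_⟩
  · by_cases hia : i = a
    · subst hia; rw [foldReplace_left]; exact ⟨z, hz'.1⟩
    by_cases hib : i = b
    · subst hib; rw [foldReplace_right hab]; exact ⟨z, hz'.2⟩
    rw [foldReplace_of_ne hia hib]
    exact hH.nonempty i
  have base : ∀ S : Finset ι, a ∉ S → b ∉ S →
      interOf (_root_.foldReplace H a b u v) S = interOf H S := fun S ha hb =>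
    interOf_congr fun i hi => foldReplace_of_ne (fun h => ha (h ▸ hi)) fun h => hb (h ▸ hi)
  have split : ∀ (S : Finset ι) (c : ι), c ∈ S → ∃ S', c ∉ S' ∧ S = insert c S' := fun S c hc =>
    ⟨S.erase c, Finset.notMem_erase c S, (Finset.insert_erase hc).symm⟩
  by_cases haS : a ∈ S
  · obtain ⟨S, ha, rfl⟩ := split S a haS
    have hia : i ≠ a := fun h => hi (by simp [h])
    have hiS : i ∉ S := fun h => hi (by simp [h])
    rw [Finset.card_insert_of_notMem ha]
    rw [interOf_insert, foldReplace_left] at hSi ⊢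
    by_cases hbS : b ∈ S
    · obtain ⟨S, hb, rfl⟩ := split S b hbS
      have hib : i ≠ b := fun h => hi (by simp [h])
      rw [Finset.mem_insert, not_or] at ha
      have key : interOf (_root_.foldReplace H a b u v) (insert b S) ∩ u ⁻¹' {0} =
          interOf H (insert a (insert b S)) := by
        rw [interOf_insert, interOf_insert, interOf_insert, base S ha.2 hb, foldReplace_right hab,
          inter_assoc, inter_assoc, inter_comm (v ⁻¹' {0}), inter_comm (H b), h.inter_eq]
      rw [foldReplace_of_ne hia hib] at hSi ⊢
      obtain ⟨k, hk, hf⟩ := hH.flat key hi hSi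
      rw [Finset.card_insert_of_notMem (by simp [ha])] at hk
      exact ⟨k, hk, hf⟩
    · rw [base S ha hbS] at hSi ⊢
      by_cases hib : i = b
      · subst hib
        rw [foldReplace_right hab] at hSi ⊢
        obtain ⟨k, hk, hf⟩ := hH.flatIn_left_right h hab rfl ha hbS hSi
        exact ⟨k, by omega, hf⟩
      · rw [foldReplace_of_ne hia hib] at hSi ⊢
        obtain ⟨k, hk, hf⟩ := hH.flatIn_left_inter h hab rfl ha hbS hiS hia hib hSi
        exact ⟨k, by omega, hf⟩
  by_cases hbS : b ∈ S
  · obtain ⟨S, hb, rfl⟩ := split S b hbS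
    have haS' : a ∉ S := fun h => haS (by simp [h])
    have hib : i ≠ b := fun h => hi (by simp [h])
    have hiS : i ∉ S := fun h => hi (by simp [h])
    rw [Finset.card_insert_of_notMem hb]
    rw [interOf_insert, foldReplace_right hab, base S haS' hb] at hSi ⊢
    by_cases hia : i = a
    · subst hia
      rw [foldReplace_left] at hSi ⊢
      obtain ⟨k, hk, hf⟩ := hH.flatIn_left_right h.swap hab rfl haS' hb hSi
      exact ⟨k, by omega, hf⟩
    · rw [foldReplace_of_ne hia hib] at hSi ⊢
      obtain ⟨k, hk, hf⟩ := hH.flatIn_left_inter h.swap hab rfl haS' hb hiS hia hib hSi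
      exact ⟨k, by omega, hf⟩
  rw [base S haS hbS] at hSi ⊢
  by_cases hia : i = a
  · subst hia
    rw [foldReplace_left] at hSi ⊢
    exact hH.flatIn_left h hab rfl haS hbS hSi
  by_cases hib : i = b
  · subst hib
    rw [foldReplace_right hab] at hSi ⊢
    exact hH.flatIn_left h.swap hab rfl haS hbS hSi
  rw [foldReplace_of_ne hia hib] at hSi ⊢
  exact hH.flat rfl hi hSi

end Replace

/-- `B` lies in one side of `A`, up to its intersection with `A`. -/
def OneSided {T : Type*} [TopologicalSpace T] (A B : Set T) : Prop :=
  ∃ K, IsPreconnected K ∧ Disjoint K A ∧ B \ A ⊆ K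

section OneSided

variable {T : Type*} [TopologicalSpace T]

theorem not_oneSided {A B : Set T} {w : T → ℝ} (hw : Continuous w) (hA : ∀ x, x ∈ A ↔ w x = 0)
    {p q : T} (hp : p ∈ B) (hq : q ∈ B) (hwp : w p < 0) (hwq : 0 < w q) : ¬OneSided A B := by
  rintro ⟨K, hK, hKA, hBK⟩
  have hpK : p ∈ K := hBK ⟨hp, fun h => hwp.ne ((hA p).1 h)⟩
  have hqK : q ∈ K := hBK ⟨hq, fun h => hwq.ne' ((hA q).1 h)⟩
  rcases forall_pos_or_forall_neg hK hw.continuousOn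
    (fun x hx h0 => disjoint_left.1 hKA hx ((hA x).2 h0)) with h | h
  · exact (h p hpK).not_gt hwp
  · exact (h q hqK).not_gt hwq

theorem OneSided.of_inter_eq {C P Q : Set T} (h : OneSided C P) (hPQ : C ∩ Q = C ∩ P) {z : T}
    (hzP : z ∈ P) (hzC : z ∉ C) (hc : IsPreconnected (insert z (Q \ P))) : OneSided C Q := by
  obtain ⟨K, hK, hKC, hPK⟩ := h
  refine ⟨K ∪ insert z (Q \ P), hK.union z (hPK ⟨hzP, hzC⟩) (mem_insert _ _) hc, ?_, ?_⟩
  · rw [disjoint_union_left, disjoint_insert_left]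
    refine ⟨hKC, hzC, disjoint_left.2 fun x hx hxC => hx.2 ?_⟩
    have h1 : x ∈ C ∩ Q := ⟨hxC, hx.1⟩
    rw [hPQ] at h1
    exact h1.2
  · intro x hx
    by_cases hxP : x ∈ P
    · exact .inl (hPK ⟨hxP, hx.2⟩)
    · exact .inr (.inr ⟨hx.1, hxP⟩)

variable {V : Type*} [NormedAddCommGroup V] [NormedSpace ℝ V]

theorem OneSided.of_crossChart {B C P Y : Set T} {e : Y ≃ₜ V × ℂ} (he : CrossChart B C e)
    (h : OneSided C P) (hP : Y ∩ B ⊆ P) : OneSided C Y := by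
  obtain ⟨K, hK, hKC, hPK⟩ := h
  set p : V × ℂ → T := fun y => (e.symm y : T) with hp
  have hpc : Continuous p := continuous_subtype_val.comp e.symm.continuous
  have hY : ∀ y, p y ∈ Y := fun y => (e.symm y).2
  have hB : ∀ y, p y ∈ B ↔ y.2.im = 0 := fun y => by simpa using he.1 (e.symm y)
  have hC : ∀ y, p y ∈ C ↔ y.2.re = 0 := fun y => by simpa using he.2 (e.symm y)
  have side : ∀ s : ℝ, s * s = 1 → ∀ K', IsPreconnected K' → K ⊆ K' →
      IsPreconnected (K' ∪ p '' {y | 0 < s * y.2.re + 0 * y.2.im}) := by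
    intro s hs K' hK' hKK'
    refine hK'.union (p (0, (s : ℂ))) (hKK' (hPK ⟨hP ⟨hY _, (hB _).2 (by simp)⟩, ?_⟩))
      ⟨_, by simp [hs], rfl⟩ ((convex_setOf_combo_pos s 0).isPreconnected.image p hpc.continuousOn)
    rw [hC]
    rintro h
    simp only [Complex.ofReal_re] at h
    simp [h] at hs
  have h1 := side 1 (by norm_num) K hK le_rfl
  have h2 := side (-1) (by norm_num) _ h1 subset_union_left
  have dis : ∀ s : ℝ, Disjoint (p '' {y | 0 < s * y.2.re + 0 * y.2.im}) C := by
    intro s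
    rw [disjoint_left]
    rintro _ ⟨y, hy, rfl⟩ hyC
    rw [hC] at hyC
    simp [hyC] at hy
  refine ⟨_, h2, ?_, ?_⟩
  · rw [disjoint_union_left, disjoint_union_left]
    exact ⟨⟨hKC, dis _⟩, dis _⟩
  · rintro x ⟨hxY, hxC⟩
    have hx : p (e ⟨x, hxY⟩) = x := by simp [hp]
    rw [← hx, hC] at hxC
    rcases lt_or_gt_of_ne hxC with h | h
    · exact .inr ⟨_, by simpa using h, hx⟩
    · exact .inl (.inr ⟨_, by simpa using h, hx⟩)

theorem isPreconnected_insert_realRay (v : V) (s : ℝ) :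
    IsPreconnected (insert (v, 0) (realRay V s)) := by
  refine isPreconnected_of_forall (v, 0) fun y hy => ?_
  refine ⟨segment ℝ (v, 0) y, ?_, left_mem_segment _ _ _, right_mem_segment _ _ _,
    (convex_segment _ _).isPreconnected⟩
  rcases hy with rfl | hy
  · simp
  rw [← insert_endpoints_openSegment]
  refine insert_subset (mem_insert _ _) (insert_subset (.inr hy) ?_)
  rintro _ ⟨a, b, -, hb, -, rfl⟩
  refine .inr ⟨by simp [hy.1], ?_⟩
  have h1 := mul_pos hb hy.2
  simp only [Prod.snd_add, Prod.smul_snd, smul_zero, zero_add, Complex.smul_re, smul_eq_mul]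
  linarith

/-- In a chart where `A` and `B` touch, and in which `U` is the imaginary hyperplane, if `U` is on
one side of `C` and meets it like `A` does, then `A` is on one side of `C`. -/
theorem OneSided.of_touch_left {A B C U : Set T} (e : T ≃ₜ V × ℂ)
    (hA : ∀ x, x ∈ A ↔ max (e x).2.re (e x).2.im = 0)
    (hB : ∀ x, x ∈ B ↔ min (e x).2.re (e x).2.im = 0) (hU : ∀ x, x ∈ U ↔ (e x).2.re = 0)
    (h : OneSided C U) (hC : C ∩ A = C ∩ U) {z : T} (hz : z ∈ A ∩ B) (hzC : z ∉ C) :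
    OneSided C A := by
  have hz1 := (hA z).1 hz.1
  have hz2 := (hB z).1 hz.2
  have hz3 : (e z).2.re = 0 := by
    rcases le_total (e z).2.re (e z).2.im with h | h <;> simp [h] at hz1 hz2 <;> assumption
  have hz4 : (e z).2.im = 0 := by
    rcases le_total (e z).2.re (e z).2.im with h | h <;> simp [h] at hz1 hz2 <;> assumption
  refine h.of_inter_eq hC ((hU z).2 hz3) hzC ?_
  have h1 : insert z (A \ U) = e.symm '' insert ((e z).1, 0) (realRay V (-1)) := by
    rw [image_insert_eq]
    have h2 : ((e z).1, (0 : ℂ)) = e z := Prod.ext rfl (Complex.ext hz3.symm hz4.symm)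
    rw [h2, e.symm_apply_apply]
    congr 1
    ext x
    rw [e.symm.image_eq_preimage_symm, Set.mem_sdiff, hA, hU]
    simp only [realRay, mem_preimage, Homeomorph.symm_symm, Set.mem_ofPred_eq, neg_mul, one_mul,
      neg_pos]
    constructor
    · rintro ⟨h3, h4⟩
      rcases le_total (e x).2.re (e x).2.im with h | h
      · rw [max_eq_right h] at h3
        exact ⟨h3, lt_of_le_of_ne (h3 ▸ h) h4⟩
      · rw [max_eq_left h] at h3
        exact absurd h3 h4
    · rintro ⟨h3, h4⟩
      rw [h3, max_eq_right h4.le]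
      exact ⟨rfl, h4.ne⟩
  rw [h1]
  exact (isPreconnected_insert_realRay _ _).image _ e.symm.continuous.continuousOn

theorem OneSided.of_touch_right {A B C U : Set T} (e : T ≃ₜ V × ℂ)
    (hA : ∀ x, x ∈ A ↔ max (e x).2.re (e x).2.im = 0)
    (hB : ∀ x, x ∈ B ↔ min (e x).2.re (e x).2.im = 0) (hU : ∀ x, x ∈ U ↔ (e x).2.re = 0)
    (h : OneSided C U) (hC : C ∩ B = C ∩ U) {z : T} (hz : z ∈ A ∩ B) (hzC : z ∉ C) :
    OneSided C B :=
  OneSided.of_touch_left (e.trans (Homeomorph.neg _)) (by simp [hB, max_neg_neg])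
    (by simp [hA, min_neg_neg]) (by simp [hU]) h hC hz.symm hzC

theorem oneSided_of_touch {A B : Set T} (e : T ≃ₜ V × ℂ)
    (hA : ∀ x, x ∈ A ↔ max (e x).2.re (e x).2.im = 0)
    (hB : ∀ x, x ∈ B ↔ min (e x).2.re (e x).2.im = 0) : OneSided A B := by
  have h1 := (convex_setOf_combo_pos (V := V) 1 0).isPreconnected.union (0, (1 + Complex.I))
    (by simp) (by simp) (convex_setOf_combo_pos (V := V) 0 1).isPreconnected
  refine ⟨_, h1.image e.symm e.symm.continuous.continuousOn, ?_, ?_⟩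
  · rw [disjoint_left]
    rintro _ ⟨y, hy, rfl⟩ hyA
    rw [hA, e.apply_symm_apply] at hyA
    have h2 := le_max_left y.2.re y.2.im
    have h3 := le_max_right y.2.re y.2.im
    simp only [one_mul, zero_mul, add_zero, zero_add, mem_union, Set.mem_ofPred_eq] at hy
    rcases hy with hy | hy <;> linarith
  · rintro x ⟨hxB, hxA⟩
    refine ⟨e x, ?_, e.symm_apply_apply x⟩
    rw [hA] at hxA
    rw [hB] at hxB
    have h2 : 0 < max (e x).2.re (e x).2.im :=
      lt_of_le_of_ne (hxB ▸ min_le_max) (Ne.symm hxA)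
    simpa using h2

end OneSided

/-- Double sums of symmetric functions vanishing on the diagonal strictly decrease if one
entry does, and its row and column do not increase on average. -/
theorem sum_sum_lt_of_pair {ι : Type*} [Fintype ι] [DecidableEq ι] {t t' : ι → ι → ℕ} {a b : ι}
    (hab : a ≠ b) (hs : ∀ i j, t i j = t j i) (hs' : ∀ i j, t' i j = t' j i)
    (hd : ∀ i, t' i i = t i i)
    (h : ∀ i j, i ≠ a → i ≠ b → j ≠ a → j ≠ b → t' i j = t i j)
    (hc : ∀ c, c ≠ a → c ≠ b → t' c a + t' c b ≤ t c a + t c b) (hlt : t' a b < t a b) :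
    ∑ i, ∑ j, t' i j < ∑ i, ∑ j, t i j := by
  set s : Finset ι := (Finset.univ.erase a).erase b with hs_def
  have hmem : ∀ i ∈ s, i ≠ a ∧ i ≠ b := fun i hi => by
    simp only [hs_def, Finset.mem_erase] at hi
    exact ⟨hi.2.1, hi.1⟩
  have exp : ∀ f : ι → ℕ, ∑ i, f i = f a + (f b + ∑ i ∈ s, f i) := fun f => by
    rw [hs_def, Finset.add_sum_erase _ _ (by simp [hab.symm]), Finset.add_sum_erase _ _ (by simp)]
  have exp2 : ∀ f : ι → ι → ℕ, (∀ i j, f i j = f j i) → ∑ i, ∑ j, f i j =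
      f a a + f b b + 2 * f a b + 2 * ∑ c ∈ s, (f c a + f c b) + ∑ i ∈ s, ∑ j ∈ s, f i j := by
    intro f hf
    have h1 : ∑ j ∈ s, f a j = ∑ c ∈ s, f c a := Finset.sum_congr rfl fun c _ => hf _ _
    have h2 : ∑ j ∈ s, f b j = ∑ c ∈ s, f c b := Finset.sum_congr rfl fun c _ => hf _ _
    simp only [exp, Finset.sum_add_distrib, h1, h2, hf b a]
    ring
  rw [exp2 t hs, exp2 t' hs', hd, hd]
  have h1 : ∑ c ∈ s, (t' c a + t' c b) ≤ ∑ c ∈ s, (t c a + t c b) :=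
    Finset.sum_le_sum fun c hc' => hc c (hmem c hc').1 (hmem c hc').2
  have h2 : ∑ i ∈ s, ∑ j ∈ s, t' i j = ∑ i ∈ s, ∑ j ∈ s, t i j :=
    Finset.sum_congr rfl fun i hi => Finset.sum_congr rfl fun j hj =>
      h i j (hmem i hi).1 (hmem i hi).2 (hmem j hj).1 (hmem j hj).2
  omega

/-- Two distinct members of a family meet without crossing. -/
def Tangent {ι T : Type*} [TopologicalSpace T] (H : ι → Set T) (i j : ι) : Prop :=
  i ≠ j ∧ (H i ∩ H j).Nonempty ∧ OneSided (H i) (H j)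

open Classical in
/-- The number of ordered pairs of members of a family that meet without crossing. -/
noncomputable def tangencyCount {ι T : Type*} [Fintype ι] [TopologicalSpace T]
    (H : ι → Set T) : ℕ :=
  ∑ i, ∑ j, if Tangent H i j then 1 else 0

theorem ite_one_zero_le_of_imp {p q : Prop} [Decidable p] [Decidable q] (h : p → q) :
    (if p then 1 else 0 : ℕ) ≤ if q then 1 else 0 := by
  split_ifs with hp hq
  · exact le_rfl
  · exact absurd (h hp) hq
  · exact zero_le_one
  · exact le_rfl

namespace IsSimpleFamily

variable {ι T : Type*} [DecidableEq ι] [TopologicalSpace T] {n : ℕ} {H : ι → Set T}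

theorem exists_chart_univ (hH : IsSimpleFamily n H) {a b : ι} (hab : a ≠ b)
    (hne : (H a ∩ H b).Nonempty) :
    ∃ k, k + 2 = n ∧ ∃ e : T ≃ₜ (Fin k → ℝ) × ℂ,
      ((∀ x, x ∈ H a ↔ (e x).2.im = 0) ∧ ∀ x, x ∈ H b ↔ (e x).2.re = 0) ∨
      ((∀ x, x ∈ H a ↔ max (e x).2.re (e x).2.im = 0) ∧
        ∀ x, x ∈ H b ↔ min (e x).2.re (e x).2.im = 0) := by
  obtain ⟨k, hk, e, he⟩ := hH.exists_chart (Y := univ) (S := ∅) (by simp [interOf]) hab (by simp)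
    (by simp) (by simpa using hne)
  refine ⟨k, by simpa using hk, (Homeomorph.Set.univ T).symm.trans e, ?_⟩
  exact he.imp (fun h => ⟨fun x => h.1 ⟨x, mem_univ x⟩, fun x => h.2 ⟨x, mem_univ x⟩⟩)
    fun h => ⟨fun x => h.1 ⟨x, mem_univ x⟩, fun x => h.2 ⟨x, mem_univ x⟩⟩

theorem tangent_symm (hH : IsSimpleFamily n H) {a b : ι} (h : Tangent H a b) : Tangent H b a := by
  obtain ⟨hab, hne, h1⟩ := h
  refine ⟨hab.symm, by rwa [inter_comm], ?_⟩
  obtain ⟨k, -, e, ⟨hA, hB⟩ | ⟨hA, hB⟩⟩ := hH.exists_chart_univ hab hne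
  · refine absurd h1 (not_oneSided (w := fun x => (e x).2.im) (by fun_prop) hA
      (p := e.symm (0, -Complex.I)) (q := e.symm (0, Complex.I)) ?_ ?_ ?_ ?_) <;> simp [hB]
  · exact oneSided_of_touch (e.trans (Homeomorph.neg _)) (by simp [hB, max_neg_neg])
      (by simp [hA, min_neg_neg])

variable {a b : ι} {u v : T → ℝ}

theorem tangent_of_hybrid (hH : IsSimpleFamily n H) (h : IsFold (H a) (H b) u v) (hab : a ≠ b)
    {c : ι} (hca : c ≠ a) (hcb : c ≠ b) {V : Type*} [NormedAddCommGroup V] {e : H c ≃ₜ V × ℂ}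
    (he : IsFold.Hybrid (H a) (H b) u v e) {P : Set T} (hP : OneSided (H c) P)
    (habP : H a ∩ H b ⊆ P) : Tangent H c a := by
  have hzc := (e.symm 0).2
  have hza := (he.1.1 (e.symm 0)).2 (by simp)
  have hzb := (he.1.2 (e.symm 0)).2 (by simp)
  obtain ⟨k, -, e₁, he₁⟩ := hH.exists_chart (Y := univ ∩ H a) (S := {a}) (a := b) (b := c)
    (by ext x; simp [interOf]) hcb.symm (by simpa using hab.symm) (by simpa using hca)
    ⟨_, ⟨⟨mem_univ _, hza⟩, hzb⟩, hzc⟩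
  have hc : univ ∩ H c = H c := univ_inter _
  have he' : IsFold.Hybrid (H a) (H b) u v ((Homeomorph.setCongr hc).trans e) :=
    ⟨⟨fun y => he.1.1 ⟨y, y.2.2⟩, fun y => he.1.2 ⟨y, y.2.2⟩⟩, fun y => he.2.1 ⟨y, y.2.2⟩,
      fun y => he.2.2 ⟨y, y.2.2⟩⟩
  have he₁' := he₁.resolve_right (h.not_touchChart he' e₁)
  have h1 := OneSided.of_crossChart he₁' hP (by simpa using habP)
  rw [univ_inter] at h1
  exact ⟨hca, ⟨_, hzc, hza⟩, h1⟩

open Classical in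
theorem tangencyCount_foldReplace_lt [PreconnectedSpace T] [Fintype ι] (hH : IsSimpleFamily n H)
    (hab : a ≠ b) {V : Type*}
    [NormedAddCommGroup V] [NormedSpace ℝ V] (e : T ≃ₜ V × ℂ)
    (hA : ∀ x, x ∈ H a ↔ max (e x).2.re (e x).2.im = 0)
    (hB : ∀ x, x ∈ H b ↔ min (e x).2.re (e x).2.im = 0) :
    tangencyCount (_root_.foldReplace H a b (fun x => (e x).2.re) fun x => (e x).2.im) <
      tangencyCount H := by
  set u : T → ℝ := fun x => (e x).2.re with hu
  set v : T → ℝ := fun x => (e x).2.im with hv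
  have h : IsFold (H a) (H b) u v := ⟨by fun_prop, by fun_prop, hA, hB⟩
  have h0 : (H a ∩ H b).Nonempty := ⟨e.symm 0, by simp [hA], by simp [hB]⟩
  have hH' := hH.foldReplace h hab h0
  have eqa : _root_.foldReplace H a b u v a = u ⁻¹' {0} := foldReplace_left
  have eqb : _root_.foldReplace H a b u v b = v ⁻¹' {0} := foldReplace_right hab
  have hU : ∀ x, x ∈ u ⁻¹' {0} ↔ (e x).2.re = 0 := fun x => Iff.rfl
  have hV : ∀ x, x ∈ v ⁻¹' {0} ↔ (e x).2.im = 0 := fun x => Iff.rfl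
  have hA' : ∀ x, x ∈ H a ↔ max ((e.trans (IsFold.swapFiber V)) x).2.re
      ((e.trans (IsFold.swapFiber V)) x).2.im = 0 := fun x => by
    rw [Homeomorph.trans_apply, IsFold.swapFiber_re, IsFold.swapFiber_im, max_comm, hA]
  have hB' : ∀ x, x ∈ H b ↔ min ((e.trans (IsFold.swapFiber V)) x).2.re
      ((e.trans (IsFold.swapFiber V)) x).2.im = 0 := fun x => by
    rw [Homeomorph.trans_apply, IsFold.swapFiber_re, IsFold.swapFiber_im, min_comm, hB]
  refine sum_sum_lt_of_pair hab
    (fun i j => if_congr ⟨hH.tangent_symm, hH.tangent_symm⟩ rfl rfl)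
    (fun i j => if_congr ⟨hH'.tangent_symm, hH'.tangent_symm⟩ rfl rfl)
    (fun i => by simp [Tangent]) (fun i j hia hib hja hjb => ?_) (fun c hca hcb => ?_) ?_
  · exact if_congr (by simp only [Tangent, foldReplace_of_ne hia hib, foldReplace_of_ne hja hjb])
      rfl rfl
  · have tca : Tangent (_root_.foldReplace H a b u v) c a ↔
        c ≠ a ∧ (H c ∩ u ⁻¹' {0}).Nonempty ∧ OneSided (H c) (u ⁻¹' {0}) := by
      rw [Tangent, eqa, foldReplace_of_ne hca hcb]
    have tcb : Tangent (_root_.foldReplace H a b u v) c b ↔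
        c ≠ b ∧ (H c ∩ v ⁻¹' {0}).Nonempty ∧ OneSided (H c) (v ⁻¹' {0}) := by
      rw [Tangent, eqb, foldReplace_of_ne hca hcb]
    obtain ⟨z, hz, hzc⟩ : ∃ z ∈ H a ∩ H b, z ∉ H c := by
      by_contra! hcon
      obtain ⟨w, hw⟩ := h0
      obtain ⟨k, -, φ, hφ⟩ := hH.flat (Y := H a ∩ H b) (S := {a, b}) (i := c)
        (by ext x; simp [interOf]) (by simp [hca, hcb]) ⟨w, hw, hcon w hw⟩
      have h1 := (hφ (φ.symm (0, 1))).1 (hcon _ (φ.symm (0, 1)).2)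
      simp at h1
    have inter : ∀ {s t : Set T}, (∀ x ∈ H c, x ∈ s ↔ x ∈ t) → H c ∩ s = H c ∩ t := fun hst => by
      ext x
      exact and_congr_right (hst x)
    rcases hH.trichotomy (Y := H c) (S := {c}) h hab (by ext x; simp [interOf])
      (by simpa using hca.symm) (by simpa using hcb.symm) with h1 | h1 | ⟨k, -, e', he'⟩
    · have i1 := inter fun x hx => (h1 x hx).1
      have i2 := inter fun x hx => (h1 x hx).2
      refine Nat.add_le_add ?_ ?_
      · refine ite_one_zero_le_of_imp fun h' => ?_
        obtain ⟨h2, h3, h4⟩ := tca.1 h'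
        refine ⟨h2, ?_, h4.of_touch_left e hA hB hU i1 hz hzc⟩
        rw [i1]
        exact h3
      · refine ite_one_zero_le_of_imp fun h' => ?_
        obtain ⟨h2, h3, h4⟩ := tcb.1 h'
        refine ⟨h2, ?_, h4.of_touch_right
          (e.trans (IsFold.swapFiber V)) hA' hB' hV i2 hz hzc⟩
        rw [i2]
        exact h3
    · have i1 := inter fun x hx => (h1 x hx).1
      have i2 := inter fun x hx => (h1 x hx).2
      rw [add_comm]
      refine Nat.add_le_add ?_ ?_
      · refine ite_one_zero_le_of_imp fun h' => ?_
        obtain ⟨h2, h3, h4⟩ := tcb.1 h'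
        refine ⟨hca, ?_, h4.of_touch_left
          (e.trans (IsFold.swapFiber V)) hA' hB' hV i1 hz hzc⟩
        rw [i1]
        exact h3
      · refine ite_one_zero_le_of_imp fun h' => ?_
        obtain ⟨h2, h3, h4⟩ := tca.1 h'
        refine ⟨hcb, ?_, h4.of_touch_right e hA hB hU i2 hz hzc⟩
        rw [i2]
        exact h3
    · have key : ∀ P, OneSided (H c) P → H a ∩ H b ⊆ P → Tangent H c a ∧ Tangent H c b :=
        fun P hP habP => ⟨hH.tangent_of_hybrid h hab hca hcb he' hP habP,
          hH.tangent_of_hybrid h.neg hab.symm hcb hca (IsFold.hybrid_neg he') hP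
            (by rwa [inter_comm])⟩
      have sU : H a ∩ H b ⊆ u ⁻¹' {0} := by rw [← h.inter_eq]; exact inter_subset_left
      have sV : H a ∩ H b ⊆ v ⁻¹' {0} := by rw [← h.inter_eq]; exact inter_subset_right
      by_cases hUV : OneSided (H c) (u ⁻¹' {0}) ∨ OneSided (H c) (v ⁻¹' {0})
      · have h2 : Tangent H c a ∧ Tangent H c b :=
          hUV.elim (fun h => key _ h sU) fun h => key _ h sV
        rw [if_pos h2.1, if_pos h2.2]
        split_ifs <;> omega
      · rw [not_or] at hUV
        rw [if_neg fun h => hUV.1 (tca.1 h).2.2, if_neg fun h => hUV.2 (tcb.1 h).2.2]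
        exact Nat.zero_le _
  · have h1 : Tangent H a b := ⟨hab, h0, oneSided_of_touch e hA hB⟩
    have h2 : ¬Tangent (_root_.foldReplace H a b u v) a b := by
      rintro ⟨-, -, h2⟩
      rw [eqa, eqb] at h2
      refine not_oneSided (w := u) h.cont_left (fun x => Iff.rfl) (p := e.symm (0, -1))
        (q := e.symm (0, 1)) ?_ ?_ ?_ ?_ h2 <;> simp [hu, hv]
    rw [if_pos h1, if_neg h2]
    exact one_pos

end IsSimpleFamily

theorem ncard_mem_foldReplace {ι T : Type*} [DecidableEq ι] [TopologicalSpace T] {H : ι → Set T}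
    {a b : ι} {u v : T → ℝ} (h : IsFold (H a) (H b) u v) (hab : a ≠ b) (x : T) :
    {i | x ∈ foldReplace H a b u v i}.ncard = {i | x ∈ H i}.ncard := by
  have ha : x ∈ foldReplace H a b u v a ↔ x ∈ u ⁻¹' {0} := by rw [foldReplace_left]
  have hb : x ∈ foldReplace H a b u v b ↔ x ∈ v ⁻¹' {0} := by rw [foldReplace_right hab]
  have hand : x ∈ u ⁻¹' {0} ∩ v ⁻¹' {0} ↔ x ∈ H a ∩ H b := by rw [h.inter_eq]
  have hor : x ∈ u ⁻¹' {0} ∪ v ⁻¹' {0} ↔ x ∈ H a ∪ H b := by rw [h.union_eq]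
  rw [Set.mem_inter_iff, Set.mem_inter_iff, ← ha, ← hb] at hand
  rw [Set.mem_union, Set.mem_union, ← ha, ← hb] at hor
  have hne : ∀ i, i ≠ a → i ≠ b → (x ∈ foldReplace H a b u v i ↔ x ∈ H i) := fun i hia hib => by
    rw [foldReplace_of_ne hia hib]
  by_cases hx : x ∈ foldReplace H a b u v a ↔ x ∈ H a
  · congr 1
    ext i
    change x ∈ foldReplace H a b u v i ↔ x ∈ H i
    by_cases hia : i = a
    · subst hia; exact hx
    by_cases hib : i = b
    · subst hib; tauto
    exact hne i hia hib
  · rw [← ncard_image_of_injective {i | x ∈ H i} (Equiv.swap a b).injective]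
    congr 1
    ext i
    rw [Equiv.image_eq_preimage_symm, Equiv.symm_swap]
    change x ∈ foldReplace H a b u v i ↔ x ∈ H (Equiv.swap a b i)
    by_cases hia : i = a
    · subst hia; rw [Equiv.swap_apply_left]; tauto
    by_cases hib : i = b
    · subst hib; rw [Equiv.swap_apply_right]; tauto
    rw [Equiv.swap_apply_of_ne_of_ne hia hib]
    exact hne i hia hib

/-- Any simple family can be replaced by one with the same multiplicities in which any two distinct
members that meet cross. -/
theorem IsSimpleFamily.exists_crossing {ι T : Type*} [Fintype ι] [TopologicalSpace T]
    [PreconnectedSpace T] {n : ℕ} {H : ι → Set T} (hH : IsSimpleFamily n H) :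
    ∃ H' : ι → Set T, IsSimpleFamily n H' ∧
      (∀ i j, i ≠ j → (H' i ∩ H' j).Nonempty → ∃ k, k + 2 = n ∧ ∃ e : T ≃ₜ (Fin k → ℝ) × ℂ,
        (∀ x, x ∈ H' i ↔ (e x).2.im = 0) ∧ ∀ x, x ∈ H' j ↔ (e x).2.re = 0) ∧
      ∀ x, {i | x ∈ H' i}.ncard = {i | x ∈ H i}.ncard := by
  classical
  induction hc : tangencyCount H using Nat.strong_induction_on generalizing H with
  | _ c ih =>
    subst hc
    by_cases hcross : ∀ i j, i ≠ j → (H i ∩ H j).Nonempty →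
        ∃ k, k + 2 = n ∧ ∃ e : T ≃ₜ (Fin k → ℝ) × ℂ,
          (∀ x, x ∈ H i ↔ (e x).2.im = 0) ∧ ∀ x, x ∈ H j ↔ (e x).2.re = 0
    · exact ⟨H, hH, hcross, fun x => rfl⟩
    push Not at hcross
    obtain ⟨a, b, hab, hne, hcross⟩ := hcross
    obtain ⟨k, hk, e, he | ⟨hA, hB⟩⟩ := hH.exists_chart_univ hab hne
    · obtain ⟨x, hx⟩ := hcross k hk e he.1
      have := he.2 x
      tauto
    have h : IsFold (H a) (H b) (fun x => (e x).2.re) fun x => (e x).2.im :=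
      ⟨by fun_prop, by fun_prop, hA, hB⟩
    obtain ⟨H', h1, h2, h3⟩ := ih _ (hH.tangencyCount_foldReplace_lt hab e hA hB)
      (hH.foldReplace h hab hne) rfl
    exact ⟨H', h1, h2, fun x => (h3 x).trans (ncard_mem_foldReplace h hab x)⟩

theorem Homeomorph.image_eq_of_mem_iff {X Y : Type*} [TopologicalSpace X] [TopologicalSpace Y]
    (e : X ≃ₜ Y) {A : Set X} {B : Set Y} (h : ∀ x, x ∈ A ↔ e x ∈ B) : e '' A = B := by
  rw [show A = e ⁻¹' B from Set.ext h, e.image_preimage]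

theorem mem_coordHyp {n i : ℕ} (hi : i < n) {x : Fin n → ℝ} : x ∈ coordHyp n i ↔ x ⟨i, hi⟩ = 0 :=
  ⟨fun h => h hi, fun h _ => h⟩

theorem exists_homeomorph_eq_of_hyperplane {m n a : ℕ}
    (hdim : ∀ d, Nonempty ((Fin n → ℝ) ≃ₜ (Fin d → ℝ)) → d = n) (hm : m ≤ n)
    (f : (Fin m → ℝ) ≃ₜ (Fin a → ℝ)) : a = m := by
  obtain ⟨c, rfl⟩ := Nat.exists_eq_add_of_le hm
  have := hdim (a + c) ⟨(Fin.appendHomeomorph m c).symm.trans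
    ((f.prodCongr (Homeomorph.refl _)).trans (Fin.appendHomeomorph a c))⟩
  omega

theorem FlatIn.isRelTopoplane {n k : ℕ} {Y H : Set (Fin n → ℝ)} (h : FlatIn (Fin k → ℝ) Y H) :
    IsRelTopoplane Y (H ∩ Y) := by
  obtain ⟨φ, hφ⟩ := h
  refine ⟨inter_subset_right, k + 1, by omega, φ.trans (prodHomeomorphFinSucc k),
    Homeomorph.image_eq_of_mem_iff _ fun y => ?_⟩
  rw [mem_coordHyp (Nat.succ_pos k)]
  exact (and_iff_left y.2).trans (hφ y)

theorem IsRelTopoplane.exists_flatIn {n : ℕ} {Y H : Set (Fin n → ℝ)}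
    (h : IsRelTopoplane Y (H ∩ Y)) : ∃ k, HasDim Y (k + 1) ∧ FlatIn (Fin k → ℝ) Y H := by
  obtain ⟨-, d, hd, φ, hφ⟩ := h
  obtain ⟨k, rfl⟩ := Nat.exists_eq_add_of_le' hd
  refine ⟨k, ⟨φ⟩, φ.trans (prodHomeomorphFinSucc k).symm, fun y => ?_⟩
  have h1 : φ y ∈ coordHyp (k + 1) 0 ↔ (y : Fin n → ℝ) ∈ H := by
    rw [← hφ, φ.injective.mem_set_image]
    exact and_iff_left y.2
  rw [← h1, mem_coordHyp (Nat.succ_pos k)]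
  rfl

theorem isFlat_range_iff {ι : Type*} [Fintype ι] {n : ℕ} {H : ι → Set (Fin n → ℝ)}
    {Y : Set (Fin n → ℝ)} :
    IsFlat (range H) Y ↔ ∃ S : Finset ι, Y = interOf H S ∧ Y.Nonempty := by
  classical
  constructor
  · rintro ⟨⟨𝓢, h𝓢, rfl⟩, hY⟩
    refine ⟨Finset.univ.filter fun i => H i ∈ 𝓢, ?_, hY⟩
    ext x
    simp only [interOf, mem_sInter, Finset.mem_filter, Finset.mem_univ, true_and,
      Set.mem_ofPred_eq]
    refine ⟨fun h i hi => h _ hi, fun h A hA => ?_⟩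
    obtain ⟨i, rfl⟩ := h𝓢 hA
    exact h i hA
  · rintro ⟨S, rfl, hY⟩
    refine ⟨⟨H '' S, image_subset_range _ _, ?_⟩, hY⟩
    ext x
    simp [interOf]

theorem hasDim_univ (n : ℕ) : HasDim (univ : Set (Fin n → ℝ)) n := ⟨Homeomorph.Set.univ _⟩

theorem interOf_empty {ι T : Type*} (H : ι → Set T) : interOf H ∅ = univ := by
  ext x
  simp [interOf]

namespace IsSimpleFamily

variable {ι : Type*} {n : ℕ} {H : ι → Set (Fin n → ℝ)}

theorem exists_hasDim (hH : IsSimpleFamily n H) (S : Finset ι)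
    (hne : (interOf H S).Nonempty) : ∃ d, d + S.card = n ∧ HasDim (interOf H S) d := by
  classical
  rcases S.eq_empty_or_nonempty with rfl | ⟨a, ha⟩
  · exact ⟨n, rfl, by rw [interOf_empty]; exact hasDim_univ n⟩
  · rw [← Finset.insert_erase ha, interOf_insert] at hne ⊢
    obtain ⟨k, hk, hf⟩ := hH.exists_flatIn _ a (Finset.notMem_erase a S) hne
    rw [Finset.card_insert_of_notMem (Finset.notMem_erase a S)]
    exact ⟨k, by omega, hf.nonempty_homeomorph⟩

theorem isTopoplane (hH : IsSimpleFamily n H) (i : ι) : IsTopoplane (H i) := by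
  obtain ⟨k, hk, φ, hφ⟩ := hH.exists_flatIn ∅ i (by simp)
    (by simpa [interOf_empty] using hH.nonempty i)
  obtain rfl : k + 1 = n := by simpa using hk
  refine ⟨(Homeomorph.Set.univ _).symm.trans ((Homeomorph.setCongr (interOf_empty H).symm).trans
    (φ.trans (prodHomeomorphFinSucc k))), Homeomorph.image_eq_of_mem_iff _ fun x => ?_⟩
  rw [mem_coordHyp (Nat.succ_pos k)]
  exact hφ ⟨x, by simp [interOf_empty]⟩

theorem isArrangement [Fintype ι] (hH : IsSimpleFamily n H) : IsArrangement (range H) := by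
  refine ⟨finite_range H, forall_mem_range.2 hH.isTopoplane, forall_mem_range.2 fun i Y hY => ?_⟩
  obtain ⟨S, rfl, -⟩ := isFlat_range_iff.1 hY
  by_cases hi : i ∈ S
  · exact .inl fun x hx => hx i hi
  rcases (interOf H S ∩ H i).eq_empty_or_nonempty with he | hne
  · exact .inr (.inl (by rwa [inter_comm]))
  · obtain ⟨k, -, hf⟩ := hH.exists_flatIn S i hi hne
    exact .inr (.inr hf.isRelTopoplane)

theorem mem_skeleton_iff [Fintype ι] (hH : IsSimpleFamily n H)
    (hdim : ∀ d, HasDim (univ : Set (Fin n → ℝ)) d → d = n) {k : ℕ} {x : Fin n → ℝ} :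
    x ∈ skeleton (range H) k ↔ n ≤ k + {i | x ∈ H i}.ncard := by
  classical
  constructor
  · rintro ⟨Y, ⟨hY, d, hd, ⟨f⟩⟩, hx⟩
    obtain ⟨S, rfl, hne⟩ := isFlat_range_iff.1 hY
    obtain ⟨d', hd', ⟨f'⟩⟩ := hH.exists_hasDim S hne
    have h1 : d = d' := exists_homeomorph_eq_of_hyperplane
      (fun c ⟨g⟩ => hdim c ⟨(Homeomorph.Set.univ _).trans g⟩) (by omega) (f'.symm.trans f)
    have h2 := ncard_le_ncard (s := (S : Set ι)) (t := {i | x ∈ H i}) hx (toFinite _)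
    rw [ncard_coe_finset] at h2
    omega
  · intro hk
    have hx : x ∈ interOf H {i | x ∈ H i}.toFinset := fun i hi => by simpa using hi
    obtain ⟨d, hd, hf⟩ := hH.exists_hasDim _ ⟨x, hx⟩
    rw [← ncard_eq_toFinset_card'] at hd
    exact ⟨_, ⟨isFlat_range_iff.2 ⟨_, rfl, x, hx⟩, d, by omega, hf⟩, hx⟩

end IsSimpleFamily

theorem crosses_of_chart {k : ℕ} {A B : Set (Fin (k + 2) → ℝ)}
    (e : (Fin (k + 2) → ℝ) ≃ₜ (Fin k → ℝ) × ℂ) (hA : ∀ x, x ∈ A ↔ (e x).2.im = 0)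
    (hB : ∀ x, x ∈ B ↔ (e x).2.re = 0) : Crosses A B := by
  refine ⟨e.trans ((prodComplex _).symm.trans (((prodHomeomorphFinSucc k).prodCongr
    (Homeomorph.refl ℝ)).trans (prodHomeomorphFinSucc (k + 1)))),
    Homeomorph.image_eq_of_mem_iff _ fun x => ?_, Homeomorph.image_eq_of_mem_iff _ fun x => ?_⟩
  · rw [mem_coordHyp (by omega)]
    exact hA x
  · rw [mem_coordHyp (by omega)]
    exact hB x

theorem IsArrangement.isSimpleFamily {n : ℕ} {𝓗 : Set (Set (Fin n → ℝ))}
    (h𝓗 : IsArrangement 𝓗)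
    (hsimple : ∀ Y : Set (Fin n → ℝ), IsFlat 𝓗 Y → ∀ d : ℕ, HasDim Y d →
      {H | H ∈ 𝓗 ∧ Y ⊆ H}.ncard + d = n) :
    IsSimpleFamily n (Subtype.val : 𝓗 → Set (Fin n → ℝ)) := by
  classical
  have : Fintype 𝓗 := h𝓗.1.fintype
  have isFlat : ∀ S : Finset 𝓗, (interOf Subtype.val S).Nonempty →
      IsFlat 𝓗 (interOf Subtype.val S) := fun S hS => by
    have := isFlat_range_iff.2 ⟨S, rfl, hS⟩
    rwa [Subtype.range_val] at this
  have flat : ∀ (S : Finset 𝓗) (d : ℕ) (i : 𝓗), HasDim (interOf Subtype.val S) d →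
      d + S.card = n → i ∉ S → (interOf Subtype.val S ∩ i.1).Nonempty →
      ∃ k, k + 1 + S.card = n ∧ FlatIn (Fin k → ℝ) (interOf Subtype.val S) i.1 := by
    intro S d i hd hdS hi hne
    have hS := isFlat S (hne.mono inter_subset_left)
    rcases h𝓗.2.2 i i.2 _ hS with h1 | h1 | h1
    · have h2 := ncard_le_ncard (s := Subtype.val '' ((insert i S : Finset 𝓗) : Set 𝓗))
        (t := {H | H ∈ 𝓗 ∧ interOf Subtype.val S ⊆ H}) ?_ (h𝓗.1.subset fun H hH => hH.1)
      · rw [ncard_image_of_injective _ Subtype.val_injective, ncard_coe_finset,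
          Finset.card_insert_of_notMem hi] at h2
        have := hsimple _ hS d hd
        omega
      · rintro _ ⟨j, hj, rfl⟩
        refine ⟨j.2, ?_⟩
        rcases Finset.mem_insert.1 hj with rfl | hj
        · exact h1
        · exact fun x hx => hx j hj
    · rw [inter_comm] at h1
      exact absurd h1 hne.ne_empty
    · obtain ⟨k, hk, hf⟩ := h1.exists_flatIn
      have h2 := hsimple _ hS d hd
      have h3 := hsimple _ hS (k + 1) hk
      exact ⟨k, by omega, hf⟩
  have dim : ∀ S : Finset 𝓗, (interOf Subtype.val S).Nonempty →
      ∃ d, d + S.card = n ∧ HasDim (interOf Subtype.val S) d := by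
    intro S
    induction S using Finset.induction_on with
    | empty => exact fun _ => ⟨n, rfl, by rw [interOf_empty]; exact hasDim_univ n⟩
    | insert a S ha ih =>
      intro hne
      rw [interOf_insert] at hne ⊢
      obtain ⟨d, hd, hd'⟩ := ih (hne.mono inter_subset_left)
      obtain ⟨k, hk, hf⟩ := flat S d a hd' hd ha hne
      rw [Finset.card_insert_of_notMem ha]
      exact ⟨k, by omega, hf.nonempty_homeomorph⟩
  refine ⟨fun i => ?_, fun S i hi hne => ?_⟩
  · obtain ⟨e, he⟩ := h𝓗.2.1 i i.2
    obtain ⟨x, hx, -⟩ := he.superset (show (0 : Fin n → ℝ) ∈ coordHyp n 0 from fun _ => rfl)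
    exact ⟨x, hx⟩
  · obtain ⟨d, hd, hd'⟩ := dim S (hne.mono inter_subset_left)
    exact flat S d i hd' hd hi hne

/-- if `𝓗` is a simple arrangement of topoplanes in `ℝⁿ` (for every flat `Y`,
the number of topoplanes of `𝓗` containing `Y` equals `n - dim Y`), then there is an affine
arrangement of topoplanes `𝓗'` whose `k`-skeleton equals that of `𝓗` for all `0 ≤ k ≤ n`. -/
theorem statement9 {n : ℕ} (hn : 1 ≤ n) (𝓗 : Set (Set (Fin n → ℝ)))
    (h𝓗 : IsArrangement 𝓗)
    (hsimple : ∀ Y : Set (Fin n → ℝ), IsFlat 𝓗 Y → ∀ d : ℕ, HasDim Y d →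
      {H | H ∈ 𝓗 ∧ Y ⊆ H}.ncard + d = n) :
    ∃ 𝓗' : Set (Set (Fin n → ℝ)), IsArrangement 𝓗' ∧ PairwiseAffine 𝓗' ∧
      ∀ k ≤ n, skeleton 𝓗' k = skeleton 𝓗 k := by
  have : Fintype 𝓗 := h𝓗.1.fintype
  have hH := h𝓗.isSimpleFamily hsimple
  have hdim : ∀ d, HasDim (univ : Set (Fin n → ℝ)) d → d = n := fun d hd => by
    have hu : IsFlat 𝓗 univ := ⟨⟨∅, empty_subset _, sInter_empty.symm⟩, univ_nonempty⟩
    have h1 := hsimple _ hu d hd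
    have h2 := hsimple _ hu n (hasDim_univ n)
    omega
  obtain ⟨H', h1, h2, h3⟩ := hH.exists_crossing
  refine ⟨range H', h1.isArrangement, ?_, fun k _ => ?_⟩
  · rintro _ ⟨i, rfl⟩ _ ⟨j, rfl⟩ hij
    rcases (H' i ∩ H' j).eq_empty_or_nonempty with he | hne
    · exact .inl he
    · obtain ⟨m, rfl, e, hA, hB⟩ := h2 i j (fun h => hij (by rw [h])) hne
      exact .inr (crosses_of_chart e hA hB)
  · conv_rhs => rw [← Subtype.range_val (s := 𝓗)]
    ext x
    rw [h1.mem_skeleton_iff hdim, hH.mem_skeleton_iff hdim, h3]
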